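/- Let b = 0 and fix A ∈ ℝ, with β = 1 + γ²(𝔠_γ + A). There exists k₀ ∈ ℕ such that for every integer k ≥ k₀, limsup_{γ→0} E^γ_{β,0}[ Σ_{ω∈ℤ²} (1+|ω|²)^{−k} |ĝ_σ(ω)|² ] < ∞, where g_σ: 𝕋² → ℝ is the step function g_σ(x) = γ^{−1} σ_{⌊ε^{−1}x⌋} and ĝ_σ(ω) = ∫_{𝕋²} g_σ(x) e^{−iπω·x} dx; i.e., the second moment of the H^{−k}(𝕋²)-norm of the rescaled spin field is bounded uniformly as γ → 0. -/

import Mathlib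

open scoped BigOperators ENNReal
open MeasureTheory

noncomputable section

namespace IsingKac

/-- The periodic lattice `Λ_N = {1-N, …, N}²`, realised as `(ℤ/2Nℤ)²`. -/
abbrev Lat (N : ℕ) : Type := ZMod (2*N) × ZMod (2*N)

instance latNeZero (N : ℕ) [NeZero N] : NeZero (2*N) := ⟨by have := NeZero.ne N; omega⟩

/-- The representative of `v ∈ ℤ/2Nℤ` lying in `{1-N, …, N}`. -/
def latRep (N : ℕ) (v : ZMod (2*N)) : ℤ :=
  if (v.val : ℤ) ≤ (N : ℤ) then (v.val : ℤ) else (v.val : ℤ) - 2*N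

def latRep2 (N : ℕ) (z : Lat N) : ℤ × ℤ := (latRep N z.1, latRep N z.2)

/-- The character `e_w(x) = exp(iπ w·x)`. -/
def eW (w : ℤ × ℤ) (x : ℝ × ℝ) : ℂ :=
  Complex.exp ((Real.pi : ℂ) * Complex.I * ((w.1 : ℂ) * (x.1 : ℂ) + (w.2 : ℂ) * (x.2 : ℂ)))

/-- The point `ε z ∈ Λ_ε ⊂ 𝕋²` corresponding to `z ∈ Λ_N` (with `ε = 1/N`). -/
def latPt (N : ℕ) (z : Lat N) : ℝ × ℝ :=
  ((latRep N z.1 : ℝ) / N, (latRep N z.2 : ℝ) / N)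

/-- Discrete Fourier coefficient `f̂(w) = Σ_{x ∈ Λ_ε} ε² f(x) e^{-iπ w·x}`. -/
def dFT (N : ℕ) [NeZero N] (f : Lat N → ℂ) (w : ℤ × ℤ) : ℂ :=
  ∑ z : Lat N, ((N : ℂ)^2)⁻¹ * f z * (starRingEnd ℂ) (eW w (latPt N z))

/-- The extension operator `(Ex f)(x) = (1/4) Σ_{w ∈ Λ_N} f̂(w) e^{iπ w·x}` for `x ∈ 𝕋²`. -/
def Ex (N : ℕ) [NeZero N] (f : Lat N → ℂ) (x : ℝ × ℝ) : ℂ :=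
  (1/4 : ℂ) * ∑ z : Lat N, dFT N f (latRep2 N z) * eW (latRep2 N z) x

/-- Discrete `L^p` norm on `Λ_ε`, `p ∈ [1,∞]`. -/
def dLp (N : ℕ) [NeZero N] (p : ℝ≥0∞) {E : Type*} [NormedAddCommGroup E]
    (f : Lat N → E) : ℝ :=
  if p = ∞ then ⨆ z : Lat N, ‖f z‖
  else (∑ z : Lat N, ((N : ℝ)^2)⁻¹ * ‖f z‖ ^ p.toReal) ^ (1/p.toReal)

/-- Fundamental domain of the torus `𝕋² = [-1,1]²`. -/
def box : Set (ℝ × ℝ) := Set.Icc (-1 : ℝ) 1 ×ˢ Set.Icc (-1 : ℝ) 1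

/-- `L^p(𝕋²)` norm, `p ∈ [1,∞]`. -/
def cLp (p : ℝ≥0∞) {E : Type*} [NormedAddCommGroup E] (g : ℝ × ℝ → E) : ℝ≥0∞ :=
  eLpNorm g p (volume.restrict box)

/-- Euclidean norm on `ℝ²`. -/
def enorm2 (r : ℝ × ℝ) : ℝ := Real.sqrt (r.1^2 + r.2^2)

/-- A Littlewood–Paley partition of unity `(χ̃, χ)` on `ℝ²`. -/
structure LPpartition : Type where
  chit : ℝ × ℝ → ℝ
  chi : ℝ × ℝ → ℝ
  cont_t : Continuous chit
  cont : Continuous chi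
  mem_t : ∀ r, chit r ∈ Set.Icc (0:ℝ) 1
  mem : ∀ r, chi r ∈ Set.Icc (0:ℝ) 1
  supp_t : ∀ r : ℝ × ℝ, 4/3 < enorm2 r → chit r = 0
  supp : ∀ r : ℝ × ℝ, enorm2 r < 3/4 ∨ 8/3 < enorm2 r → chi r = 0
  partition : ∀ r : ℝ × ℝ, chit r + ∑' k : ℕ, chi ((2:ℝ)^(-(k:ℤ)) • r) = 1

/-- `χ_k`, for `k ≥ -1`. -/
def LPchi (P : LPpartition) (k : ℤ) : ℝ × ℝ → ℝ :=
  if k = -1 then P.chit else fun r => P.chi ((2:ℝ)^(-k) • r)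

/-- The Littlewood–Paley block `δ_k (Ex f)` of (the extension of) a lattice function. -/
def dBlock (N : ℕ) [NeZero N] (P : LPpartition) (k : ℤ) (f : Lat N → ℂ) (x : ℝ × ℝ) : ℂ :=
  (1/4 : ℂ) * ∑ z : Lat N,
    ((LPchi P k ((latRep N z.1 : ℝ), (latRep N z.2 : ℝ)) : ℝ) : ℂ) *
      dFT N f (latRep2 N z) * eW (latRep2 N z) x

/-- Discrete Besov norm `‖f‖_{B^ν_{p,q}(Λ_ε)}`. -/
def dBesov (N : ℕ) [NeZero N] (P : LPpartition) (ν : ℝ) (p q : ℝ≥0∞) (f : Lat N → ℂ) : ℝ :=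
  if q = ∞ then
    ⨆ k : ℕ, (2:ℝ)^(ν * ((k:ℝ) - 1)) * dLp N p (fun z => dBlock N P ((k:ℤ)-1) f (latPt N z))
  else
    (∑' k : ℕ, ((2:ℝ)^(ν * ((k:ℝ) - 1)) *
      dLp N p (fun z => dBlock N P ((k:ℤ)-1) f (latPt N z))) ^ q.toReal) ^ (1/q.toReal)

/-- The `C^{-ν}` (Besov–Hölder) norm of the extension `Ex f`:
`sup_{k ≥ -1} 2^{-νk} ‖δ_k (Ex f)‖_{L^∞(𝕋²)}`. -/
def holderNeg (N : ℕ) [NeZero N] (P : LPpartition) (ν : ℝ) (f : Lat N → ℂ) : ℝ :=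
  ⨆ k : ℕ, (2:ℝ)^(-ν * ((k:ℝ) - 1)) * ⨆ x : ℝ × ℝ, ‖dBlock N P ((k:ℤ)-1) f x‖

/-- Spin values. -/
def spin (s : Bool) : ℝ := if s then 1 else -1

/-- Hamiltonian `H(σ) = (β/2) Σ_{x,y} k(x-y) σ_x σ_y + b Σ_x σ_x`. -/
def hamil (N : ℕ) [NeZero N] (kk : Lat N → ℝ) (β b : ℝ) (σ : Lat N → ℝ) : ℝ :=
  β/2 * ∑ x : Lat N, ∑ y : Lat N, kk (x - y) * σ x * σ y + b * ∑ x : Lat N, σ x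

/-- Gibbs expectation `E^γ_{β,b}[F]`. -/
def gibbsE (N : ℕ) [NeZero N] (kk : Lat N → ℝ) (β b : ℝ) (F : (Lat N → ℝ) → ℝ) : ℝ :=
  (∑ s : Lat N → Bool, Real.exp (hamil N kk β b (fun x => spin (s x))) * F (fun x => spin (s x))) /
  (∑ s : Lat N → Bool, Real.exp (hamil N kk β b (fun x => spin (s x))))

/-- The profile `𝔎 : ℝ² → [0,1]`, twice differentiable, radial, supported in `B(0,3)`,
not identically zero. -/
structure KacProfile : Type where
  f : ℝ × ℝ → ℝ
  smooth : ContDiff ℝ 2 f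
  mem : ∀ x, f x ∈ Set.Icc (0:ℝ) 1
  radial : ∀ x y : ℝ × ℝ, enorm2 x = enorm2 y → f x = f y
  supp : ∀ x : ℝ × ℝ, 3 < enorm2 x → f x = 0
  nontriv : ∃ x, f x ≠ 0

/-- The Kac kernel `k_γ(z) = c γ² 𝔎(γ·z)` (shortest periodic representative), `k_γ(0)=0`. -/
def kGamma (𝔎 : KacProfile) (N : ℕ) (c γ : ℝ) (z : Lat N) : ℝ :=
  if z = 0 then 0 else c * γ^2 * 𝔎.f (γ * (latRep N z.1 : ℝ), γ * (latRep N z.2 : ℝ))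

/-- `γ = N^{-1/2}`, so that `γ² = ε = 1/N`. -/
def gam (N : ℕ) : ℝ := Real.sqrt ((N : ℝ)⁻¹)

/-- Fourier transform `K̂_γ(ω) = Σ_z k_γ(z) e^{-iπ ω·(εz)}` of the macroscopic kernel
(real, since the kernel is even). -/
def kHat (N : ℕ) [NeZero N] (kk : Lat N → ℝ) (ω : ℤ × ℤ) : ℝ :=
  ∑ z : Lat N, kk z *
    Real.cos (Real.pi * ((ω.1 : ℝ) * (latRep N z.1 : ℝ) / N + (ω.2 : ℝ) * (latRep N z.2 : ℝ) / N))

/-- The renormalisation constant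
`𝔠_γ = (1/4) Σ_{ω ∈ Λ_N \ {0}} |K̂_γ(ω)|² / (γ^{-2} (1-K̂_γ(ω)))`. -/
def cGamma (N : ℕ) [NeZero N] (kk : Lat N → ℝ) (γ : ℝ) : ℝ :=
  (1/4) * ∑ z : Lat N, if z = (0 : Lat N) then 0 else
    (kHat N kk (latRep2 N z))^2 / ((γ^2)⁻¹ * (1 - kHat N kk (latRep2 N z)))

/-- Critical inverse temperature `β = 1 + γ²(𝔠_γ + A)`. -/
def betaCrit (𝔎 : KacProfile) (N : ℕ) [NeZero N] (c A : ℝ) : ℝ :=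
  1 + (gam N)^2 * (cGamma N (kGamma 𝔎 N c (gam N)) (gam N) + A)

/-- The fluctuation field `X_γ(x) = γ^{-1} Σ_z k_γ(ε^{-1}x - z) σ_z`, as a function on `Λ_N`. -/
def fluct (N : ℕ) [NeZero N] (kk : Lat N → ℝ) (γ : ℝ) (σ : Lat N → ℝ) (z : Lat N) : ℝ :=
  γ⁻¹ * ∑ y : Lat N, kk (z - y) * σ y

/-- The rescaled step field `γ^{-1} σ_{⌊ε^{-1}x⌋}` on the torus (without the `γ^{-1}`). -/
def stepField (N : ℕ) (σ : Lat N → ℝ) (x : ℝ × ℝ) : ℝ :=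
  σ (((⌊(N : ℝ) * x.1⌋ : ℤ) : ZMod (2*N)), ((⌊(N : ℝ) * x.2⌋ : ℤ) : ZMod (2*N)))

/-- Fourier coefficient on the torus: `ĝ(ω) = ∫_{𝕋²} g(x) e^{-iπω·x} dx`. -/
def cFT (g : ℝ × ℝ → ℂ) (ω : ℤ × ℤ) : ℂ :=
  ∫ x in box, g x * (starRingEnd ℂ) (eW ω x)


/-! ### Additional definitions -/

/-- Nearest-neighbour Dirichlet sum `Σ_{x,y ∈ Λ_ε, |x-y|=ε} ε² (f(y)-f(x))²`. -/
def nnSum (N : ℕ) [NeZero N] (f : Lat N → ℝ) : ℝ :=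
  ∑ x : Lat N, ((N : ℝ)^2)⁻¹ *
    ((f (x + (1, 0)) - f x)^2 + (f (x + (0, 1)) - f x)^2 +
     (f (x - (1, 0)) - f x)^2 + (f (x - (0, 1)) - f x)^2)

/-- The `d`-dimensional periodic lattice `Λ_N^d`. -/
abbrev LatD (d N : ℕ) : Type := Fin d → ZMod (2*N)

/-- Discrete `L^p` norm on `Λ_ε^d`, `p ∈ [1,∞]`. -/
def dLpD (d N : ℕ) [NeZero N] (p : ℝ≥0∞) (f : LatD d N → ℂ) : ℝ :=
  if p = ∞ then ⨆ z : LatD d N, ‖f z‖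
  else (∑ z : LatD d N, ((N : ℝ)^d)⁻¹ * ‖f z‖ ^ p.toReal) ^ (1/p.toReal)

/-- `Σ_{w ∈ Λ_N^d} χ(λ w) e_w`, evaluated at the lattice point `ε z ∈ Λ_ε^d`. -/
def gLam (d N : ℕ) [NeZero N] (χ : (Fin d → ℝ) → ℝ) (lam : ℝ) (z : LatD d N) : ℂ :=
  ∑ w : LatD d N, ((χ (fun i => lam * (latRep N (w i) : ℝ)) : ℝ) : ℂ) *
    Complex.exp ((Real.pi : ℂ) * Complex.I *
      ((∑ i : Fin d, (latRep N (w i) : ℝ) * ((latRep N (z i) : ℝ) / N) : ℝ) : ℂ))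

/-- Second partial derivative of `φ` in directions `v, w`. -/
def pd2 (φ : ℝ × ℝ → ℝ) (v w : ℝ × ℝ) : ℝ × ℝ → ℝ :=
  fun x => fderiv ℝ (fun y => fderiv ℝ φ y v) x w

/-- `max_{i,j ∈ {1,2}} ‖∂_i ∂_j φ‖_{L^∞}`. -/
def secondDerivBound (φ : ℝ × ℝ → ℝ) : ℝ :=
  max (max (⨆ x : ℝ × ℝ, |pd2 φ (1,0) (1,0) x|) (⨆ x : ℝ × ℝ, |pd2 φ (1,0) (0,1) x|))
      (max (⨆ x : ℝ × ℝ, |pd2 φ (0,1) (1,0) x|) (⨆ x : ℝ × ℝ, |pd2 φ (0,1) (0,1) x|))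

/-- The Littlewood–Paley block `δ_k g` of a function on the torus. -/
def cBlock (P : LPpartition) (k : ℤ) (g : ℝ × ℝ → ℂ) (x : ℝ × ℝ) : ℂ :=
  (1/4 : ℂ) * ∑' ω : ℤ × ℤ, ((LPchi P k ((ω.1 : ℝ), (ω.2 : ℝ)) : ℝ) : ℂ) * cFT g ω * eW ω x

/-- Besov norm `‖g‖_{B^ν_{1,1}(𝕋²)} = Σ_{k ≥ -1} 2^{νk} ‖δ_k g‖_{L¹(𝕋²)}`. -/
def cBesov11 (P : LPpartition) (ν : ℝ) (g : ℝ × ℝ → ℂ) : ℝ :=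
  ∑' k : ℕ, (2:ℝ) ^ (ν * ((k:ℝ) - 1)) * ∫ x in box, ‖cBlock P ((k:ℤ)-1) g x‖

open scoped NNReal

set_option linter.all false

/-! ### General Ising model -/

/-- spin at a vertex -/
def sg {V : Type*} (s : V → Bool) (x : V) : ℝ := spin (s x)

/-- product of spins along a list -/
def mon {V : Type*} (l : List V) (s : V → Bool) : ℝ := (l.map (sg s)).prod

/-- pointwise product of configurations -/
def cm {V : Type*} (s t : V → Bool) : V → Bool := fun x => (s x == t x)

section ising
variable {V : Type*}

lemma sg_sq (s : V → Bool) (x : V) : sg s x * sg s x = 1 := by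
  unfold sg spin; split_ifs <;> norm_num

lemma sg_cases (s : V → Bool) (x : V) : sg s x = 1 ∨ sg s x = -1 := by
  unfold sg spin; split_ifs <;> simp

lemma sg_cm (s t : V → Bool) (x : V) : sg (cm s t) x = sg s x * sg t x := by
  unfold sg spin cm; cases s x <;> cases t x <;> simp

lemma mon_nil (s : V → Bool) : mon [] s = 1 := rfl
lemma mon_cons (x : V) (l : List V) (s : V → Bool) : mon (x :: l) s = sg s x * mon l s := by
  simp [mon]
lemma mon_append (l m : List V) (s : V → Bool) : mon (l ++ m) s = mon l s * mon m s := by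
  simp [mon]
lemma mon_cm (l : List V) (s t : V → Bool) : mon l (cm s t) = mon l s * mon l t := by
  induction l with
  | nil => simp [mon_nil]
  | cons x l ih => simp only [mon_cons, sg_cm, ih]; ring
lemma mon_cases (l : List V) (s : V → Bool) : mon l s = 1 ∨ mon l s = -1 := by
  induction l with
  | nil => simp [mon_nil]
  | cons x l ih =>
    rw [mon_cons]; rcases sg_cases s x with h | h <;> rcases ih with h' | h' <;> simp [h, h']
lemma mon_sq (l : List V) (s : V → Bool) : mon l s * mon l s = 1 := by
  rcases mon_cases l s with h | h <;> simp [h]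
lemma mon_le_one (l : List V) (s : V → Bool) : mon l s ≤ 1 := by
  rcases mon_cases l s with h | h <;> simp [h]

lemma cm_cm (s t : V → Bool) : cm (cm s t) t = s := by
  funext x; unfold cm; cases s x <;> cases t x <;> rfl
lemma cm_comm (s t : V → Bool) : cm s t = cm t s := by
  funext x; unfold cm; cases s x <;> cases t x <;> rfl
lemma cm_cm' (s t : V → Bool) : cm s (cm s t) = t := by
  funext x; unfold cm; cases s x <;> cases t x <;> rfl

variable [Fintype V] [DecidableEq V]

lemma sum_cm {M : Type*} [AddCommMonoid M] (t : V → Bool) (F : (V → Bool) → M) :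
    ∑ s, F (cm s t) = ∑ s, F s :=
  Equiv.sum_comp (Function.Involutive.toPerm (fun s => cm s t) (fun s => cm_cm s t)) F

lemma sum_cm' {M : Type*} [AddCommMonoid M] (t : V → Bool) (F : (V → Bool) → M) :
    ∑ s, F (cm t s) = ∑ s, F s := by
  rw [← sum_cm t F]; simp only [cm_comm]

lemma sum_mon_nonneg (l : List V) : 0 ≤ ∑ s : V → Bool, mon l s := by
  by_cases h : ∃ q : V → Bool, mon l q = -1
  · obtain ⟨q, hq⟩ := h
    have := sum_cm q (mon l)
    simp only [mon_cm, hq, mul_neg, mul_one, Finset.sum_neg_distrib] at this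
    linarith
  · push Not at h
    refine Finset.sum_nonneg fun s _ => ?_
    rcases mon_cases l s with h' | h'
    · rw [h']; norm_num
    · exact absurd h' (h s)

/-- A1 -/
lemma pos_prod (T : Finset (V × V)) (a b : V × V → ℝ) (ha : ∀ e, 0 ≤ a e) (hb : ∀ e, 0 ≤ b e) :
    ∀ l : List V, 0 ≤ ∑ s : V → Bool, mon l s * ∏ e ∈ T, (a e + b e * (sg s e.1 * sg s e.2)) := by
  induction T using Finset.induction_on with
  | empty => intro l; simpa using sum_mon_nonneg l
  | insert e T he ih =>
    intro l
    have : ∀ s : V → Bool, mon l s * ∏ e ∈ insert e T, (a e + b e * (sg s e.1 * sg s e.2)) =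
        a e * (mon l s * ∏ e ∈ T, (a e + b e * (sg s e.1 * sg s e.2))) +
        b e * (mon (e.1 :: e.2 :: l) s * ∏ e ∈ T, (a e + b e * (sg s e.1 * sg s e.2))) := by
      intro s; rw [Finset.prod_insert he]; simp only [mon_cons]; ring
    simp only [this, Finset.sum_add_distrib, ← Finset.mul_sum]
    exact add_nonneg (mul_nonneg (ha e) (ih _)) (mul_nonneg (hb e) (ih _))

/-- energy and weight -/
def en (J : V × V → ℝ) (s : V → Bool) : ℝ := ∑ e : V × V, J e * (sg s e.1 * sg s e.2)
def wt (J : V × V → ℝ) (s : V → Bool) : ℝ := Real.exp (en J s)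
def Zp (J : V × V → ℝ) : ℝ := ∑ s : V → Bool, wt J s
def ev (J : V × V → ℝ) (F : (V → Bool) → ℝ) : ℝ := (∑ s, wt J s * F s) / Zp J

lemma wt_pos (J : V × V → ℝ) (s : V → Bool) : 0 < wt J s := Real.exp_pos _
lemma Zp_pos (J : V × V → ℝ) : 0 < Zp J :=
  Finset.sum_pos (fun s _ => wt_pos J s) ⟨fun _ => true, Finset.mem_univ _⟩

lemma ev_add (J : V × V → ℝ) (F G : (V → Bool) → ℝ) :
    ev J (fun s => F s + G s) = ev J F + ev J G := by
  unfold ev; rw [← add_div, ← Finset.sum_add_distrib]; congr 1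
  exact Finset.sum_congr rfl fun s _ => by ring
lemma ev_sub (J : V × V → ℝ) (F G : (V → Bool) → ℝ) :
    ev J (fun s => F s - G s) = ev J F - ev J G := by
  unfold ev; rw [← sub_div, ← Finset.sum_sub_distrib]; congr 1
  exact Finset.sum_congr rfl fun s _ => by ring
lemma ev_mul_left (J : V × V → ℝ) (c : ℝ) (F : (V → Bool) → ℝ) :
    ev J (fun s => c * F s) = c * ev J F := by
  unfold ev; rw [← mul_div_assoc, Finset.mul_sum]; congr 1
  exact Finset.sum_congr rfl fun s _ => by ring
lemma ev_sum {ι : Type*} (J : V × V → ℝ) (T : Finset ι) (F : ι → (V → Bool) → ℝ) :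
    ev J (fun s => ∑ i ∈ T, F i s) = ∑ i ∈ T, ev J (F i) := by
  unfold ev; rw [← Finset.sum_div]; congr 1
  simp only [Finset.mul_sum]
  exact Finset.sum_comm
lemma ev_const (J : V × V → ℝ) (c : ℝ) : ev J (fun _ => c) = c := by
  unfold ev; rw [← Finset.sum_mul]; have := Zp_pos J; unfold Zp at *; field_simp
lemma ev_mono (J : V × V → ℝ) {F G : (V → Bool) → ℝ} (h : ∀ s, F s ≤ G s) : ev J F ≤ ev J G := by
  unfold ev
  exact div_le_div_of_nonneg_right
    (Finset.sum_le_sum fun s _ => mul_le_mul_of_nonneg_left (h s) (wt_pos J s).le) (Zp_pos J).le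
lemma ev_nonneg (J : V × V → ℝ) {F : (V → Bool) → ℝ} (h : ∀ s, 0 ≤ F s) : 0 ≤ ev J F := by
  have := ev_mono J (F := fun _ => 0) (G := F) h
  rwa [ev_const] at this

lemma exp_ss (J : ℝ) (s : V → Bool) (x y : V) :
    Real.exp (J * (sg s x * sg s y)) = Real.cosh J + Real.sinh J * (sg s x * sg s y) := by
  rcases sg_cases s x with h | h <;> rcases sg_cases s y with h' | h' <;>
    simp [h, h', Real.cosh_eq, Real.sinh_eq] <;> ring

lemma wt_eq (J : V × V → ℝ) (s : V → Bool) :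
    wt J s = ∏ e : V × V, (Real.cosh (J e) + Real.sinh (J e) * (sg s e.1 * sg s e.2)) := by
  unfold wt en; rw [Real.exp_sum]; exact Finset.prod_congr rfl fun e _ => exp_ss _ _ _ _

lemma sum_mon_wt_nonneg (J : V × V → ℝ) (hJ : ∀ e, 0 ≤ J e) (l : List V) :
    0 ≤ ∑ s, mon l s * wt J s := by
  simp only [wt_eq]
  exact pos_prod _ _ _ (fun e => (Real.cosh_pos _).le) (fun e => Real.sinh_nonneg_iff.2 (hJ e)) l

/-- GKS I -/
lemma gks1 (J : V × V → ℝ) (hJ : ∀ e, 0 ≤ J e) (l : List V) : 0 ≤ ev J (mon l) := by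
  unfold ev
  refine div_nonneg ?_ (Zp_pos J).le
  have := sum_mon_wt_nonneg J hJ l
  simpa only [mul_comm] using this

/-- double sums under the change of variables t = s q -/
lemma sum_sum_cm (F : (V → Bool) → (V → Bool) → ℝ) :
    ∑ s, ∑ t, F s t = ∑ q, ∑ s, F s (cm s q) := by
  rw [Finset.sum_comm (γ := V → Bool)]
  rw [Finset.sum_comm]
  conv_rhs => rw [Finset.sum_comm]
  exact Finset.sum_congr rfl fun s _ => (sum_cm' s (F s)).symm

/-- A2 -/
lemma ev_mono_J (J J' : V × V → ℝ) (hJ' : ∀ e, 0 ≤ J' e) (h : ∀ e, J' e ≤ J e) (l : List V) :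
    ev J' (mon l) ≤ ev J (mon l) := by
  unfold ev
  rw [div_le_div_iff₀ (Zp_pos _) (Zp_pos _)]
  have key : 0 ≤ ∑ s, ∑ t, (mon l s - mon l t) * (wt J s * wt J' t) := by
    rw [sum_sum_cm]
    refine Finset.sum_nonneg fun q _ => ?_
    have : ∀ s : V → Bool, (mon l s - mon l (cm s q)) * (wt J s * wt J' (cm s q)) =
        (1 - mon l q) * (mon l s * wt (fun e => J e + J' e * (sg q e.1 * sg q e.2)) s) := by
      intro s
      have h1 : wt J s * wt J' (cm s q) = wt (fun e => J e + J' e * (sg q e.1 * sg q e.2)) s := by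
        unfold wt; rw [← Real.exp_add]; congr 1
        unfold en; rw [← Finset.sum_add_distrib]
        refine Finset.sum_congr rfl fun e _ => ?_
        rw [sg_cm, sg_cm]; ring
      rw [h1, mon_cm]; ring
    simp only [this, ← Finset.mul_sum]
    refine mul_nonneg (by linarith [mon_le_one l q]) (sum_mon_wt_nonneg _ (fun e => ?_) l)
    rcases sg_cases q e.1 with h1 | h1 <;> rcases sg_cases q e.2 with h2 | h2 <;> simp only [h1, h2] <;>
      linarith [h e, hJ' e]
  have e1 : ∑ s, ∑ t, (mon l s - mon l t) * (wt J s * wt J' t) =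
      (∑ s, wt J s * mon l s) * Zp J' - (∑ s, wt J' s * mon l s) * Zp J := by
    unfold Zp
    rw [Finset.sum_mul_sum, mul_comm (∑ s, wt J' s * mon l s), Finset.sum_mul_sum,
      ← Finset.sum_sub_distrib]
    refine Finset.sum_congr rfl fun s _ => ?_
    rw [← Finset.sum_sub_distrib]
    exact Finset.sum_congr rfl fun t _ => by ring
  linarith

/-! switching -/
/-- cluster weight -/
def Wc (J : V × V → ℝ) (ω : Finset (V × V)) (l : List V) : ℝ :=
  ∑ s : V → Bool, mon l s * ∏ e ∈ ω, ((Real.cosh (2 * J e) - 1) + Real.sinh (2 * J e) * (sg s e.1 * sg s e.2))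

def Qm (ω : Finset (V × V)) (q : V → Bool) : Prop := ∀ e ∈ ω, q e.1 = q e.2

open Classical in
def Qc (ω : Finset (V × V)) (l : List V) : ℝ := ∑ q : V → Bool, if Qm ω q then mon l q else 0

def Rl (ω : Finset (V × V)) (u v : V) : Prop := ∀ q, Qm ω q → q u = q v

lemma Wc_nonneg (J : V × V → ℝ) (hJ : ∀ e, 0 ≤ J e) (ω : Finset (V × V)) (l : List V) :
    0 ≤ Wc J ω l :=
  pos_prod _ _ _ (fun e => by linarith [Real.one_le_cosh (2 * J e)])
    (fun e => Real.sinh_nonneg_iff.2 (by linarith [hJ e])) l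

lemma Qm_cm {ω : Finset (V × V)} {q r : V → Bool} (hq : Qm ω q) (hr : Qm ω r) : Qm ω (cm q r) := by
  intro e he; simp [cm, hq e he, hr e he]

lemma Wc_eq_zero (J : V × V → ℝ) {ω : Finset (V × V)} {l : List V} {q : V → Bool} (hq : Qm ω q)
    (h : mon l q = -1) : Wc J ω l = 0 := by
  have := sum_cm q (fun s => mon l s * ∏ e ∈ ω, ((Real.cosh (2 * J e) - 1) + Real.sinh (2 * J e) * (sg s e.1 * sg s e.2)))
  have h2 : ∀ s : V → Bool, mon l (cm s q) * ∏ e ∈ ω, ((Real.cosh (2 * J e) - 1) + Real.sinh (2 * J e) * (sg (cm s q) e.1 * sg (cm s q) e.2))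
     = - (mon l s * ∏ e ∈ ω, ((Real.cosh (2 * J e) - 1) + Real.sinh (2 * J e) * (sg s e.1 * sg s e.2))) := by
    intro s
    rw [mon_cm, h]
    have : ∏ e ∈ ω, ((Real.cosh (2 * J e) - 1) + Real.sinh (2 * J e) * (sg (cm s q) e.1 * sg (cm s q) e.2)) = ∏ e ∈ ω, ((Real.cosh (2 * J e) - 1) + Real.sinh (2 * J e) * (sg s e.1 * sg s e.2)) := by
      refine Finset.prod_congr rfl fun e he => ?_
      have h3 : sg q e.1 * sg q e.2 = 1 := by
        have : sg q e.1 = sg q e.2 := by unfold sg; rw [hq e he]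
        rw [this, sg_sq]
      rw [sg_cm, sg_cm]
      linear_combination (Real.sinh (2 * J e) * sg s e.1 * sg s e.2) * h3
    rw [this]; ring
  simp only [h2, Finset.sum_neg_distrib] at this
  unfold Wc; linarith

lemma Qc_eq_zero {ω : Finset (V × V)} {l : List V} {q : V → Bool} (hq : Qm ω q)
    (h : mon l q = -1) : Qc ω l = 0 := by
  classical
  have := sum_cm q (fun q => if Qm ω q then mon l q else 0)
  have h2 : ∀ s : V → Bool, (if Qm ω (cm s q) then mon l (cm s q) else 0) = -(if Qm ω s then mon l s else 0) := by
    intro s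
    have : Qm ω (cm s q) ↔ Qm ω s := ⟨fun h => by simpa [cm_cm] using Qm_cm h hq, fun h => Qm_cm h hq⟩
    simp only [this, mon_cm, h]
    split_ifs <;> simp
  simp only [h2, Finset.sum_neg_distrib] at this
  unfold Qc; linarith

lemma Qc_nil_nonneg (ω : Finset (V × V)) : 0 ≤ Qc ω ([] : List V) := by
  classical
  refine Finset.sum_nonneg fun q _ => ?_
  split_ifs <;> simp [mon_nil]

lemma Qc_eq {ω : Finset (V × V)} {l : List V} (h : ∀ q, Qm ω q → mon l q = 1) :
    Qc ω l = Qc ω [] := by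
  classical
  refine Finset.sum_congr rfl fun q _ => ?_
  split_ifs with h'
  · rw [h q h', mon_nil]
  · rfl

open Classical in
lemma Qc_pair (ω : Finset (V × V)) (u v : V) :
    Qc ω [u, v] = if Rl ω u v then Qc ω [] else 0 := by
  split_ifs with h
  · refine Qc_eq fun q hq => ?_
    simp only [mon_cons, mon_nil, mul_one]
    unfold sg; rw [h q hq]; exact sg_sq q v
  · unfold Rl at h; push Not at h
    obtain ⟨q, hq, hne⟩ := h
    refine Qc_eq_zero hq ?_
    simp only [mon_cons, mon_nil, mul_one, sg, spin]
    cases h1 : q u <;> cases h2 : q v <;> simp_all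

lemma Qc_le (ω : Finset (V × V)) (l : List V) : Qc ω l ≤ Qc ω [] := by
  classical
  refine Finset.sum_le_sum fun q _ => ?_
  split_ifs
  · rw [mon_nil]; exact mon_le_one _ _
  · rfl

lemma Rl_refl (ω : Finset (V × V)) (u : V) : Rl ω u u := fun _ _ => rfl
lemma Rl_symm {ω : Finset (V × V)} {u v : V} (h : Rl ω u v) : Rl ω v u := fun q hq => (h q hq).symm
lemma Rl_trans {ω : Finset (V × V)} {u v w : V} (h : Rl ω u v) (h' : Rl ω v w) : Rl ω u w :=
  fun q hq => (h q hq).trans (h' q hq)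
lemma Rl_edge {ω : Finset (V × V)} {e : V × V} (h : e ∈ ω) : Rl ω e.1 e.2 := fun q hq => hq e h

open Classical in
/-- the configuration equal to -1 exactly on the class of u -/
def clq (ω : Finset (V × V)) (u : V) : V → Bool := fun v => !(decide (Rl ω u v))

lemma Qm_clq (ω : Finset (V × V)) (u : V) : Qm ω (clq ω u) := by
  intro e he
  have : Rl ω u e.1 ↔ Rl ω u e.2 :=
    ⟨fun h => Rl_trans h (Rl_edge he), fun h => Rl_trans h (Rl_symm (Rl_edge he))⟩
  simp [clq, this]

open Classical in
lemma sg_clq (ω : Finset (V × V)) (u v : V) : sg (clq ω u) v = if Rl ω u v then -1 else 1 := by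
  unfold sg spin clq; split_ifs <;> simp_all

lemma wt_wt (J : V × V → ℝ) (s q : V → Bool) :
    wt J s * wt J (cm s q) = ∏ e : V × V, (1 + if q e.1 = q e.2 then ((Real.cosh (2 * J e) - 1) + Real.sinh (2 * J e) * (sg s e.1 * sg s e.2)) else 0) := by
  unfold wt en; rw [← Real.exp_add, ← Finset.sum_add_distrib, Real.exp_sum]
  refine Finset.prod_congr rfl fun e _ => ?_
  rw [sg_cm, sg_cm]
  split_ifs with h
  · have h3 : sg q e.1 * sg q e.2 = 1 := by
      have : sg q e.1 = sg q e.2 := by unfold sg; rw [h]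
      rw [this, sg_sq]
    have : J e * (sg s e.1 * sg s e.2) + J e * (sg s e.1 * sg q e.1 * (sg s e.2 * sg q e.2)) = 2 * J e * (sg s e.1 * sg s e.2) := by
      linear_combination (J e * (sg s e.1 * sg s e.2)) * h3
    rw [this, exp_ss]; ring
  · have h3 : sg q e.1 * sg q e.2 = -1 := by
      unfold sg spin; cases h1 : q e.1 <;> cases h2 : q e.2 <;> simp_all
    have : J e * (sg s e.1 * sg s e.2) + J e * (sg s e.1 * sg q e.1 * (sg s e.2 * sg q e.2)) = 0 := by
      linear_combination (J e * (sg s e.1 * sg s e.2)) * h3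
    rw [this]; simp


/-- switching identity -/
lemma switching (J : V × V → ℝ) (l m : List V) :
    (∑ s, wt J s * mon l s) * (∑ s, wt J s * mon m s) =
      ∑ ω : Finset (V × V), Wc J ω (l ++ m) * Qc ω m := by
  classical
  rw [Finset.sum_mul_sum, sum_sum_cm]
  have h1 : ∀ q s : V → Bool, wt J s * mon l s * (wt J (cm s q) * mon m (cm s q)) =
     ∑ ω : Finset (V × V), (mon (l ++ m) s * ∏ e ∈ ω, ((Real.cosh (2 * J e) - 1) + Real.sinh (2 * J e) * (sg s e.1 * sg s e.2))) * (if Qm ω q then mon m q else 0) := by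
    intro q s
    have h2 := wt_wt J s q
    rw [Finset.prod_one_add, Finset.powerset_univ] at h2
    have h3 : wt J s * mon l s * (wt J (cm s q) * mon m (cm s q)) = (wt J s * wt J (cm s q)) * (mon (l ++ m) s * mon m q) := by
      rw [mon_cm, mon_append]; ring
    rw [h3, h2, Finset.sum_mul]
    refine Finset.sum_congr rfl fun ω _ => ?_
    by_cases hq : Qm ω q
    · rw [if_pos hq, Finset.prod_congr rfl (fun e he => if_pos (hq e he))]; ring
    · rw [if_neg hq]
      unfold Qm at hq; push Not at hq; obtain ⟨e, he, hne⟩ := hq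
      rw [Finset.prod_eq_zero he (if_neg hne)]; ring
  simp only [h1]
  unfold Wc Qc
  simp only [Finset.sum_mul_sum]
  rw [Finset.sum_comm]
  rw [Finset.sum_congr rfl fun s _ => Finset.sum_comm]
  rw [Finset.sum_comm]

lemma Zp_eq (J : V × V → ℝ) : Zp J = ∑ s : V → Bool, wt J s * mon ([] : List V) s := by
  simp [mon_nil, Zp]

lemma ev_mul_ev (J : V × V → ℝ) (l m : List V) :
    ev J (mon l) * ev J (mon m) = (∑ ω : Finset (V × V), Wc J ω (l ++ m) * Qc ω m) / Zp J ^ 2 := by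
  rw [← switching]; unfold ev; ring

lemma ev_eq_sw (J : V × V → ℝ) (l : List V) :
    ev J (mon l) = (∑ ω : Finset (V × V), Wc J ω l * Qc ω []) / Zp J ^ 2 := by
  have := ev_mul_ev J l []
  have h1 : ev J (mon ([] : List V)) = 1 := ev_const J 1
  rw [h1, mul_one, List.append_nil] at this
  exact this

lemma mon_congr_Wc {l m : List V} (h : ∀ s, mon l s = mon m s) (J : V × V → ℝ) (ω : Finset (V × V)) :
    Wc J ω l = Wc J ω m := by unfold Wc; simp only [h]

lemma gks2 (J : V × V → ℝ) (hJ : ∀ e, 0 ≤ J e) (l m : List V) :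
    ev J (mon l) * ev J (mon m) ≤ ev J (mon (l ++ m)) := by
  rw [ev_mul_ev, ev_eq_sw]
  refine div_le_div_of_nonneg_right (Finset.sum_le_sum fun ω _ => ?_) (by positivity)
  exact mul_le_mul_of_nonneg_left (Qc_le _ _) (Wc_nonneg J hJ _ _)

end ising

section ising2
variable {V : Type*} [Fintype V] [DecidableEq V]

/-- two-point function -/
def S2 (J : V × V → ℝ) (x y : V) : ℝ := ev J (mon [x, y])

lemma S2_comm (J : V × V → ℝ) (x y : V) : S2 J x y = S2 J y x := by
  unfold S2; congr 1; funext s; simp only [mon_cons, mon_nil]; ring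
lemma S2_self (J : V × V → ℝ) (x : V) : S2 J x x = 1 := by
  unfold S2
  have : mon [x, x] = fun _ : V → Bool => (1:ℝ) := by
    funext s; simp only [mon_cons, mon_nil, mul_one, sg_sq]
  rw [this, ev_const]
lemma S2_le_one (J : V × V → ℝ) (x y : V) : S2 J x y ≤ 1 := by
  have := ev_mono J (F := mon [x,y]) (G := fun _ => 1) (fun s => mon_le_one _ s)
  rwa [ev_const] at this
lemma S2_nonneg (J : V × V → ℝ) (hJ : ∀ e, 0 ≤ J e) (x y : V) : 0 ≤ S2 J x y := gks1 J hJ _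

lemma ev_mul_ev' (J : V × V → ℝ) (l m n : List V) (h : ∀ s : V → Bool, mon n s = mon l s * mon m s) :
    ev J (mon l) * ev J (mon m) = (∑ ω : Finset (V × V), Wc J ω n * Qc ω m) / Zp J ^ 2 := by
  rw [ev_mul_ev]
  congr 1; refine Finset.sum_congr rfl fun ω _ => ?_
  congr 1
  exact mon_congr_Wc (fun s => by rw [h, mon_append]) J ω

lemma leb4 (J : V × V → ℝ) (hJ : ∀ e, 0 ≤ J e) (x a b c : V) :
    ev J (mon [x, a, b, c]) ≤ S2 J x a * S2 J b c + S2 J x b * S2 J a c + S2 J x c * S2 J a b := by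
  classical
  have h1 := ev_mul_ev' J [b, c] [x, a] [x, a, b, c] (fun s => by simp only [mon_cons, mon_nil]; ring)
  have h2 := ev_mul_ev' J [a, c] [x, b] [x, a, b, c] (fun s => by simp only [mon_cons, mon_nil]; ring)
  have h3 := ev_mul_ev' J [a, b] [x, c] [x, a, b, c] (fun s => by simp only [mon_cons, mon_nil]; ring)
  unfold S2
  rw [mul_comm (ev J (mon [x, a])), mul_comm (ev J (mon [x, b])), mul_comm (ev J (mon [x, c])),
    h1, h2, h3, ev_eq_sw, ← add_div, ← add_div, ← Finset.sum_add_distrib, ← Finset.sum_add_distrib]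
  refine div_le_div_of_nonneg_right (Finset.sum_le_sum fun ω _ => ?_) (by positivity)
  have hW := Wc_nonneg J hJ ω [x, a, b, c]
  have hQ := mul_nonneg hW (Qc_nil_nonneg ω)
  simp only [Qc_pair]
  by_cases ha : Rl ω x a <;> by_cases hb : Rl ω x b <;> by_cases hc : Rl ω x c <;>
    simp only [ha, hb, hc, if_true, if_false] <;> try linarith
  rw [Wc_eq_zero J (Qm_clq ω x)]
  · simp
  · simp [mon_cons, mon_nil, sg_clq, ha, hb, hc, Rl_refl]

lemma leb6 (J : V × V → ℝ) (hJ : ∀ e, 0 ≤ J e) (x a b c d e : V) :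
    ev J (mon [x, a, b, c, d, e]) ≤ S2 J x a * ev J (mon [b, c, d, e]) + S2 J x b * ev J (mon [a, c, d, e])
     + S2 J x c * ev J (mon [a, b, d, e]) + S2 J x d * ev J (mon [a, b, c, e]) + S2 J x e * ev J (mon [a, b, c, d]) := by
  classical
  have h1 := ev_mul_ev' J [b, c, d, e] [x, a] [x, a, b, c, d, e] (fun s => by simp only [mon_cons, mon_nil]; ring)
  have h2 := ev_mul_ev' J [a, c, d, e] [x, b] [x, a, b, c, d, e] (fun s => by simp only [mon_cons, mon_nil]; ring)
  have h3 := ev_mul_ev' J [a, b, d, e] [x, c] [x, a, b, c, d, e] (fun s => by simp only [mon_cons, mon_nil]; ring)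
  have h4 := ev_mul_ev' J [a, b, c, e] [x, d] [x, a, b, c, d, e] (fun s => by simp only [mon_cons, mon_nil]; ring)
  have h5 := ev_mul_ev' J [a, b, c, d] [x, e] [x, a, b, c, d, e] (fun s => by simp only [mon_cons, mon_nil]; ring)
  unfold S2
  rw [mul_comm (ev J (mon [x, a])), mul_comm (ev J (mon [x, b])), mul_comm (ev J (mon [x, c])),
    mul_comm (ev J (mon [x, d])), mul_comm (ev J (mon [x, e])),
    h1, h2, h3, h4, h5, ev_eq_sw]
  simp only [← add_div, ← Finset.sum_add_distrib]
  refine div_le_div_of_nonneg_right (Finset.sum_le_sum fun ω _ => ?_) (by positivity)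
  have hW := Wc_nonneg J hJ ω [x, a, b, c, d, e]
  have hQ := mul_nonneg hW (Qc_nil_nonneg ω)
  simp only [Qc_pair]
  by_cases ha : Rl ω x a <;> by_cases hb : Rl ω x b <;> by_cases hc : Rl ω x c <;>
    by_cases hd : Rl ω x d <;> by_cases he : Rl ω x e <;>
    simp only [ha, hb, hc, hd, he, if_true, if_false] <;> try linarith
  rw [Wc_eq_zero J (Qm_clq ω x)]
  · simp
  · simp [mon_cons, mon_nil, sg_clq, ha, hb, hc, hd, he, Rl_refl]

/-! FKG -/
/-- linear form in the spins -/
def hl (f : V → ℝ) (s : V → Bool) : ℝ := ∑ a, f a * sg s a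

lemma sg_mono (x : V) : Monotone (fun s : V → Bool => sg s x) := by
  intro s t h
  have := h x
  simp only [sg, spin]
  cases h1 : s x <;> cases h2 : t x <;> rw [h1, h2] at this
  all_goals first | (norm_num; done) | exact absurd (show (true:Bool) ≤ false from this) (by decide)

lemma hl_mono (f : V → ℝ) (hf : ∀ a, 0 ≤ f a) : Monotone (hl f) := by
  intro s t h
  exact Finset.sum_le_sum fun a _ => mul_le_mul_of_nonneg_left (sg_mono a h) (hf a)

lemma ev_sg (J : V × V → ℝ) (x : V) : ev J (fun s => sg s x) = 0 := by
  unfold ev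
  have h : ∀ s : V → Bool, wt J (cm s (fun _ => false)) * sg (cm s (fun _ => false)) x = -(wt J s * sg s x) := by
    intro s
    have h0 : ∀ v : V, sg (cm s (fun _ => false)) v = - sg s v := by
      intro v; rw [sg_cm]; simp [sg, spin]
    unfold wt en; simp only [h0]; ring_nf
  have := sum_cm (fun _ => false) (fun s : V → Bool => wt J s * sg s x)
  simp only [h, Finset.sum_neg_distrib] at this
  have : ∑ s : V → Bool, wt J s * sg s x = 0 := by linarith
  rw [this, zero_div]

lemma fkg_ev (J : V × V → ℝ) (hJ : ∀ e, 0 ≤ J e) (F : (V → Bool) → ℝ) (hF : Monotone F) (y : V) :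
    0 ≤ ev J (fun s => F s * sg s y) := by
  have hbot : ∀ s, F ⊥ ≤ F s := fun s => hF bot_le
  have key := fkg (μ := wt J) (f := fun s => F s - F ⊥) (g := fun s => sg s y + 1) (fun s => (wt_pos J s).le)
    (fun s => by simpa using hbot s)
    (fun s => by rcases sg_cases s y with h | h <;> simp [h])
    (fun s t h => by simpa using hF h) (fun s t h => by simpa using sg_mono y h)
    (by
      intro s t
      unfold wt
      rw [← Real.exp_add, ← Real.exp_add]
      refine Real.exp_le_exp.2 ?_
      unfold en
      rw [← Finset.sum_add_distrib, ← Finset.sum_add_distrib]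
      refine Finset.sum_le_sum fun e _ => ?_
      rw [← mul_add, ← mul_add]
      refine mul_le_mul_of_nonneg_left ?_ (hJ e)
      have h4 : ∀ p q r u : Bool, spin p * spin q + spin r * spin u ≤
          spin (p ⊓ r) * spin (q ⊓ u) + spin (p ⊔ r) * spin (q ⊔ u) := by
        intro p q r u
        cases p <;> cases q <;> cases r <;> cases u <;> simp [spin] <;> norm_num
      exact h4 (s e.1) (s e.2) (t e.1) (t e.2))
  have hy : ∑ s : V → Bool, wt J s * sg s y = 0 := by
    have := ev_sg J y
    unfold ev at this
    rcases div_eq_zero_iff.1 this with h | h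
    · exact h
    · exact absurd h (Zp_pos J).ne'
  unfold ev
  refine div_nonneg ?_ (Zp_pos J).le
  have hZ := Zp_pos J
  have e1 : ∑ s : V → Bool, wt J s * (F s - F ⊥) = ∑ s : V → Bool, wt J s * F s - Zp J * F ⊥ := by
    unfold Zp; rw [Finset.sum_mul, ← Finset.sum_sub_distrib]
    exact Finset.sum_congr rfl fun s _ => by ring
  have e2 : ∑ s : V → Bool, wt J s * (sg s y + 1) = Zp J := by
    have : ∑ s : V → Bool, wt J s * (sg s y + 1) = ∑ s : V → Bool, wt J s * sg s y + Zp J := by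
      unfold Zp; rw [← Finset.sum_add_distrib]
      exact Finset.sum_congr rfl fun s _ => by ring
    rw [this, hy, zero_add]
  have e3 : ∑ s : V → Bool, wt J s * ((F s - F ⊥) * (sg s y + 1)) = ∑ s : V → Bool, wt J s * (F s * sg s y)
      - F ⊥ * (∑ s : V → Bool, wt J s * sg s y) + (∑ s : V → Bool, wt J s * F s) - F ⊥ * Zp J := by
    unfold Zp
    rw [Finset.mul_sum, Finset.mul_sum, ← Finset.sum_sub_distrib, ← Finset.sum_add_distrib, ← Finset.sum_sub_distrib]
    exact Finset.sum_congr rfl fun s _ => by ring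
  have e4 : ∑ s : V → Bool, wt J s = Zp J := rfl
  rw [e1, e2, e3, hy, e4] at key
  by_contra hneg
  push Not at hneg
  have := mul_neg_of_pos_of_neg hZ hneg
  nlinarith

/-! Schwinger-Dyson -/
def fl (x : V) : V → Bool := fun v => !decide (v = x)

lemma sg_fl (x v : V) : sg (fl x) v = if v = x then -1 else 1 := by
  unfold sg spin fl; split_ifs <;> simp_all

def loc (J : V × V → ℝ) (x : V) (s : V → Bool) : ℝ := hl (fun y => J (x, y) + J (y, x)) s

lemma en_fl (J : V × V → ℝ) (x : V) (hx : J (x, x) = 0) (s : V → Bool) :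
    en J (cm s (fl x)) = en J s - 2 * (sg s x * loc J x s) := by
  have h : ∀ e : V × V, J e * (sg (cm s (fl x)) e.1 * sg (cm s (fl x)) e.2) = J e * (sg s e.1 * sg s e.2)
     - ((if e.1 = x then 2 * J e * (sg s e.1 * sg s e.2) else 0) + (if e.2 = x then 2 * J e * (sg s e.1 * sg s e.2) else 0)) := by
    rintro ⟨u, v⟩
    simp only [sg_cm, sg_fl]
    by_cases hu : u = x <;> by_cases hv : v = x
    · subst hu; subst hv; simp [hx]
    all_goals simp only [hu, hv, if_true, if_false]; ring
  unfold en
  simp only [h, Finset.sum_sub_distrib, Finset.sum_add_distrib]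
  congr 1
  rw [Fintype.sum_prod_type, Fintype.sum_prod_type]
  simp only [Finset.sum_ite_eq', Finset.mem_univ, if_true]
  rw [Finset.sum_comm]
  simp only [Finset.sum_ite_eq', Finset.mem_univ, if_true]
  unfold loc hl
  rw [← Finset.sum_add_distrib, Finset.mul_sum, Finset.mul_sum]
  exact Finset.sum_congr rfl fun v _ => by ring

lemma hl_fl (f : V → ℝ) (x : V) (hx : f x = 0) (s : V → Bool) : hl f (cm s (fl x)) = hl f s := by
  unfold hl
  refine Finset.sum_congr rfl fun a _ => ?_
  rw [sg_cm, sg_fl]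
  split_ifs with h
  · subst h; simp [hx]
  · ring

lemma sd (J : V × V → ℝ) (x : V) (hx : J (x, x) = 0) (F : (V → Bool) → ℝ)
    (hF : ∀ s, F (cm s (fl x)) = F s) :
    ev J (fun s => sg s x * F s) = ev J (fun s => Real.tanh (loc J x s) * F s) := by
  rw [← sub_eq_zero, ← ev_sub]
  unfold ev
  have h1 := sum_cm (fl x) (fun s : V → Bool => wt J s * (sg s x * F s - Real.tanh (loc J x s) * F s))
  have h2 : ∀ s : V → Bool, wt J (cm s (fl x)) * (sg (cm s (fl x)) x * F (cm s (fl x)) - Real.tanh (loc J x (cm s (fl x))) * F (cm s (fl x))) = - (wt J s * (sg s x * F s - Real.tanh (loc J x s) * F s)) := by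
    intro s
    have hl' : loc J x (cm s (fl x)) = loc J x s := hl_fl _ _ (by simp [hx]) _
    rw [hF, hl', sg_cm, sg_fl, if_pos rfl]
    unfold wt
    rw [en_fl J x hx]
    have hc : Real.tanh (loc J x s) = Real.sinh (loc J x s) / Real.cosh (loc J x s) := Real.tanh_eq_sinh_div_cosh _
    have hp := (Real.cosh_pos (loc J x s)).ne'
    rw [hc]
    set L := loc J x s
    rcases sg_cases s x with h | h <;> rw [h]
    · have e1 : Real.exp (en J s - 2 * (1 * L)) = Real.exp (en J s - L) * Real.exp (-L) := by
        rw [← Real.exp_add]; congr 1; ring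
      have e2 : Real.exp (en J s) = Real.exp (en J s - L) * Real.exp L := by
        rw [← Real.exp_add]; congr 1; ring
      rw [e1, e2]
      field_simp
      rw [Real.cosh_eq, Real.sinh_eq]; ring
    · have e1 : Real.exp (en J s - 2 * (-1 * L)) = Real.exp (en J s + L) * Real.exp (L) := by
        rw [← Real.exp_add]; congr 1; ring
      have e2 : Real.exp (en J s) = Real.exp (en J s + L) * Real.exp (-L) := by
        rw [← Real.exp_add]; congr 1; ring
      rw [e1, e2]
      field_simp
      rw [Real.cosh_eq, Real.sinh_eq]; ring
  simp only [h2, Finset.sum_neg_distrib] at h1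
  have : ∑ s : V → Bool, wt J s * (sg s x * F s - Real.tanh (loc J x s) * F s) = 0 := by linarith
  rw [this, zero_div]

end ising2

section ising3
variable {V : Type*} [Fintype V] [DecidableEq V]

/-- coupling restricted to the complement of `C` -/
def JC (J : V × V → ℝ) (C : Finset V) : V × V → ℝ := fun e => if e.1 ∉ C ∧ e.2 ∉ C then J e else 0

open Classical in
/-- cluster of `x` -/
def cls (ω : Finset (V × V)) (x : V) : Finset V := Finset.univ.filter (fun v => Rl ω x v)

lemma mem_cls {ω : Finset (V × V)} {x v : V} : v ∈ cls ω x ↔ Rl ω x v := by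
  classical
  simp [cls]

lemma Qm_union {a b : Finset (V × V)} {q : V → Bool} : Qm (a ∪ b) q ↔ Qm a q ∧ Qm b q := by
  unfold Qm
  constructor
  · intro h; exact ⟨fun e he => h e (Finset.mem_union_left _ he), fun e he => h e (Finset.mem_union_right _ he)⟩
  · rintro ⟨h1, h2⟩ e he
    rcases Finset.mem_union.1 he with h | h
    · exact h1 e h
    · exact h2 e h

lemma Qm_sub {a b : Finset (V × V)} (hab : a ⊆ b) {q : V → Bool} (h : Qm b q) : Qm a q :=
  fun e he => h e (hab he)

lemma cls_union {C : Finset V} {x : V} (hx : x ∈ C) {a b : Finset (V × V)} (ha : a ⊆ C ×ˢ C)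
    (hb : b ⊆ Cᶜ ×ˢ Cᶜ) : cls (a ∪ b) x = C ↔ ∀ v ∈ C, Rl a x v := by
  constructor
  · intro h v hv q hq
    rw [← h, mem_cls] at hv
    have hv' : v ∈ C := by rw [← h, mem_cls]; exact hv
    have := hv (fun w => if w ∈ C then q w else true) (Qm_union.2 ⟨?_, ?_⟩)
    · simpa [hx, hv'] using this
    · intro e he
      have := Finset.mem_product.1 (ha he)
      simp [this.1, this.2, hq e he]
    · intro e he
      have := Finset.mem_product.1 (hb he)
      simp only [Finset.mem_compl] at this
      simp [this.1, this.2]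
  · intro h
    ext v
    rw [mem_cls]
    constructor
    · intro hv
      by_contra hvC
      have := hv (fun w => decide (w ∈ C)) (Qm_union.2 ⟨?_, ?_⟩)
      · simp [hx, hvC] at this
      · intro e he
        have := Finset.mem_product.1 (ha he)
        simp [this.1, this.2]
      · intro e he
        have := Finset.mem_product.1 (hb he)
        simp only [Finset.mem_compl] at this
        simp [this.1, this.2]
    · intro hv q hq
      exact h v hv q (Qm_union.1 hq).1

lemma cls_split (ω : Finset (V × V)) (x : V) :
    ω ⊆ (cls ω x ×ˢ cls ω x) ∪ ((cls ω x)ᶜ ×ˢ (cls ω x)ᶜ) := by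
  intro e he
  have h : e.1 ∈ cls ω x ↔ e.2 ∈ cls ω x := by
    rw [mem_cls, mem_cls]
    exact ⟨fun h => Rl_trans h (Rl_edge he), fun h => Rl_trans h (Rl_symm (Rl_edge he))⟩
  rw [Finset.mem_union, Finset.mem_product, Finset.mem_product, Finset.mem_compl, Finset.mem_compl, h]
  tauto

open Classical in
lemma sum_cls {C : Finset V} {x : V} (hx : x ∈ C) (φ : Finset (V × V) → ℝ) :
    ∑ ω : Finset (V × V), (if cls ω x = C then φ ω else 0) =
    ∑ a ∈ (C ×ˢ C).powerset.filter (fun a => ∀ v ∈ C, Rl a x v), ∑ b ∈ (Cᶜ ×ˢ Cᶜ).powerset, φ (a ∪ b) := by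
  rw [← Finset.sum_filter, Finset.sum_sigma']
  symm
  have hdisj : Disjoint (C ×ˢ C) (Cᶜ ×ˢ Cᶜ) := by
    rw [Finset.disjoint_left]
    intro e h1 h2
    simp only [Finset.mem_product, Finset.mem_compl] at h1 h2
    exact h2.1 h1.1
  refine Finset.sum_nbij' (fun p => p.1 ∪ p.2) (fun ω => ⟨ω ∩ (C ×ˢ C), ω ∩ (Cᶜ ×ˢ Cᶜ)⟩) ?_ ?_ ?_ ?_ ?_
  · rintro ⟨a, b⟩ h
    simp only [Finset.mem_sigma, Finset.mem_filter, Finset.mem_powerset] at h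
    simp only [Finset.mem_filter, Finset.mem_univ, true_and]
    exact (cls_union hx h.1.1 h.2).2 h.1.2
  · intro ω h
    simp only [Finset.mem_filter, Finset.mem_univ, true_and] at h
    simp only [Finset.mem_sigma, Finset.mem_filter, Finset.mem_powerset]
    refine ⟨⟨Finset.inter_subset_right, ?_⟩, Finset.inter_subset_right⟩
    rw [← cls_union hx Finset.inter_subset_right (b := ω ∩ (Cᶜ ×ˢ Cᶜ)) Finset.inter_subset_right,
      ← Finset.inter_union_distrib_left, Finset.inter_eq_left.2 (by have := cls_split ω x; rwa [h] at this), h]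
  · rintro ⟨a, b⟩ h
    simp only [Finset.mem_sigma, Finset.mem_filter, Finset.mem_powerset] at h
    have ha := h.1.1
    have hb := h.2
    have e1 : (a ∪ b) ∩ (C ×ˢ C) = a := by
      rw [Finset.union_inter_distrib_right, Finset.inter_eq_left.2 ha,
        Finset.disjoint_iff_inter_eq_empty.1 (Finset.disjoint_of_subset_left hb hdisj.symm), Finset.union_empty]
    have e2 : (a ∪ b) ∩ (Cᶜ ×ˢ Cᶜ) = b := by
      rw [Finset.union_inter_distrib_right, Finset.inter_eq_left.2 hb,
        Finset.disjoint_iff_inter_eq_empty.1 (Finset.disjoint_of_subset_left ha hdisj), Finset.empty_union]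
    simp only [e1, e2]
  · intro ω h
    simp only [Finset.mem_filter, Finset.mem_univ, true_and] at h
    simp only
    rw [← Finset.inter_union_distrib_left, Finset.inter_eq_left.2 (by have := cls_split ω x; rwa [h] at this)]
  · rintro ⟨a, b⟩ h; rfl

/-- mixing of configurations -/
def mx (C : Finset V) (p p' : (V → Bool) × (V → Bool)) : (V → Bool) × (V → Bool) :=
  (fun v => if v ∈ C then p.1 v else p'.1 v, fun v => if v ∈ C then p.2 v else p'.2 v)

lemma indep (C : Finset V) (f g g' : (V → Bool) × (V → Bool) → ℝ)
    (hf : ∀ p p', f (mx C p p') = f p) (hg : ∀ p p', g (mx C p p') = g p')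
    (hg' : ∀ p p', g' (mx C p p') = g' p') :
    (∑ p, f p * g p) * (∑ p, g' p) = (∑ p, f p * g' p) * (∑ p, g p) := by
  rw [Finset.sum_mul_sum, Finset.sum_mul_sum, ← Finset.sum_product', ← Finset.sum_product',
    Finset.univ_product_univ]
  have hinv : Function.Involutive (fun z : ((V → Bool) × (V → Bool)) × ((V → Bool) × (V → Bool)) =>
      (mx C z.1 z.2, mx C z.2 z.1)) := by
    rintro ⟨⟨s, t⟩, ⟨s', t'⟩⟩
    simp only [mx, Prod.mk.injEq]
    refine ⟨⟨?_, ?_⟩, ?_, ?_⟩ <;> funext v <;> by_cases hv : v ∈ C <;> simp [hv]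
  rw [← Equiv.sum_comp hinv.toPerm]
  refine Finset.sum_congr rfl fun z _ => ?_
  simp only [Function.Involutive.coe_toPerm, hf, hg, hg']
  ring

lemma wt_JC_prod (J : V × V → ℝ) (C : Finset V) (s q : V → Bool) :
    wt (JC J C) s * wt (JC J C) (cm s q) = ∏ e ∈ Cᶜ ×ˢ Cᶜ, (1 + if q e.1 = q e.2 then
      ((Real.cosh (2 * J e) - 1) + Real.sinh (2 * J e) * (sg s e.1 * sg s e.2)) else 0) := by
  rw [wt_wt]
  symm
  rw [← Finset.prod_subset (Finset.subset_univ (Cᶜ ×ˢ Cᶜ))]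
  · refine Finset.prod_congr rfl fun e he => ?_
    simp only [Finset.mem_product, Finset.mem_compl] at he
    have : JC J C e = J e := if_pos he
    rw [this]
  · intro e _ he
    simp only [Finset.mem_product, Finset.mem_compl] at he
    have : JC J C e = 0 := if_neg he
    rw [this]; simp

open Classical in
lemma sum_b (J : V × V → ℝ) (C : Finset V) {a : Finset (V × V)} (ha : a ⊆ C ×ˢ C) (l : List V) :
    ∑ b ∈ (Cᶜ ×ˢ Cᶜ).powerset, Wc J (a ∪ b) l * Qc (a ∪ b) [] =
    ∑ p : (V → Bool) × (V → Bool), mon l p.1 * (((if Qm a (cm p.1 p.2) then 1 else 0) *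
      ∏ e ∈ a, ((Real.cosh (2 * J e) - 1) + Real.sinh (2 * J e) * (sg p.1 e.1 * sg p.1 e.2))) *
      (wt (JC J C) p.1 * wt (JC J C) p.2)) := by
  rw [Fintype.sum_prod_type, sum_sum_cm]
  have hdisj : Disjoint (C ×ˢ C) (Cᶜ ×ˢ Cᶜ) := by
    rw [Finset.disjoint_left]
    intro e h1 h2
    simp only [Finset.mem_product, Finset.mem_compl] at h1 h2
    exact h2.1 h1.1
  have h1 : ∀ q s : V → Bool, mon l s * (((if Qm a (cm s (cm s q)) then (1:ℝ) else 0) *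
      ∏ e ∈ a, ((Real.cosh (2 * J e) - 1) + Real.sinh (2 * J e) * (sg s e.1 * sg s e.2))) *
      (wt (JC J C) s * wt (JC J C) (cm s q))) = ∑ b ∈ (Cᶜ ×ˢ Cᶜ).powerset,
      (mon l s * ∏ e ∈ a ∪ b, ((Real.cosh (2 * J e) - 1) + Real.sinh (2 * J e) * (sg s e.1 * sg s e.2))) * (if Qm (a ∪ b) q then mon ([] : List V) q else 0) := by
    intro q s
    rw [cm_cm', wt_JC_prod, Finset.prod_one_add, Finset.mul_sum, Finset.mul_sum]
    refine Finset.sum_congr rfl fun b hb => ?_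
    rw [Finset.mem_powerset] at hb
    rw [Finset.prod_union (Finset.disjoint_of_subset_left ha (Finset.disjoint_of_subset_right hb hdisj))]
    by_cases hq : Qm b q
    · rw [Finset.prod_congr rfl (fun e he => if_pos (hq e he))]
      simp only [Qm_union, hq, and_true, mon_nil]
      split_ifs <;> ring
    · have : ¬ Qm (a ∪ b) q := fun h => hq (Qm_union.1 h).2
      rw [if_neg this]
      unfold Qm at hq; push Not at hq; obtain ⟨e, he, hne⟩ := hq
      rw [Finset.prod_eq_zero he (if_neg hne)]; ring
  simp only [h1]
  unfold Wc Qc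
  simp only [Finset.sum_mul_sum]
  rw [Finset.sum_comm]
  rw [Finset.sum_congr rfl fun s _ => Finset.sum_comm]
  rw [Finset.sum_comm]

lemma wt_JC_mix (J : V × V → ℝ) (C : Finset V) (s s' : V → Bool) :
    wt (JC J C) (fun v => if v ∈ C then s v else s' v) = wt (JC J C) s' := by
  unfold wt en
  congr 1
  refine Finset.sum_congr rfl fun e _ => ?_
  by_cases h : e.1 ∉ C ∧ e.2 ∉ C
  · simp [sg, h.1, h.2]
  · have : JC J C e = 0 := if_neg h
    rw [this]; simp

lemma KL0 (J : V × V → ℝ) (C : Finset V) {a : Finset (V × V)} (ha : a ⊆ C ×ˢ C) {x1 x2 x3 x4 : V}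
    (h1 : x1 ∉ C) (h2 : x2 ∉ C) (h3 : x3 ∈ C) (h4 : x4 ∈ C) :
    ∑ b ∈ (Cᶜ ×ˢ Cᶜ).powerset, Wc J (a ∪ b) [x1, x2, x3, x4] * Qc (a ∪ b) [] =
    S2 (JC J C) x1 x2 * ∑ b ∈ (Cᶜ ×ˢ Cᶜ).powerset, Wc J (a ∪ b) [x3, x4] * Qc (a ∪ b) [] := by
  classical
  rw [sum_b J C ha, sum_b J C ha]
  have key := indep C (fun p => mon [x3, x4] p.1 * ((if Qm a (cm p.1 p.2) then 1 else 0) *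
      ∏ e ∈ a, ((Real.cosh (2 * J e) - 1) + Real.sinh (2 * J e) * (sg p.1 e.1 * sg p.1 e.2))))
    (fun p => mon [x1, x2] p.1 * (wt (JC J C) p.1 * wt (JC J C) p.2))
    (fun p => wt (JC J C) p.1 * wt (JC J C) p.2) ?_ ?_ ?_
  · have e1 : ∑ p : (V → Bool) × (V → Bool), wt (JC J C) p.1 * wt (JC J C) p.2 = Zp (JC J C) * Zp (JC J C) := by
      rw [Fintype.sum_prod_type]; unfold Zp; rw [Finset.sum_mul_sum]
    have e2 : ∑ p : (V → Bool) × (V → Bool), mon [x1, x2] p.1 * (wt (JC J C) p.1 * wt (JC J C) p.2) =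
        (S2 (JC J C) x1 x2 * Zp (JC J C)) * Zp (JC J C) := by
      have hZ := (Zp_pos (JC J C)).ne'
      have : S2 (JC J C) x1 x2 * Zp (JC J C) = ∑ s, wt (JC J C) s * mon [x1, x2] s := by
        unfold S2 ev; field_simp
      rw [this, Fintype.sum_prod_type]; unfold Zp; rw [Finset.sum_mul_sum]
      exact Finset.sum_congr rfl fun s _ => Finset.sum_congr rfl fun t _ => by ring
    rw [e1, e2] at key
    have hZ := (Zp_pos (JC J C)).ne'
    have hZ2 : Zp (JC J C) * Zp (JC J C) ≠ 0 := mul_ne_zero hZ hZ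
    refine mul_right_cancel₀ hZ2 ?_
    refine Eq.trans ?_ (key.trans ?_)
    · congr 1
      refine Finset.sum_congr rfl fun p _ => ?_
      simp only [mon_cons, mon_nil]; ring
    · have : ∀ A B C : ℝ, A * (B * C * C) = B * A * (C * C) := by intros; ring
      rw [this]
      congr 2
      refine Finset.sum_congr rfl fun p _ => ?_
      ring
  · rintro ⟨s, t⟩ ⟨s', t'⟩
    simp only [mx]
    have hm : mon [x3, x4] (fun v => if v ∈ C then s v else s' v) = mon [x3, x4] s := by
      simp [mon_cons, mon_nil, sg, h3, h4]
    have hq : Qm a (cm (fun v => if v ∈ C then s v else s' v) (fun v => if v ∈ C then t v else t' v)) ↔ Qm a (cm s t) := by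
      unfold Qm
      refine forall_congr' fun e => forall_congr' fun he => ?_
      have := Finset.mem_product.1 (ha he)
      simp [cm, this.1, this.2]
    have hp : ∏ e ∈ a, ((Real.cosh (2 * J e) - 1) + Real.sinh (2 * J e) * (sg (fun v => if v ∈ C then s v else s' v) e.1 * sg (fun v => if v ∈ C then s v else s' v) e.2)) =
       ∏ e ∈ a, ((Real.cosh (2 * J e) - 1) + Real.sinh (2 * J e) * (sg s e.1 * sg s e.2)) := by
      refine Finset.prod_congr rfl fun e he => ?_
      have := Finset.mem_product.1 (ha he)
      simp [sg, this.1, this.2]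
    rw [hm, hp]; simp only [hq]
  · rintro ⟨s, t⟩ ⟨s', t'⟩
    simp only [mx, wt_JC_mix]
    simp [mon_cons, mon_nil, sg, h1, h2]
  · rintro ⟨s, t⟩ ⟨s', t'⟩
    simp only [mx, wt_JC_mix]

open Classical in
lemma KL (J : V × V → ℝ) (C : Finset V) {x1 x2 x3 x4 : V}
    (h1 : x1 ∉ C) (h2 : x2 ∉ C) (h3 : x3 ∈ C) (h4 : x4 ∈ C) :
    ∑ ω : Finset (V × V), (if cls ω x3 = C then Wc J ω [x1, x2, x3, x4] * Qc ω [] else 0) =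
    S2 (JC J C) x1 x2 * ∑ ω : Finset (V × V), (if cls ω x3 = C then Wc J ω [x3, x4] * Qc ω [] else 0) := by
  rw [sum_cls h3, sum_cls h3, Finset.mul_sum]
  refine Finset.sum_congr rfl fun a ha => ?_
  rw [Finset.mem_filter, Finset.mem_powerset] at ha
  exact KL0 J C ha.1 h1 h2 h3 h4

open Classical in
lemma four_case (J : V × V → ℝ) (ω : Finset (V × V)) (x1 x2 x3 x4 : V) :
    Wc J ω [x1, x2, x3, x4] * Qc ω [] - Wc J ω [x1, x2, x3, x4] * Qc ω [x3, x4]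
      - Wc J ω [x1, x2, x3, x4] * Qc ω [x2, x4] - Wc J ω [x1, x2, x3, x4] * Qc ω [x2, x3] =
    -2 * (Wc J ω [x1, x2, x3, x4] * Qc ω [x3, x4]) +
     2 * (if x4 ∈ cls ω x3 ∧ x1 ∉ cls ω x3 ∧ x2 ∉ cls ω x3 then Wc J ω [x1, x2, x3, x4] * Qc ω [] else 0) := by
  by_cases hW : Wc J ω [x1, x2, x3, x4] = 0
  · simp [hW]
  have hp : ∀ u, mon [x1, x2, x3, x4] (clq ω u) ≠ -1 := fun u h => hW (Wc_eq_zero J (Qm_clq ω u) h)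
  have p2 := hp x2
  have p3 := hp x3
  simp only [mon_cons, mon_nil, sg_clq, Rl_refl, if_true] at p2 p3
  simp only [Qc_pair, mem_cls]
  have t1 : Rl ω x3 x2 ↔ Rl ω x2 x3 := ⟨Rl_symm, Rl_symm⟩
  rw [t1] at p3 ⊢
  by_cases h34 : Rl ω x3 x4
  · have t2 : Rl ω x2 x4 ↔ Rl ω x2 x3 := ⟨fun h => Rl_trans h (Rl_symm h34), fun h => Rl_trans h h34⟩
    rw [t2]
    by_cases h23 : Rl ω x2 x3 <;> by_cases h31 : Rl ω x3 x1 <;> simp [h34, h23, h31] at p3 ⊢ <;> ring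
  · by_cases h23 : Rl ω x2 x3
    · have h24 : ¬ Rl ω x2 x4 := fun h => h34 (Rl_trans (Rl_symm h23) h)
      simp [h34, h23, h24]
    · by_cases h24 : Rl ω x2 x4
      · simp [h34, h23, h24]
      · exfalso
        by_cases h21 : Rl ω x2 x1
        · have h31 : ¬ Rl ω x3 x1 := fun h => h23 (Rl_trans h21 (Rl_symm h))
          simp [h34, h23, h31] at p3
        · simp [h21, h23, h24] at p2

theorem cluster (J : V × V → ℝ) (hJ : ∀ e, 0 ≤ J e) (x1 x2 x3 x4 : V) (a : ℝ) (D : V → ℝ)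
    (h : ∀ C : Finset V, x1 ∉ C → x2 ∉ C → a - ∑ u ∈ C, D u ≤ S2 (JC J C) x1 x2)
    (h' : ∀ C : Finset V, x1 ∈ C ∨ x2 ∈ C → a - ∑ u ∈ C, D u ≤ 0) :
    S2 J x1 x3 * S2 J x2 x4 + S2 J x1 x4 * S2 J x2 x3 - S2 J x1 x2 * S2 J x3 x4 + 2 * a * S2 J x3 x4
      - 2 * ∑ u, D u * (S2 J x3 u * S2 J u x4) ≤ ev J (mon [x1, x2, x3, x4]) := by
  classical
  have hZ : 0 < Zp J ^ 2 := by have := Zp_pos J; positivity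
  have h1 := ev_mul_ev' J [x1, x3] [x2, x4] [x1, x2, x3, x4] (fun s => by simp only [mon_cons, mon_nil]; ring)
  have h2 := ev_mul_ev' J [x1, x4] [x2, x3] [x1, x2, x3, x4] (fun s => by simp only [mon_cons, mon_nil]; ring)
  have h3 := ev_mul_ev' J [x1, x2] [x3, x4] [x1, x2, x3, x4] (fun s => by simp only [mon_cons, mon_nil]; ring)
  have h4 := ev_eq_sw J [x1, x2, x3, x4]
  have h5 := ev_eq_sw J [x3, x4]
  have h6 : ∀ u, ev J (mon [x3, u]) * ev J (mon [u, x4]) = (∑ ω : Finset (V × V), Wc J ω [x3, x4] * Qc ω [x3, u]) / Zp J ^ 2 := by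
    intro u
    rw [mul_comm]
    refine ev_mul_ev' J [u, x4] [x3, u] [x3, x4] (fun s => ?_)
    simp only [mon_cons, mon_nil]
    linear_combination (-(sg s x3 * sg s x4)) * sg_sq s u
  -- main inequality
  have main : a * (∑ ω : Finset (V × V), Wc J ω [x3, x4] * Qc ω [])
      - ∑ u, D u * (∑ ω : Finset (V × V), Wc J ω [x3, x4] * Qc ω [x3, u]) ≤
      ∑ ω : Finset (V × V), (if x4 ∈ cls ω x3 ∧ x1 ∉ cls ω x3 ∧ x2 ∉ cls ω x3 then Wc J ω [x1, x2, x3, x4] * Qc ω [] else 0) := by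
    have e1 : ∑ ω : Finset (V × V), (if x4 ∈ cls ω x3 ∧ x1 ∉ cls ω x3 ∧ x2 ∉ cls ω x3 then Wc J ω [x1, x2, x3, x4] * Qc ω [] else 0)
       = ∑ C : Finset V, if x4 ∈ C ∧ x1 ∉ C ∧ x2 ∉ C then ∑ ω : Finset (V × V), (if cls ω x3 = C then Wc J ω [x1, x2, x3, x4] * Qc ω [] else 0) else 0 := by
      have : ∀ C : Finset V, (if x4 ∈ C ∧ x1 ∉ C ∧ x2 ∉ C then ∑ ω : Finset (V × V), (if cls ω x3 = C then Wc J ω [x1, x2, x3, x4] * Qc ω [] else 0) else 0)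
        = ∑ ω : Finset (V × V), if cls ω x3 = C then (if x4 ∈ C ∧ x1 ∉ C ∧ x2 ∉ C then Wc J ω [x1, x2, x3, x4] * Qc ω [] else 0) else 0 := by
        intro C; split_ifs <;> simp
      simp only [this]
      rw [Finset.sum_comm]
      refine Finset.sum_congr rfl fun ω _ => ?_
      simp
    have e2 : a * (∑ ω : Finset (V × V), Wc J ω [x3, x4] * Qc ω [])
      - ∑ u, D u * (∑ ω : Finset (V × V), Wc J ω [x3, x4] * Qc ω [x3, u]) =
      ∑ C : Finset V, (a - ∑ u ∈ C, D u) * ∑ ω : Finset (V × V), (if cls ω x3 = C then Wc J ω [x3, x4] * Qc ω [] else 0) := by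
      simp only [Finset.mul_sum]
      rw [Finset.sum_comm (s := (Finset.univ : Finset V)), Finset.sum_comm (s := (Finset.univ : Finset (Finset V))), ← Finset.sum_sub_distrib]
      refine Finset.sum_congr rfl fun ω _ => ?_
      simp only [mul_ite, mul_zero, Finset.sum_ite_eq, Finset.mem_univ, if_true, sub_mul]
      congr 1
      rw [Finset.sum_mul]
      have : cls ω x3 = Finset.univ.filter (fun v => Rl ω x3 v) := by unfold cls; congr
      rw [this, Finset.sum_filter]
      refine Finset.sum_congr rfl fun u _ => ?_
      rw [Qc_pair]; split_ifs <;> simp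
    rw [e1, e2]
    refine Finset.sum_le_sum fun C _ => ?_
    have hnn : 0 ≤ ∑ ω : Finset (V × V), (if cls ω x3 = C then Wc J ω [x3, x4] * Qc ω [] else 0) := by
      refine Finset.sum_nonneg fun ω _ => ?_
      split_ifs
      · exact mul_nonneg (Wc_nonneg J hJ _ _) (Qc_nil_nonneg _)
      · rfl
    by_cases h3C : x3 ∈ C
    swap
    · have hz : ∀ φ : Finset (V × V) → ℝ, ∑ ω : Finset (V × V), (if cls ω x3 = C then φ ω else 0) = 0 := by
        intro φ
        refine Finset.sum_eq_zero fun ω _ => if_neg ?_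
        intro hh; apply h3C; rw [← hh, mem_cls]; exact Rl_refl _ _
      rw [hz, hz]; simp
    by_cases h4C : x4 ∈ C
    swap
    · have hz : ∑ ω : Finset (V × V), (if cls ω x3 = C then Wc J ω [x3, x4] * Qc ω [] else 0) = 0 := by
        refine Finset.sum_eq_zero fun ω _ => ?_
        split_ifs with hh
        · have hn : ¬ Rl ω x3 x4 := by rw [← mem_cls, hh]; exact h4C
          rw [Wc_eq_zero J (Qm_clq ω x3)]
          · simp
          · simp [mon_cons, mon_nil, sg_clq, Rl_refl, hn]
        · rfl
      rw [hz]; simp [h4C]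
    by_cases h12 : x1 ∉ C ∧ x2 ∉ C
    · rw [if_pos ⟨h4C, h12⟩, KL J C h12.1 h12.2 h3C h4C]
      exact mul_le_mul_of_nonneg_right (h C h12.1 h12.2) hnn
    · rw [if_neg (fun hh => h12 hh.2)]
      exact mul_nonpos_of_nonpos_of_nonneg (h' C (by tauto)) hnn
  have hsum := Finset.sum_congr (rfl : (Finset.univ : Finset (Finset (V × V))) = _) (fun ω _ => four_case J ω x1 x2 x3 x4)
  simp only [Finset.sum_sub_distrib, Finset.sum_add_distrib, ← Finset.mul_sum] at hsum
  unfold S2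
  rw [h1, h2, h3, h4, h5]
  simp only [h6]
  have e7 : ∑ u, D u * ((∑ ω : Finset (V × V), Wc J ω [x3, x4] * Qc ω [x3, u]) / Zp J ^ 2) =
     (∑ u, D u * (∑ ω : Finset (V × V), Wc J ω [x3, x4] * Qc ω [x3, u])) / Zp J ^ 2 := by
    rw [Finset.sum_div]; exact Finset.sum_congr rfl fun u _ => by ring
  rw [e7]
  rw [← sub_nonneg]
  have : ∀ p q r t u v z : ℝ, v / z - (p / z + q / z - r / z + 2 * a * (t / z) - 2 * (u / z)) = (v - p - q + r - 2 * a * t + 2 * u) / z := by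
    intros; ring
  rw [this]
  refine div_nonneg ?_ hZ.le
  linarith

end ising3

/-! tanh inequalities -/
lemma hasDerivAt_tanh (x : ℝ) : HasDerivAt Real.tanh (1 - Real.tanh x ^ 2) x := by
  have h := (Real.hasDerivAt_sinh x).div (Real.hasDerivAt_cosh x) (Real.cosh_pos x).ne'
  have e : Real.tanh = Real.sinh / Real.cosh := by funext y; exact Real.tanh_eq_sinh_div_cosh y
  rw [e]
  refine h.congr_deriv ?_
  have := (Real.cosh_pos x).ne'
  show _ = 1 - (Real.sinh x / Real.cosh x) ^ 2
  field_simp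

lemma tanh_mono : Monotone Real.tanh := by
  refine monotone_of_hasDerivAt_nonneg (fun x => hasDerivAt_tanh x) (fun x => ?_)
  have h1 := Real.tanh_lt_one x
  have h2 := Real.neg_one_lt_tanh x
  show (0:ℝ) ≤ 1 - Real.tanh x ^ 2
  nlinarith

lemma tanh_nonneg {x : ℝ} (hx : 0 ≤ x) : 0 ≤ Real.tanh x := by
  have := tanh_mono hx; rwa [Real.tanh_zero] at this

lemma tanh_le_self {x : ℝ} (hx : 0 ≤ x) : Real.tanh x ≤ x := by
  have : Monotone (fun x => x - Real.tanh x) := by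
    refine monotone_of_hasDerivAt_nonneg (f' := fun x => 1 - (1 - Real.tanh x ^ 2)) (fun x => (hasDerivAt_id x).sub (hasDerivAt_tanh x)) (fun x => ?_)
    show (0:ℝ) ≤ 1 - (1 - Real.tanh x ^ 2)
    nlinarith
  have := this hx
  simp only [Real.tanh_zero] at this; linarith

lemma tanh_sq_le (x : ℝ) : Real.tanh x ^ 2 ≤ x ^ 2 := by
  rcases le_total 0 x with h | h
  · have h1 := tanh_nonneg h
    have h2 := tanh_le_self h
    nlinarith
  · have h' : 0 ≤ -x := by linarith
    have h1 := tanh_nonneg h'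
    have h2 := tanh_le_self h'
    rw [Real.tanh_neg] at h1 h2
    nlinarith

lemma mul_tanh_le (x : ℝ) : x * Real.tanh x ≤ x ^ 2 := by
  nlinarith [tanh_sq_le x, sq_nonneg (x - Real.tanh x)]

lemma T1_mono : Monotone (fun u : ℝ => Real.tanh u - u + u ^ 3 / 3) := by
  refine monotone_of_hasDerivAt_nonneg (f' := fun u => (1 - Real.tanh u ^ 2) - 1 + u ^ 2) (fun x => ?_) (fun x => ?_)
  · have := ((hasDerivAt_tanh x).sub (hasDerivAt_id x)).add ((hasDerivAt_pow 3 x).div_const 3)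
    refine HasDerivAt.congr_deriv this ?_
    norm_num; try ring
  · show (0:ℝ) ≤ (1 - Real.tanh x ^ 2) - 1 + x ^ 2
    have := tanh_sq_le x
    linarith

lemma tanh_ge {x : ℝ} (hx : 0 ≤ x) : x - x ^ 3 / 3 ≤ Real.tanh x := by
  have := T1_mono hx
  simp only [Real.tanh_zero] at this; linarith

lemma tanh_sq_ge (x : ℝ) : x ^ 2 - 2 * x ^ 4 / 3 ≤ Real.tanh x ^ 2 := by
  have key : ∀ x : ℝ, 0 ≤ x → x ^ 2 - 2 * x ^ 4 / 3 ≤ Real.tanh x ^ 2 := by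
    intro x hx
    have h := tanh_ge hx
    by_cases hs : x ^ 2 ≤ 3 / 2
    · have h0 : 0 ≤ x - x ^ 3 / 3 := by nlinarith
      have h1 : (x - x ^ 3 / 3) ^ 2 ≤ Real.tanh x ^ 2 := pow_le_pow_left₀ h0 h 2
      nlinarith [sq_nonneg (x ^ 3)]
    · push Not at hs
      nlinarith [sq_nonneg (Real.tanh x)]
  rcases le_total 0 x with h | h
  · exact key x h
  · have := key (-x) (by linarith)
    rw [Real.tanh_neg] at this
    nlinarith

lemma T2_mono : Monotone (fun u : ℝ => u - u ^ 3 / 3 + 2 * u ^ 5 / 15 - Real.tanh u) := by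
  refine monotone_of_hasDerivAt_nonneg (f' := fun u => 1 - u ^ 2 + 2 * u ^ 4 / 3 - (1 - Real.tanh u ^ 2)) (fun x => ?_) (fun x => ?_)
  · have := (((hasDerivAt_id x).sub ((hasDerivAt_pow 3 x).div_const 3)).add (((hasDerivAt_pow 5 x).const_mul 2).div_const 15)).sub (hasDerivAt_tanh x)
    refine HasDerivAt.congr_deriv this ?_
    norm_num; ring
  · show (0:ℝ) ≤ 1 - x ^ 2 + 2 * x ^ 4 / 3 - (1 - Real.tanh x ^ 2)
    have := tanh_sq_ge x
    linarith

lemma T2_mono' : Monotone (fun u : ℝ => u - u ^ 3 / 3 + 2 * u ^ 5 / 15) := by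
  have := T2_mono.add tanh_mono
  have e : (fun u : ℝ => u - u ^ 3 / 3 + 2 * u ^ 5 / 15) = (fun u : ℝ => u - u ^ 3 / 3 + 2 * u ^ 5 / 15 - Real.tanh u) + Real.tanh := by
    funext u; simp
  rw [e]; exact this

lemma T3_mono : MonotoneOn (fun u : ℝ => u - u ^ 3 / 10 - Real.tanh u) (Set.Icc (-(11/10)) (11/10)) := by
  refine monotoneOn_of_hasDerivWithinAt_nonneg (convex_Icc _ _) (f' := fun u => 1 - 3 * u ^ 2 / 10 - (1 - Real.tanh u ^ 2)) ?_ (fun x _ => HasDerivAt.hasDerivWithinAt ?_) (fun x hx => ?_)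
  · refine Continuous.continuousOn ?_
    have : Continuous Real.tanh := continuous_iff_continuousAt.2 fun x => (hasDerivAt_tanh x).continuousAt
    fun_prop
  · have := ((hasDerivAt_id x).sub ((hasDerivAt_pow 3 x).div_const 10)).sub (hasDerivAt_tanh x)
    refine HasDerivAt.congr_deriv this ?_
    norm_num; try ring
  · show (0:ℝ) ≤ 1 - 3 * x ^ 2 / 10 - (1 - Real.tanh x ^ 2)
    rw [interior_Icc] at hx
    have := tanh_sq_ge x
    have h3 : x ^ 2 - 2 * x ^ 4 / 3 ≤ Real.tanh x ^ 2 := this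
    -- need tanh² ≥ 0.3 x²
    have key : ∀ x : ℝ, 0 ≤ x → x ≤ 11/10 → 3 * x ^ 2 / 10 ≤ Real.tanh x ^ 2 := by
      intro x hx hx'
      have h := tanh_ge hx
      have h0 : 59/100 * x ≤ x - x ^ 3 / 3 := by nlinarith [mul_nonneg hx (sub_nonneg.2 hx'), mul_nonneg hx (mul_nonneg hx (sub_nonneg.2 hx'))]
      have h1 : (59/100 * x) ^ 2 ≤ Real.tanh x ^ 2 := pow_le_pow_left₀ (by positivity) (h0.trans h) 2
      nlinarith
    have : 3 * x ^ 2 / 10 ≤ Real.tanh x ^ 2 := by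
      rcases le_total 0 x with h | h
      · exact key x h hx.2.le
      · have := key (-x) (by linarith) (by linarith [hx.1])
        rw [Real.tanh_neg] at this
        nlinarith
    linarith

lemma T3_mono' : MonotoneOn (fun u : ℝ => u - u ^ 3 / 10) (Set.Icc (-(11/10)) (11/10)) := by
  have := T3_mono.add (tanh_mono.monotoneOn _)
  have e : (fun u : ℝ => u - u ^ 3 / 10) = (fun u : ℝ => u - u ^ 3 / 10 - Real.tanh u) + Real.tanh := by
    funext u; simp
  rw [e]; exact this

section ising4
variable {V : Type*} [Fintype V] [DecidableEq V]

lemma ev_hl (J : V × V → ℝ) (f : V → ℝ) (F : (V → Bool) → ℝ) :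
    ev J (fun s => hl f s * F s) = ∑ a, f a * ev J (fun s => sg s a * F s) := by
  have : (fun s => hl f s * F s) = fun s => ∑ a, f a * (sg s a * F s) := by
    funext s; unfold hl; rw [Finset.sum_mul]; exact Finset.sum_congr rfl fun a _ => by ring
  rw [this, ev_sum]
  exact Finset.sum_congr rfl fun a _ => ev_mul_left _ _ _

lemma ev_h1 (J : V × V → ℝ) (f : V → ℝ) (y : V) :
    ev J (fun s => hl f s * sg s y) = ∑ a, f a * S2 J a y := by
  rw [ev_hl]
  refine Finset.sum_congr rfl fun a _ => ?_
  unfold S2; congr 2; funext s; simp [mon_cons, mon_nil]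

lemma ev_h2 (J : V × V → ℝ) (f : V → ℝ) :
    ev J (fun s => hl f s ^ 2) = ∑ a, ∑ b, f a * f b * S2 J a b := by
  have : (fun s => hl f s ^ 2) = fun s => hl f s * hl f s := by funext s; ring
  rw [this, ev_hl]
  refine Finset.sum_congr rfl fun a _ => ?_
  have : (fun s => sg s a * hl f s) = fun s => hl f s * sg s a := by funext s; ring
  rw [this, ev_h1, Finset.mul_sum]
  exact Finset.sum_congr rfl fun b _ => by rw [S2_comm]; ring

lemma ev_h3 (J : V × V → ℝ) (f : V → ℝ) (y : V) :
    ev J (fun s => hl f s ^ 3 * sg s y) = ∑ a, ∑ b, ∑ c, f a * f b * f c * ev J (mon [y, a, b, c]) := by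
  have : (fun s => hl f s ^ 3 * sg s y) = fun s => hl f s * (hl f s * (hl f s * sg s y)) := by funext s; ring
  rw [this, ev_hl]
  refine Finset.sum_congr rfl fun a _ => ?_
  have : (fun s => sg s a * (hl f s * (hl f s * sg s y))) = fun s => hl f s * (hl f s * (sg s a * sg s y)) := by funext s; ring
  rw [this, ev_hl, Finset.mul_sum]
  refine Finset.sum_congr rfl fun b _ => ?_
  have : (fun s => sg s b * (hl f s * (sg s a * sg s y))) = fun s => hl f s * (sg s b * (sg s a * sg s y)) := by funext s; ring
  rw [this, ev_hl, Finset.mul_sum, Finset.mul_sum]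
  refine Finset.sum_congr rfl fun c _ => ?_
  have : (fun s => sg s c * (sg s b * (sg s a * sg s y))) = mon [y, a, b, c] := by
    funext s; simp only [mon_cons, mon_nil]; ring
  rw [this]; ring

lemma h3_upper (J : V × V → ℝ) (hJ : ∀ e, 0 ≤ J e) (f : V → ℝ) (hf : ∀ a, 0 ≤ f a) (y : V) :
    ev J (fun s => hl f s ^ 3 * sg s y) ≤ 3 * ev J (fun s => hl f s ^ 2) * ev J (fun s => hl f s * sg s y) := by
  have h1 : ev J (fun s => hl f s ^ 3 * sg s y) ≤ ∑ a, ∑ b, ∑ c, f a * f b * f c *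
      (S2 J y a * S2 J b c + S2 J y b * S2 J a c + S2 J y c * S2 J a b) := by
    rw [ev_h3]
    refine Finset.sum_le_sum fun a _ => Finset.sum_le_sum fun b _ => Finset.sum_le_sum fun c _ => ?_
    exact mul_le_mul_of_nonneg_left (leb4 J hJ y a b c) (mul_nonneg (mul_nonneg (hf a) (hf b)) (hf c))
  refine h1.trans (le_of_eq ?_)
  rw [ev_h1, ev_h2]
  have e1 : ∑ a, ∑ b, ∑ c, f a * f b * f c * (S2 J y a * S2 J b c) = (∑ a, ∑ b, f a * f b * S2 J a b) * ∑ a, f a * S2 J a y := by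
    rw [mul_comm, Finset.sum_mul]
    simp only [Finset.mul_sum]
    refine Finset.sum_congr rfl fun a _ => Finset.sum_congr rfl fun b _ => Finset.sum_congr rfl fun c _ => ?_
    rw [S2_comm J y a]; ring
  have e2 : ∑ a, ∑ b, ∑ c, f a * f b * f c * (S2 J y b * S2 J a c) = ∑ a, ∑ b, ∑ c, f a * f b * f c * (S2 J y a * S2 J b c) := by
    rw [Finset.sum_comm]
    refine Finset.sum_congr rfl fun a _ => Finset.sum_congr rfl fun b _ => Finset.sum_congr rfl fun c _ => by ring
  have e3 : ∑ a, ∑ b, ∑ c, f a * f b * f c * (S2 J y c * S2 J a b) = ∑ a, ∑ b, ∑ c, f a * f b * f c * (S2 J y b * S2 J a c) := by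
    refine Finset.sum_congr rfl fun a _ => ?_
    rw [Finset.sum_comm]
    refine Finset.sum_congr rfl fun b _ => Finset.sum_congr rfl fun c _ => by ring
  simp only [mul_add, Finset.sum_add_distrib]
  rw [e3, e2, e1]; ring

lemma h3_lower (J : V × V → ℝ) (hJ : ∀ e, 0 ≤ J e) (f : V → ℝ) (hf : ∀ a, 0 ≤ f a) (y : V) :
    ev J (fun s => hl f s ^ 2) * ev J (fun s => hl f s * sg s y) ≤ ev J (fun s => hl f s ^ 3 * sg s y) := by
  rw [ev_h3, ev_h1, ev_h2, mul_comm, Finset.sum_mul]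
  simp only [Finset.mul_sum]
  refine Finset.sum_le_sum fun a _ => Finset.sum_le_sum fun b _ => Finset.sum_le_sum fun c _ => ?_
  have h := gks2 J hJ [y, a] [b, c]
  have : f a * S2 J a y * (f b * f c * S2 J b c) = f a * f b * f c * (S2 J y a * S2 J b c) := by
    rw [S2_comm J y a]; ring
  rw [this]
  exact mul_le_mul_of_nonneg_left h (mul_nonneg (mul_nonneg (hf a) (hf b)) (hf c))

/-- expectation of `h⁴` -/
lemma h4_upper (J : V × V → ℝ) (hJ : ∀ e, 0 ≤ J e) (f : V → ℝ) (hf : ∀ a, 0 ≤ f a) :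
    ev J (fun s => hl f s ^ 4) ≤ 3 * ev J (fun s => hl f s ^ 2) ^ 2 := by
  have e : (fun s => hl f s ^ 4) = fun s => hl f s * hl f s ^ 3 := by funext s; ring
  rw [e, ev_hl]
  have h : ∀ a, ev J (fun s => sg s a * hl f s ^ 3) ≤ 3 * ev J (fun s => hl f s ^ 2) * ev J (fun s => hl f s * sg s a) := by
    intro a
    have : (fun s => sg s a * hl f s ^ 3) = fun s => hl f s ^ 3 * sg s a := by funext s; ring
    rw [this]; exact h3_upper J hJ f hf a
  refine (Finset.sum_le_sum fun a _ => mul_le_mul_of_nonneg_left (h a) (hf a)).trans (le_of_eq ?_)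
  have : ev J (fun s => hl f s ^ 2) = ∑ a, f a * ev J (fun s => hl f s * sg s a) := by
    have : (fun s => hl f s ^ 2) = fun s => hl f s * hl f s := by funext s; ring
    rw [this, ev_hl]
    refine Finset.sum_congr rfl fun a _ => ?_
    congr 2; funext s; ring
  conv_rhs => rw [sq, ← mul_assoc]; rhs; rw [this]
  rw [Finset.mul_sum]
  exact Finset.sum_congr rfl fun a _ => by ring

lemma ev_h4 (J : V × V → ℝ) (f : V → ℝ) :
    ev J (fun s => hl f s ^ 4) = ∑ a, ∑ b, ∑ c, ∑ d, f a * f b * f c * f d * ev J (mon [a, b, c, d]) := by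
  have e : (fun s => hl f s ^ 4) = fun s => hl f s * hl f s ^ 3 := by funext s; ring
  rw [e, ev_hl]
  refine Finset.sum_congr rfl fun a _ => ?_
  have : (fun s => sg s a * hl f s ^ 3) = fun s => hl f s ^ 3 * sg s a := by funext s; ring
  rw [this, ev_h3]
  simp only [Finset.mul_sum]
  exact Finset.sum_congr rfl fun b _ => Finset.sum_congr rfl fun c _ => Finset.sum_congr rfl fun d _ => by ring

lemma ev_h5 (J : V × V → ℝ) (f : V → ℝ) (y : V) :
    ev J (fun s => hl f s ^ 5 * sg s y) = ∑ a, ∑ b, ∑ c, ∑ d, ∑ e, f a * f b * f c * f d * f e * ev J (mon [y, a, b, c, d, e]) := by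
  have : (fun s => hl f s ^ 5 * sg s y) = fun s => hl f s * (hl f s * (hl f s * (hl f s * (hl f s * sg s y)))) := by funext s; ring
  rw [this, ev_hl]
  refine Finset.sum_congr rfl fun a _ => ?_
  have : (fun s => sg s a * (hl f s * (hl f s * (hl f s * (hl f s * sg s y))))) = fun s => hl f s * (hl f s * (hl f s * (hl f s * (sg s a * sg s y)))) := by funext s; ring
  rw [this, ev_hl, Finset.mul_sum]
  refine Finset.sum_congr rfl fun b _ => ?_
  have : (fun s => sg s b * (hl f s * (hl f s * (hl f s * (sg s a * sg s y))))) = fun s => hl f s * (hl f s * (hl f s * (sg s b * (sg s a * sg s y)))) := by funext s; ring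
  rw [this, ev_hl, Finset.mul_sum, Finset.mul_sum]
  refine Finset.sum_congr rfl fun c _ => ?_
  have : (fun s => sg s c * (hl f s * (hl f s * (sg s b * (sg s a * sg s y))))) = fun s => hl f s * (hl f s * (sg s c * (sg s b * (sg s a * sg s y)))) := by funext s; ring
  rw [this, ev_hl, Finset.mul_sum, Finset.mul_sum, Finset.mul_sum]
  refine Finset.sum_congr rfl fun d _ => ?_
  have : (fun s => sg s d * (hl f s * (sg s c * (sg s b * (sg s a * sg s y))))) = fun s => hl f s * (sg s d * (sg s c * (sg s b * (sg s a * sg s y)))) := by funext s; ring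
  rw [this, ev_hl]
  simp only [Finset.mul_sum]
  refine Finset.sum_congr rfl fun e _ => ?_
  have : (fun s => sg s e * (sg s d * (sg s c * (sg s b * (sg s a * sg s y))))) = mon [y, a, b, c, d, e] := by
    funext s; simp only [mon_cons, mon_nil]; ring
  rw [this]; ring

lemma h5_upper (J : V × V → ℝ) (hJ : ∀ e, 0 ≤ J e) (f : V → ℝ) (hf : ∀ a, 0 ≤ f a) (y : V) :
    ev J (fun s => hl f s ^ 5 * sg s y) ≤ 15 * ev J (fun s => hl f s ^ 2) ^ 2 * ev J (fun s => hl f s * sg s y) := by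
  have h1 : ev J (fun s => hl f s ^ 5 * sg s y) ≤ ∑ a, ∑ b, ∑ c, ∑ d, ∑ e, f a * f b * f c * f d * f e *
      (S2 J y a * ev J (mon [b, c, d, e]) + S2 J y b * ev J (mon [a, c, d, e])
     + S2 J y c * ev J (mon [a, b, d, e]) + S2 J y d * ev J (mon [a, b, c, e]) + S2 J y e * ev J (mon [a, b, c, d])) := by
    rw [ev_h5]
    refine Finset.sum_le_sum fun a _ => Finset.sum_le_sum fun b _ => Finset.sum_le_sum fun c _ => Finset.sum_le_sum fun d _ => Finset.sum_le_sum fun e _ => ?_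
    exact mul_le_mul_of_nonneg_left (leb6 J hJ y a b c d e)
      (mul_nonneg (mul_nonneg (mul_nonneg (mul_nonneg (hf a) (hf b)) (hf c)) (hf d)) (hf e))
  have e1 : ∑ a, ∑ b, ∑ c, ∑ d, ∑ e, f a * f b * f c * f d * f e * (S2 J y a * ev J (mon [b, c, d, e])) =
      ev J (fun s => hl f s ^ 4) * ev J (fun s => hl f s * sg s y) := by
    rw [ev_h1, ev_h4, mul_comm, Finset.sum_mul]
    simp only [Finset.mul_sum]
    refine Finset.sum_congr rfl fun a _ => Finset.sum_congr rfl fun b _ => Finset.sum_congr rfl fun c _ => Finset.sum_congr rfl fun d _ => Finset.sum_congr rfl fun e _ => ?_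
    rw [S2_comm J y a]; ring
  have e2 : ∑ a, ∑ b, ∑ c, ∑ d, ∑ e, f a * f b * f c * f d * f e * (S2 J y b * ev J (mon [a, c, d, e])) = ∑ a, ∑ b, ∑ c, ∑ d, ∑ e, f a * f b * f c * f d * f e * (S2 J y a * ev J (mon [b, c, d, e])) := by
    rw [Finset.sum_comm]
    refine Finset.sum_congr rfl fun a _ => Finset.sum_congr rfl fun b _ => Finset.sum_congr rfl fun c _ => Finset.sum_congr rfl fun d _ => Finset.sum_congr rfl fun e _ => by ring
  have e3 : ∑ a, ∑ b, ∑ c, ∑ d, ∑ e, f a * f b * f c * f d * f e * (S2 J y c * ev J (mon [a, b, d, e])) = ∑ a, ∑ b, ∑ c, ∑ d, ∑ e, f a * f b * f c * f d * f e * (S2 J y b * ev J (mon [a, c, d, e])) := by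
    refine Finset.sum_congr rfl fun a _ => ?_
    rw [Finset.sum_comm]
    refine Finset.sum_congr rfl fun b _ => Finset.sum_congr rfl fun c _ => Finset.sum_congr rfl fun d _ => Finset.sum_congr rfl fun e _ => by ring
  have e4 : ∑ a, ∑ b, ∑ c, ∑ d, ∑ e, f a * f b * f c * f d * f e * (S2 J y d * ev J (mon [a, b, c, e])) = ∑ a, ∑ b, ∑ c, ∑ d, ∑ e, f a * f b * f c * f d * f e * (S2 J y c * ev J (mon [a, b, d, e])) := by
    refine Finset.sum_congr rfl fun a _ => Finset.sum_congr rfl fun b _ => ?_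
    rw [Finset.sum_comm]
    refine Finset.sum_congr rfl fun c _ => Finset.sum_congr rfl fun d _ => Finset.sum_congr rfl fun e _ => by ring
  have e5 : ∑ a, ∑ b, ∑ c, ∑ d, ∑ e, f a * f b * f c * f d * f e * (S2 J y e * ev J (mon [a, b, c, d])) = ∑ a, ∑ b, ∑ c, ∑ d, ∑ e, f a * f b * f c * f d * f e * (S2 J y d * ev J (mon [a, b, c, e])) := by
    refine Finset.sum_congr rfl fun a _ => Finset.sum_congr rfl fun b _ => Finset.sum_congr rfl fun c _ => ?_
    rw [Finset.sum_comm]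
    refine Finset.sum_congr rfl fun d _ => Finset.sum_congr rfl fun e _ => by ring
  have h2 : ev J (fun s => hl f s ^ 5 * sg s y) ≤ 5 * (ev J (fun s => hl f s ^ 4) * ev J (fun s => hl f s * sg s y)) := by
    refine h1.trans (le_of_eq ?_)
    simp only [mul_add, Finset.sum_add_distrib]
    rw [e5, e4, e3, e2, e1]; ring
  have h3 : 0 ≤ ev J (fun s => hl f s * sg s y) := by
    rw [ev_h1]; exact Finset.sum_nonneg fun a _ => mul_nonneg (hf a) (S2_nonneg J hJ _ _)
  nlinarith [mul_le_mul_of_nonneg_right (h4_upper J hJ f hf) h3]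

end ising4

section ising5
variable {V : Type*} [Fintype V] [DecidableEq V]

/-- coupling from a kernel matrix -/
def JK (β : ℝ) (K : V → V → ℝ) (e : V × V) : ℝ := β / 2 * K e.1 e.2

lemma loc_JK (β : ℝ) (K : V → V → ℝ) (hs : ∀ x y, K x y = K y x) (x : V) (s : V → Bool) :
    loc (JK β K) x s = β * hl (K x) s := by
  unfold loc hl JK
  rw [Finset.mul_sum]
  refine Finset.sum_congr rfl fun a _ => ?_
  simp only [hs a x]; ring

lemma S2_eq (J : V × V → ℝ) (x y : V) : S2 J x y = ev J (fun s => sg s x * sg s y) := by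
  unfold S2; congr 1; funext s; simp [mon_cons, mon_nil]

lemma JK_nonneg {β : ℝ} (hβ : 0 ≤ β) {K : V → V → ℝ} (h0 : ∀ x y, 0 ≤ K x y) (e : V × V) : 0 ≤ JK β K e :=
  mul_nonneg (by linarith) (h0 _ _)

lemma S2_tanh (β : ℝ) (K : V → V → ℝ) (hs : ∀ x y, K x y = K y x) (hd : ∀ x, K x x = 0) {x y : V} (hxy : x ≠ y) :
    S2 (JK β K) x y = ev (JK β K) (fun s => Real.tanh (β * hl (K x) s) * sg s y) := by
  rw [S2_eq, sd _ x (by simp [JK, hd]) (fun s => sg s y)]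
  · simp only [loc_JK β K hs]
  · intro s; rw [sg_cm, sg_fl]; simp [hxy.symm]

lemma hl_monoK (K : V → V → ℝ) (h0 : ∀ x y, 0 ≤ K x y) {β : ℝ} (hβ : 0 ≤ β) (x : V) : Monotone (fun s : V → Bool => β * hl (K x) s) :=
  fun s t hst => mul_le_mul_of_nonneg_left (hl_mono (K x) (h0 x) hst) hβ

lemma Q_nonneg (J : V × V → ℝ) (hJ : ∀ e, 0 ≤ J e) (f : V → ℝ) (hf : ∀ a, 0 ≤ f a) (y : V) : 0 ≤ ev J (fun s => hl f s * sg s y) := by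
  rw [ev_h1]; exact Finset.sum_nonneg fun a _ => mul_nonneg (hf a) (S2_nonneg J hJ _ _)

lemma lowerS (β : ℝ) (hβ : 0 ≤ β) (K : V → V → ℝ) (hs : ∀ x y, K x y = K y x) (hd : ∀ x, K x x = 0) (h0 : ∀ x y, 0 ≤ K x y)
    (x y : V) (E : ℝ) (hE : ev (JK β K) (fun s => hl (K x) s ^ 2) ≤ E) :
    (1 - β ^ 2 * E) * (if x = y then 1 else 0) + β * (1 - β ^ 2 * E) * ∑ a, K x a * S2 (JK β K) a y ≤ S2 (JK β K) x y := by
  have hJ := JK_nonneg hβ h0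
  set J := JK β K with hJdef
  rw [← ev_h1]
  have hQ := Q_nonneg J hJ (K x) (h0 x) y
  set Q := ev J (fun s => hl (K x) s * sg s y) with hQd
  have hE0 : 0 ≤ ev J (fun s => hl (K x) s ^ 2) := ev_nonneg _ (fun s => sq_nonneg _)
  by_cases hxy : x = y
  · subst hxy
    simp only [if_true, mul_one, S2_self]
    have h1 : Q = ev J (fun s => hl (K x) s * Real.tanh (β * hl (K x) s)) := by
      have : (fun s => hl (K x) s * sg s x) = fun s => sg s x * hl (K x) s := by funext s; ring
      rw [hQd, this, sd _ x (by simp [hJdef, JK, hd]) (fun s => hl (K x) s) (fun s => hl_fl _ _ (hd x) _)]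
      simp only [hJdef, loc_JK β K hs]
      congr 1; funext s; ring
    have h2 : β * Q ≤ β ^ 2 * E := by
      have : β * Q ≤ β ^ 2 * ev J (fun s => hl (K x) s ^ 2) := by
        rw [h1, ← ev_mul_left, ← ev_mul_left]
        refine ev_mono _ fun s => ?_
        have := mul_tanh_le (β * hl (K x) s)
        nlinarith
      nlinarith [sq_nonneg β]
    have h3 : 0 ≤ β * Q := mul_nonneg hβ hQ
    by_cases ha : 0 ≤ 1 - β ^ 2 * E
    · nlinarith
    · push Not at ha
      nlinarith
  · simp only [hxy, if_false, mul_zero, zero_add]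
    rw [hJdef, S2_tanh β K hs hd hxy, ← hJdef]
    have h1 := fkg_ev J hJ (fun s => Real.tanh (β * hl (K x) s) - β * hl (K x) s + (β * hl (K x) s) ^ 3 / 3)
      (fun s t hst => T1_mono (hl_monoK K h0 hβ x hst)) y
    have h2 : (fun s => (Real.tanh (β * hl (K x) s) - β * hl (K x) s + (β * hl (K x) s) ^ 3 / 3) * sg s y) =
        fun s => (Real.tanh (β * hl (K x) s) * sg s y - β * (hl (K x) s * sg s y)) + β ^ 3 / 3 * (hl (K x) s ^ 3 * sg s y) := by
      funext s; ring
    rw [h2, ev_add, ev_sub, ev_mul_left, ev_mul_left] at h1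
    have h3 := h3_upper J hJ (K x) (h0 x) y
    have h4 : β ^ 3 / 3 * ev J (fun s => hl (K x) s ^ 3 * sg s y) ≤ β ^ 3 * (E * Q) := by
      have : ev J (fun s => hl (K x) s ^ 3 * sg s y) ≤ 3 * (E * Q) := by nlinarith
      have hb : 0 ≤ β ^ 3 / 3 := by positivity
      nlinarith [mul_le_mul_of_nonneg_left this hb]
    nlinarith

lemma upperS (β : ℝ) (hβ : 0 ≤ β) (K : V → V → ℝ) (hs : ∀ x y, K x y = K y x) (hd : ∀ x, K x x = 0) (h0 : ∀ x y, 0 ≤ K x y)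
    (x y : V) :
    S2 (JK β K) x y ≤ (if x = y then 1 else 0) + β * ev (JK β K) (fun s => hl (K x) s * sg s y)
      - β ^ 3 / 3 * ev (JK β K) (fun s => hl (K x) s ^ 3 * sg s y)
      + 2 * β ^ 5 * ev (JK β K) (fun s => hl (K x) s ^ 2) ^ 2 * ev (JK β K) (fun s => hl (K x) s * sg s y) := by
  have hJ := JK_nonneg hβ h0
  set J := JK β K with hJdef
  have h5 := h5_upper J hJ (K x) (h0 x) y
  have hb : 0 ≤ 2 * β ^ 5 / 15 := by positivity
  have h5' := mul_le_mul_of_nonneg_left h5 hb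
  by_cases hxy : x = y
  · subst hxy
    simp only [if_true, S2_self]
    have h1 := fkg_ev J hJ (fun s => β * hl (K x) s - (β * hl (K x) s) ^ 3 / 3 + 2 * (β * hl (K x) s) ^ 5 / 15)
      (fun s t hst => T2_mono' (hl_monoK K h0 hβ x hst)) x
    have h2 : (fun s => (β * hl (K x) s - (β * hl (K x) s) ^ 3 / 3 + 2 * (β * hl (K x) s) ^ 5 / 15) * sg s x) =
        fun s => (β * (hl (K x) s * sg s x) - β ^ 3 / 3 * (hl (K x) s ^ 3 * sg s x)) + 2 * β ^ 5 / 15 * (hl (K x) s ^ 5 * sg s x) := by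
      funext s; ring
    rw [h2, ev_add, ev_sub, ev_mul_left, ev_mul_left, ev_mul_left] at h1
    nlinarith
  · simp only [hxy, if_false, zero_add]
    rw [hJdef, S2_tanh β K hs hd hxy, ← hJdef]
    have h1 := fkg_ev J hJ (fun s => β * hl (K x) s - (β * hl (K x) s) ^ 3 / 3 + 2 * (β * hl (K x) s) ^ 5 / 15 - Real.tanh (β * hl (K x) s))
      (fun s t hst => T2_mono (hl_monoK K h0 hβ x hst)) y
    have h2 : (fun s => (β * hl (K x) s - (β * hl (K x) s) ^ 3 / 3 + 2 * (β * hl (K x) s) ^ 5 / 15 - Real.tanh (β * hl (K x) s)) * sg s y) =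
        fun s => (β * (hl (K x) s * sg s y) - β ^ 3 / 3 * (hl (K x) s ^ 3 * sg s y)) + 2 * β ^ 5 / 15 * (hl (K x) s ^ 5 * sg s y) - Real.tanh (β * hl (K x) s) * sg s y := by
      funext s; ring
    rw [h2, ev_sub, ev_add, ev_sub, ev_mul_left, ev_mul_left, ev_mul_left] at h1
    nlinarith

lemma hl_abs (f : V → ℝ) (hf : ∀ a, 0 ≤ f a) (h1 : ∑ a, f a ≤ 1) (s : V → Bool) : |hl f s| ≤ 1 := by
  unfold hl
  refine (Finset.abs_sum_le_sum_abs _ _).trans (le_trans (Finset.sum_le_sum fun a _ => ?_) h1)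
  rw [abs_mul, abs_of_nonneg (hf a)]
  rcases sg_cases s a with h | h <;> simp [h]

lemma upper0S (β : ℝ) (hβ : 0 ≤ β) (hβ1 : β ≤ 11 / 10) (K : V → V → ℝ) (hs : ∀ x y, K x y = K y x) (hd : ∀ x, K x x = 0) (h0 : ∀ x y, 0 ≤ K x y)
    (h1s : ∀ x, ∑ a, K x a ≤ 1) (x y : V) :
    S2 (JK β K) x y ≤ (if x = y then 1 else 0) + (β
      - β ^ 3 / 10 * ev (JK β K) (fun s => hl (K x) s ^ 2)) * ev (JK β K) (fun s => hl (K x) s * sg s y) := by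
  have hJ := JK_nonneg hβ h0
  set J := JK β K with hJdef
  have h3 := h3_lower J hJ (K x) (h0 x) y
  have hb : 0 ≤ β ^ 3 / 10 := by positivity
  have h3' := mul_le_mul_of_nonneg_left h3 hb
  have hm : ∀ s, β * hl (K x) s ∈ Set.Icc (-(11/10) : ℝ) (11/10) := by
    intro s
    have := abs_le.1 (hl_abs (K x) (h0 x) (h1s x) s)
    constructor <;> nlinarith [this.1, this.2]
  by_cases hxy : x = y
  · subst hxy
    simp only [if_true, S2_self]
    have h1 := fkg_ev J hJ (fun s => β * hl (K x) s - (β * hl (K x) s) ^ 3 / 10)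
      (fun s t hst => T3_mono' (hm s) (hm t) (hl_monoK K h0 hβ x hst)) x
    have h2 : (fun s => (β * hl (K x) s - (β * hl (K x) s) ^ 3 / 10) * sg s x) =
        fun s => (β * (hl (K x) s * sg s x) - β ^ 3 / 10 * (hl (K x) s ^ 3 * sg s x)) := by
      funext s; ring
    rw [h2, ev_sub, ev_mul_left, ev_mul_left] at h1
    -- need 0 ≤ (β - β³/10 E) Q
    have hQ := Q_nonneg J hJ (K x) (h0 x) x
    have hE : ev J (fun s => hl (K x) s ^ 2) ≤ 1 := by
      rw [← ev_const J 1]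
      refine ev_mono _ fun s => ?_
      have := abs_le.1 (hl_abs (K x) (h0 x) (h1s x) s)
      nlinarith [this.1, this.2]
    have : 0 ≤ β - β ^ 3 / 10 * ev J (fun s => hl (K x) s ^ 2) := by
      have : β ^ 3 / 10 * ev J (fun s => hl (K x) s ^ 2) ≤ β ^ 3 / 10 := by nlinarith
      nlinarith [mul_nonneg hβ (mul_nonneg (sub_nonneg.2 hβ1) (add_nonneg hβ (by norm_num : (0:ℝ) ≤ 11/10)))]
    nlinarith [mul_nonneg this hQ]
  · simp only [hxy, if_false, zero_add]
    rw [hJdef, S2_tanh β K hs hd hxy, ← hJdef]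
    have h1 := fkg_ev J hJ (fun s => β * hl (K x) s - (β * hl (K x) s) ^ 3 / 10 - Real.tanh (β * hl (K x) s))
      (fun s t hst => T3_mono (hm s) (hm t) (hl_monoK K h0 hβ x hst)) y
    have h2 : (fun s => (β * hl (K x) s - (β * hl (K x) s) ^ 3 / 10 - Real.tanh (β * hl (K x) s)) * sg s y) =
        fun s => (β * (hl (K x) s * sg s y) - β ^ 3 / 10 * (hl (K x) s ^ 3 * sg s y)) - Real.tanh (β * hl (K x) s) * sg s y := by
      funext s; ring
    rw [h2, ev_sub, ev_sub, ev_mul_left, ev_mul_left] at h1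
    nlinarith

/-- restricted kernel -/
def KC (K : V → V → ℝ) (C : Finset V) (x y : V) : ℝ := if x ∉ C ∧ y ∉ C then K x y else 0

lemma JC_JK (β : ℝ) (K : V → V → ℝ) (C : Finset V) : JC (JK β K) C = JK β (KC K C) := by
  funext e; unfold JC JK KC; split_ifs <;> simp

end ising5

section ising6
variable {V : Type*} [Fintype V] [DecidableEq V]

lemma max_principle (K : V → V → ℝ) (h0 : ∀ x y, 0 ≤ K x y) (h1s : ∀ x, ∑ a, K x a ≤ 1) (b : ℝ) (hb0 : 0 ≤ b) (hb1 : b < 1)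
    (C : Finset V) (w : V → ℝ) (hw : ∀ x ∉ C, w x ≤ b * ∑ z, KC K C x z * w z) : ∀ x ∉ C, w x ≤ 0 := by
  classical
  intro x hx
  have hne : (Finset.univ \ C).Nonempty := ⟨x, by simp [hx]⟩
  obtain ⟨m, hm, hmax⟩ := Finset.exists_max_image (Finset.univ \ C) w hne
  have hmC : m ∉ C := by simpa using hm
  have h2 : w x ≤ w m := hmax x (by simp [hx])
  refine h2.trans ?_
  by_contra hpos
  push Not at hpos
  have h3 : ∑ z, KC K C m z * w z ≤ ∑ z, K m z * w m := by
    refine Finset.sum_le_sum fun z _ => ?_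
    unfold KC
    split_ifs with h
    · exact mul_le_mul_of_nonneg_left (hmax z (by simp [h.2])) (h0 _ _)
    · rw [zero_mul]; exact mul_nonneg (h0 _ _) hpos.le
  rw [← Finset.sum_mul] at h3
  have h4 := hw m hmC
  have h5 : ∑ z, KC K C m z * w z ≤ w m := h3.trans (by nlinarith [h1s m])
  nlinarith [mul_le_mul_of_nonneg_left h5 hb0]

lemma green_lower (β : ℝ) (hβ : 0 ≤ β) (K : V → V → ℝ) (hs : ∀ x y, K x y = K y x) (hd : ∀ x, K x x = 0) (h0 : ∀ x y, 0 ≤ K x y)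
    (h1s : ∀ x, ∑ a, K x a ≤ 1) (E : ℝ) (hE : ∀ x, ev (JK β K) (fun s => hl (K x) s ^ 2) ≤ E)
    (ha : 0 ≤ 1 - β ^ 2 * E) (b : ℝ) (hb0 : 0 ≤ b) (hb1 : b < 1) (hb : b ≤ β * (1 - β ^ 2 * E))
    (G : V → V → ℝ) (hG : ∀ x y, G x y = (if x = y then 1 else 0) + b * ∑ z, K x z * G z y)
    (hG0 : ∀ x y, 0 ≤ G x y) (hG1 : ∀ x, 1 ≤ G x x) (C : Finset V) (x y : V) (hx : x ∉ C) (hy : y ∉ C) :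
    (1 - β ^ 2 * E) * G x y - ∑ u ∈ C, (1 - β ^ 2 * E) * (G x u * G u y) ≤ S2 (JC (JK β K) C) x y := by
  have hKs : ∀ x y, KC K C x y = KC K C y x := by
    intro x y; unfold KC; rw [hs x y]; simp only [and_comm]
  have hKd : ∀ x, KC K C x x = 0 := by intro x; unfold KC; split_ifs <;> simp [hd]
  have hK0 : ∀ x y, 0 ≤ KC K C x y := by intro x y; unfold KC; split_ifs <;> simp [h0]
  have hKle : ∀ x y, KC K C x y ≤ K x y := by intro x y; unfold KC; split_ifs <;> simp [h0]
  rw [JC_JK]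
  have hJ' := JK_nonneg hβ hK0
  have hE' : ∀ x, ev (JK β (KC K C)) (fun s => hl (KC K C x) s ^ 2) ≤ E := by
    intro x
    refine le_trans ?_ (hE x)
    rw [ev_h2, ev_h2]
    refine Finset.sum_le_sum fun a _ => Finset.sum_le_sum fun c _ => ?_
    refine mul_le_mul (mul_le_mul (hKle _ _) (hKle _ _) (hK0 _ _) (h0 _ _)) ?_ (S2_nonneg _ hJ' _ _) (mul_nonneg (h0 _ _) (h0 _ _))
    exact ev_mono_J _ _ hJ' (fun e => mul_le_mul_of_nonneg_left (hKle _ _) (by linarith)) _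
  have hL := fun x => lowerS β hβ (KC K C) hKs hKd hK0 x y E (hE' x)
  set α := 1 - β ^ 2 * E with hα
  set S := fun x => S2 (JK β (KC K C)) x y with hS
  have hS0 : ∀ x, 0 ≤ S x := fun x => S2_nonneg _ hJ' _ _
  set v := fun x => α * G x y - ∑ u ∈ C, α * (G x u * G u y) with hv
  have hvC : ∀ z ∈ C, v z ≤ 0 := by
    intro z hz
    have h1 : α * (G z z * G z y) ≤ ∑ u ∈ C, α * (G z u * G u y) :=
      Finset.single_le_sum (f := fun u => α * (G z u * G u y)) (fun u _ => mul_nonneg ha (mul_nonneg (hG0 _ _) (hG0 _ _))) hz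
    have h2 : G z y ≤ G z z * G z y := by nlinarith [hG0 z y, hG1 z]
    have := mul_le_mul_of_nonneg_left h2 ha
    simp only [hv]; linarith
  have hveq : ∀ x ∉ C, v x = α * (if x = y then 1 else 0) + b * ∑ z, K x z * v z := by
    intro x hx
    have e1 : ∀ u ∈ C, α * (G x u * G u y) = b * ∑ z, K x z * (α * (G z u * G u y)) := by
      intro u hu
      have : x ≠ u := fun h => hx (h ▸ hu)
      rw [hG x u]; simp only [this, if_false, zero_add]
      rw [mul_assoc, Finset.sum_mul, mul_left_comm, Finset.mul_sum]
      congr 1; exact Finset.sum_congr rfl fun z _ => by ring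
    simp only [hv]
    rw [Finset.sum_congr rfl e1, ← Finset.mul_sum, Finset.sum_comm, hG x y]
    simp only [mul_sub, Finset.sum_sub_distrib, ← Finset.mul_sum]
    have : ∑ z, K x z * (α * G z y) = α * ∑ z, K x z * G z y := by
      rw [Finset.mul_sum]; exact Finset.sum_congr rfl fun z _ => by ring
    rw [this]; ring
  have hmain : ∀ x ∉ C, v x - S x ≤ 0 := by
    refine max_principle K h0 h1s b hb0 hb1 C (fun x => v x - S x) fun x hx => ?_
    have h1 := hL x
    have h2 : ∑ z, K x z * v z ≤ ∑ z, KC K C x z * v z := by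
      refine Finset.sum_le_sum fun z _ => ?_
      unfold KC
      by_cases hz : z ∈ C
      · simp [hz]; exact mul_nonpos_of_nonneg_of_nonpos (h0 _ _) (hvC z hz)
      · simp [hz, hx]
    have h3 : 0 ≤ ∑ z, KC K C x z * S z := Finset.sum_nonneg fun z _ => mul_nonneg (hK0 _ _) (hS0 z)
    have h4 : b * ∑ z, KC K C x z * S z ≤ β * α * ∑ z, KC K C x z * S z := mul_le_mul_of_nonneg_right hb h3
    have h5 := mul_le_mul_of_nonneg_left h2 hb0
    simp only [mul_sub, Finset.sum_sub_distrib]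
    have h6 := hveq x hx
    linarith
  have := hmain x hx
  simp only [hv, hS] at this
  linarith

/-- upper bound with the cluster correction, for translation invariant style quantities. -/
lemma upper_sum (β : ℝ) (hβ : 0 ≤ β) (K : V → V → ℝ) (hs : ∀ x y, K x y = K y x) (hd : ∀ x, K x x = 0) (h0 : ∀ x y, 0 ≤ K x y)
    (h1s : ∀ x, ∑ a, K x a ≤ 1) (E : ℝ) (hE : ∀ x, ev (JK β K) (fun s => hl (K x) s ^ 2) = E)
    (ha : 0 ≤ 1 - β ^ 2 * E) (b : ℝ) (hb0 : 0 ≤ b) (hb1 : b < 1) (hb : b ≤ β * (1 - β ^ 2 * E))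
    (G : V → V → ℝ) (hG : ∀ x y, G x y = (if x = y then 1 else 0) + b * ∑ z, K x z * G z y)
    (hG0 : ∀ x y, 0 ≤ G x y) (hG1 : ∀ x, 1 ≤ G x x) (x y : V) :
    E * (∑ c, K x c * S2 (JK β K) c y) + 2 * (1 - β ^ 2 * E) * (∑ a, ∑ c, K x a * K x c * G a c) * (∑ c, K x c * S2 (JK β K) c y)
      - 2 * (1 - β ^ 2 * E) * ∑ u, (∑ a, K x a * G a u) * (∑ a, K x a * G u a) * (∑ a, K x a * S2 (JK β K) a u) * S2 (JK β K) u y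
      ≤ ev (JK β K) (fun s => hl (K x) s ^ 3 * sg s y) := by
  have hJ := JK_nonneg hβ h0
  have key : ∀ a c d, S2 (JK β K) a d * S2 (JK β K) c y + S2 (JK β K) a y * S2 (JK β K) c d - S2 (JK β K) a c * S2 (JK β K) d y
      + 2 * ((1 - β ^ 2 * E) * G a c) * S2 (JK β K) d y - 2 * ∑ u, ((1 - β ^ 2 * E) * (G a u * G u c)) * (S2 (JK β K) d u * S2 (JK β K) u y)
      ≤ ev (JK β K) (mon [y, a, c, d]) := by
    intro a c d
    have hm : mon [y, a, c, d] = mon [a, c, d, y] := by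
      funext s; simp only [mon_cons, mon_nil]; ring
    rw [hm]
    refine cluster (JK β K) hJ a c d y ((1 - β ^ 2 * E) * G a c) (fun u => (1 - β ^ 2 * E) * (G a u * G u c)) ?_ ?_
    · intro C h1 h2
      exact green_lower β hβ K hs hd h0 h1s E (fun x => (hE x).le) ha b hb0 hb1 hb G hG hG0 hG1 C a c h1 h2
    · intro C hC
      have hs1 : ∀ z ∈ C, (1 - β ^ 2 * E) * (G a z * G z c) ≤ ∑ u ∈ C, (1 - β ^ 2 * E) * (G a u * G u c) := fun z hz =>
        Finset.single_le_sum (f := fun u => (1 - β ^ 2 * E) * (G a u * G u c)) (fun u _ => mul_nonneg ha (mul_nonneg (hG0 _ _) (hG0 _ _))) hz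
      rcases hC with h | h
      · have := hs1 a h
        have h2 : G a c ≤ G a a * G a c := by nlinarith [hG0 a c, hG1 a]
        have := mul_le_mul_of_nonneg_left h2 ha
        linarith
      · have := hs1 c h
        have h2 : G a c ≤ G a c * G c c := by nlinarith [hG0 a c, hG1 c]
        have := mul_le_mul_of_nonneg_left h2 ha
        linarith
  rw [ev_h3]
  have h2 := Finset.sum_le_sum fun a (_ : a ∈ Finset.univ) => Finset.sum_le_sum fun c (_ : c ∈ Finset.univ) => Finset.sum_le_sum fun d (_ : d ∈ Finset.univ) =>
    mul_le_mul_of_nonneg_left (key a c d) (mul_nonneg (mul_nonneg (h0 x a) (h0 x c)) (h0 x d))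
  refine le_trans (le_of_eq ?_) h2
  have hEx : E = ∑ a, ∑ c, K x a * K x c * S2 (JK β K) a c := by rw [← hE x, ev_h2]
  set S := S2 (JK β K) with hS
  set α := 1 - β ^ 2 * E with hα
  set Q := ∑ c, K x c * S c y with hQ
  have t1 : ∑ a, ∑ c, ∑ d, K x a * K x c * K x d * (S a d * S c y) = E * Q := by
    rw [hEx, hQ, Finset.sum_mul]
    refine Finset.sum_congr rfl fun a _ => ?_
    rw [Finset.sum_comm, Finset.sum_mul]
    refine Finset.sum_congr rfl fun d _ => ?_
    rw [Finset.mul_sum]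
    exact Finset.sum_congr rfl fun c _ => by ring
  have t2 : ∑ a, ∑ c, ∑ d, K x a * K x c * K x d * (S a y * S c d) = E * Q := by
    rw [hEx, hQ, mul_comm, Finset.sum_mul]
    simp only [Finset.mul_sum]
    exact Finset.sum_congr rfl fun a _ => Finset.sum_congr rfl fun d _ => Finset.sum_congr rfl fun c _ => by ring
  have t3 : ∀ F : V → V → ℝ, ∑ a, ∑ c, ∑ d, K x a * K x c * K x d * (F a c * S d y) = (∑ a, ∑ c, K x a * K x c * F a c) * Q := by
    intro F
    rw [hQ, Finset.sum_mul]
    refine Finset.sum_congr rfl fun a _ => ?_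
    rw [Finset.sum_mul]
    refine Finset.sum_congr rfl fun c _ => ?_
    rw [Finset.mul_sum]
    exact Finset.sum_congr rfl fun d _ => by ring
  have t4 : ∑ a, ∑ c, ∑ d, K x a * K x c * K x d * (∑ u, (α * (G a u * G u c)) * (S d u * S u y)) =
      α * ∑ u, (∑ a, K x a * G a u) * (∑ a, K x a * G u a) * (∑ a, K x a * S a u) * S u y := by
    have : ∀ u, (∑ a, K x a * G a u) * (∑ a, K x a * G u a) * (∑ a, K x a * S a u) * S u y =
        ∑ a, ∑ c, ∑ d, K x a * K x c * K x d * ((G a u * G u c) * (S d u * S u y)) := by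
      intro u
      rw [Finset.sum_mul, Finset.sum_mul, Finset.sum_mul]
      refine Finset.sum_congr rfl fun a _ => ?_
      rw [Finset.mul_sum, Finset.sum_mul, Finset.sum_comm]
      refine Finset.sum_congr rfl fun d _ => ?_
      rw [Finset.mul_sum, Finset.sum_mul, Finset.sum_mul]
      refine Finset.sum_congr rfl fun c _ => by ring
    simp only [this]
    rw [Finset.mul_sum]
    simp only [Finset.mul_sum]
    rw [eq_comm, Finset.sum_comm]
    refine Finset.sum_congr rfl fun a _ => ?_
    rw [Finset.sum_comm]
    refine Finset.sum_congr rfl fun c _ => ?_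
    rw [Finset.sum_comm]
    refine Finset.sum_congr rfl fun d _ => Finset.sum_congr rfl fun u _ => by ring
  have t3S := t3 S
  have t3G := t3 G
  rw [← hEx] at t3S
  have : ∀ a c d, K x a * K x c * K x d * (S a d * S c y + S a y * S c d - S a c * S d y + 2 * (α * G a c) * S d y - 2 * ∑ u, α * (G a u * G u c) * (S d u * S u y))
    = K x a * K x c * K x d * (S a d * S c y) + K x a * K x c * K x d * (S a y * S c d) - K x a * K x c * K x d * (S a c * S d y)
      + 2 * α * (K x a * K x c * K x d * (G a c * S d y)) - 2 * (K x a * K x c * K x d * (∑ u, α * (G a u * G u c) * (S d u * S u y))) := by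
    intro a c d; ring
  simp only [this, Finset.sum_add_distrib, Finset.sum_sub_distrib, ← Finset.mul_sum]
  rw [t1, t2, t3S, t3G]
  rw [t4]
  ring

end ising6

section fourier
variable {V : Type*} [AddCommGroup V] [Fintype V] [DecidableEq V]

/-- real cosine characters on a finite group, abstractly -/
structure FC (c : V → V → ℝ) : Prop where
  symm : ∀ w z, c w z = c z w
  zero : ∀ w, c w 0 = 1
  prod : ∀ w x y, c w (x + y) + c w (x - y) = 2 * (c w x * c w y)
  sum : ∀ z, ∑ w, c w z = if z = 0 then (Fintype.card V : ℝ) else 0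
  le : ∀ w x, |c w x| ≤ 1
  sub : ∃ s : V → V → ℝ, ∀ w x y, c w (x - y) = c w x * c w y + s w x * s w y

/-- cosine transform -/
def ft (c : V → V → ℝ) (f : V → ℝ) (w : V) : ℝ := ∑ z, f z * c w z
/-- inverse transform -/
def iv (c : V → V → ℝ) (f : V → ℝ) (x : V) : ℝ := (Fintype.card V : ℝ)⁻¹ * ∑ w, f w * c w x
/-- convolution -/
def cv (f g : V → ℝ) (x : V) : ℝ := ∑ z, f z * g (x - z)

variable {c : V → V → ℝ}

lemma card_ne (hc : FC c) : (Fintype.card V : ℝ) ≠ 0 := by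
  have : 0 < Fintype.card V := Fintype.card_pos
  positivity

lemma c_neg (hc : FC c) (w x : V) : c w (-x) = c w x := by
  have := hc.prod w 0 x
  rw [zero_add, zero_sub, hc.zero] at this; linarith

lemma c_neg' (hc : FC c) (w x : V) : c (-w) x = c w x := by
  rw [hc.symm, c_neg hc, hc.symm]

lemma iv_eq (hc : FC c) (f : V → ℝ) (x : V) : iv c f x = (Fintype.card V : ℝ)⁻¹ * ft c f x := by
  unfold iv ft; congr 1; exact Finset.sum_congr rfl fun w _ => by rw [hc.symm]

lemma ft_even (hc : FC c) (f : V → ℝ) (w : V) : ft c f (-w) = ft c f w := by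
  unfold ft; exact Finset.sum_congr rfl fun z _ => by rw [c_neg' hc]

lemma iv_even (hc : FC c) (f : V → ℝ) (w : V) : iv c f (-w) = iv c f w := by
  rw [iv_eq hc, iv_eq hc, ft_even hc]

lemma sum_c_c (hc : FC c) (x z : V) : ∑ w, c w z * c w x = (Fintype.card V : ℝ) / 2 * ((if z = -x then 1 else 0) + (if z = x then 1 else 0)) := by
  have h : ∀ w, c w z * c w x = (1/2) * (c w (z + x) + c w (z - x)) := fun w => by rw [hc.prod]; ring
  simp only [h]
  rw [← Finset.mul_sum, Finset.sum_add_distrib, hc.sum, hc.sum]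
  simp only [add_eq_zero_iff_eq_neg, sub_eq_zero]
  split_ifs <;> ring

lemma iv_ft (hc : FC c) (f : V → ℝ) (hf : ∀ x, f (-x) = f x) (x : V) : iv c (ft c f) x = f x := by
  unfold iv ft
  have : ∑ w, (∑ z, f z * c w z) * c w x = ∑ z, f z * ∑ w, c w z * c w x := by
    simp only [Finset.sum_mul, Finset.mul_sum]
    rw [Finset.sum_comm]
    exact Finset.sum_congr rfl fun w _ => Finset.sum_congr rfl fun z _ => by ring
  rw [this]
  simp only [sum_c_c hc]
  have h2 : ∀ z, f z * ((Fintype.card V : ℝ) / 2 * ((if z = -x then 1 else 0) + (if z = x then 1 else 0))) =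
     (Fintype.card V : ℝ) / 2 * ((if z = -x then f z else 0) + (if z = x then f z else 0)) := by
    intro z; split_ifs <;> ring
  simp only [h2]
  rw [← Finset.mul_sum, Finset.sum_add_distrib]
  simp only [Finset.sum_ite_eq', Finset.mem_univ, if_true]
  rw [hf]
  have := card_ne hc
  field_simp; ring

lemma ft_iv (hc : FC c) (f : V → ℝ) (hf : ∀ x, f (-x) = f x) (x : V) : ft c (iv c f) x = f x := by
  rw [← iv_ft hc f hf x]
  unfold iv
  conv_rhs => rw [Finset.mul_sum]
  unfold ft
  refine Finset.sum_congr rfl fun z _ => ?_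
  rw [hc.symm x z, ← mul_assoc]
  congr 1
  show (Fintype.card V : ℝ)⁻¹ * _ = _
  congr 1
  exact Finset.sum_congr rfl fun w _ => by rw [hc.symm]

lemma sum_c_neg (hc : FC c) (f : V → ℝ) (hf : ∀ x, f (-x) = f x) (w x : V) :
    ∑ z, f z * c w (x - z) = ft c f w * c w x := by
  have h1 : ∑ z, f z * c w (x - z) = ∑ z, f z * c w (x + z) := by
    rw [← Equiv.sum_comp (Equiv.neg V)]
    refine Finset.sum_congr rfl fun z _ => ?_
    simp [hf]
  have h2 : 2 * ∑ z, f z * c w (x - z) = 2 * (ft c f w * c w x) := by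
    rw [two_mul]
    nth_rewrite 1 [h1]
    rw [← Finset.sum_add_distrib]
    unfold ft
    rw [Finset.sum_mul, Finset.mul_sum]
    refine Finset.sum_congr rfl fun z _ => ?_
    rw [← mul_add, hc.prod]; ring
  linarith

lemma cv_iv (hc : FC c) (f g : V → ℝ) (hf : ∀ x, f (-x) = f x) (x : V) :
    cv f (iv c g) x = iv c (fun w => ft c f w * g w) x := by
  unfold cv iv
  have : ∑ z, f z * ((Fintype.card V : ℝ)⁻¹ * ∑ w, g w * c w (x - z)) = (Fintype.card V : ℝ)⁻¹ * ∑ w, g w * ∑ z, f z * c w (x - z) := by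
    simp only [Finset.mul_sum]
    rw [Finset.sum_comm]
    exact Finset.sum_congr rfl fun w _ => Finset.sum_congr rfl fun z _ => by ring
  rw [this]
  simp only [sum_c_neg hc f hf]
  congr 1
  exact Finset.sum_congr rfl fun w _ => by ring

lemma ft_cv (hc : FC c) (f g : V → ℝ) (hf : ∀ x, f (-x) = f x) (w : V) : ft c (cv f g) w = ft c f w * ft c g w := by
  have h1 : ft c (cv f g) w = ∑ y, g y * ∑ z, f z * c w (y + z) := by
    unfold ft cv
    simp only [Finset.sum_mul, Finset.mul_sum]
    rw [Finset.sum_comm]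
    rw [Finset.sum_comm (γ := V) (f := fun y z => g y * (f z * c w (y + z)))]
    refine Finset.sum_congr rfl fun z _ => ?_
    rw [← Equiv.sum_comp (Equiv.addRight z)]
    refine Finset.sum_congr rfl fun y _ => ?_
    simp; ring
  have h2 : ∀ y, ∑ z, f z * c w (y + z) = ft c f w * c w y := by
    intro y
    rw [← sum_c_neg hc f hf, ← Equiv.sum_comp (Equiv.neg V)]
    refine Finset.sum_congr rfl fun z _ => ?_
    simp [hf, sub_eq_add_neg]
  rw [h1]
  simp only [h2]
  unfold ft
  rw [Finset.mul_sum]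
  exact Finset.sum_congr rfl fun w _ => by ring

lemma parseval (hc : FC c) (f g : V → ℝ) (hf : ∀ x, f (-x) = f x) :
    ∑ x, f x * g x = (Fintype.card V : ℝ)⁻¹ * ∑ w, ft c f w * ft c g w := by
  have : ∀ x, f x * g x = (Fintype.card V : ℝ)⁻¹ * ∑ w, ft c f w * (g x * c w x) := by
    intro x
    nth_rewrite 1 [← iv_ft hc f hf x]
    unfold iv
    rw [mul_assoc, Finset.sum_mul]
    congr 1; exact Finset.sum_congr rfl fun w _ => by ring
  simp only [this]
  rw [← Finset.mul_sum, Finset.sum_comm]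
  congr 1
  refine Finset.sum_congr rfl fun w _ => ?_
  rw [← Finset.mul_sum]; rfl

/-- `(1/n) ∑ f g` with inverse transforms -/
lemma parseval_iv (hc : FC c) (f : V → ℝ) (hf : ∀ x, f (-x) = f x) :
    ∑ x, iv c f x ^ 2 = (Fintype.card V : ℝ)⁻¹ * ∑ w, f w ^ 2 := by
  have := parseval hc (iv c f) (iv c f) (iv_even hc f)
  simp only [ft_iv hc f hf] at this
  simp only [sq]; exact this

lemma iv_sq (hc : FC c) (f : V → ℝ) (hf : ∀ x, f (-x) = f x) (x : V) :
    iv c f x ^ 2 = (Fintype.card V : ℝ)⁻¹ * iv c (cv f f) x := by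
  rw [iv_eq hc (cv f f), ft_cv hc f f hf, iv_eq hc]; ring

lemma cv_even (hc : FC c) (f g : V → ℝ) (hf : ∀ x, f (-x) = f x) (hg : ∀ x, g (-x) = g x) (x : V) : cv f g (-x) = cv f g x := by
  unfold cv
  rw [← Equiv.sum_comp (Equiv.neg V)]
  refine Finset.sum_congr rfl fun z _ => ?_
  simp only [Equiv.neg_apply, hf]
  rw [← hg]; congr 2; abel

/-- fourth moment bound -/
lemma iv_four (hc : FC c) (φ : V → ℝ) (hφ : ∀ x, φ (-x) = φ x) :
    ∑ x, iv c (fun w => φ w ^ 3) x ^ 4 ≤ ((Fintype.card V : ℝ)⁻¹) ^ 3 * (∑ w, φ w ^ 4) ^ 3 := by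
  set f := fun w => φ w ^ 3 with hf
  have hfe : ∀ x, f (-x) = f x := fun x => by simp only [hf, hφ]
  have h1 : ∀ x, iv c f x ^ 4 = ((Fintype.card V : ℝ)⁻¹) ^ 2 * iv c (cv f f) x ^ 2 := by
    intro x
    have : iv c f x ^ 4 = (iv c f x ^ 2) ^ 2 := by ring
    rw [this, iv_sq hc f hfe]; ring
  simp only [h1]
  rw [← Finset.mul_sum, parseval_iv hc _ (cv_even hc f f hfe hfe)]
  have h2 : ∀ w, cv f f w ^ 2 ≤ (∑ a, φ a ^ 4 * φ (w - a) ^ 4) * ∑ a, φ a ^ 4 := by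
    intro w
    have cs := Finset.sum_mul_sq_le_sq_mul_sq Finset.univ (fun a => φ a ^ 2 * φ (w - a) ^ 2) (fun a => φ a * φ (w - a))
    have e1 : ∑ a, φ a ^ 2 * φ (w - a) ^ 2 * (φ a * φ (w - a)) = cv f f w := by
      unfold cv; exact Finset.sum_congr rfl fun a _ => by simp only [hf]; ring
    have e2 : ∑ a, (φ a ^ 2 * φ (w - a) ^ 2) ^ 2 = ∑ a, φ a ^ 4 * φ (w - a) ^ 4 :=
      Finset.sum_congr rfl fun a _ => by ring
    rw [e1, e2] at cs
    refine cs.trans (mul_le_mul_of_nonneg_left ?_ (Finset.sum_nonneg fun a _ => by positivity))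
    have e3 : ∀ a, (φ a * φ (w - a)) ^ 2 ≤ (1/2) * φ a ^ 4 + (1/2) * φ (w - a) ^ 4 := by
      intro a; nlinarith [sq_nonneg (φ a ^ 2 - φ (w - a) ^ 2)]
    refine (Finset.sum_le_sum fun a _ => e3 a).trans (le_of_eq ?_)
    rw [Finset.sum_add_distrib, ← Finset.mul_sum, ← Finset.mul_sum]
    have : ∑ a, φ (w - a) ^ 4 = ∑ a, φ a ^ 4 := Equiv.sum_comp (Equiv.subLeft w) (fun a => φ a ^ 4)
    rw [this]; ring
  have h3 : ∑ w, cv f f w ^ 2 ≤ (∑ w, φ w ^ 4) ^ 3 := by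
    refine (Finset.sum_le_sum fun w _ => h2 w).trans (le_of_eq ?_)
    rw [← Finset.sum_mul, Finset.sum_comm]
    have : ∀ a, ∑ w, φ a ^ 4 * φ (w - a) ^ 4 = φ a ^ 4 * ∑ w, φ w ^ 4 := by
      intro a
      rw [← Finset.mul_sum]; congr 1
      exact Equiv.sum_comp (Equiv.subRight a) (fun a => φ a ^ 4)
    simp only [this]
    rw [← Finset.sum_mul]; ring
  have hn : 0 ≤ (Fintype.card V : ℝ)⁻¹ := by positivity
  calc _ = ((Fintype.card V : ℝ)⁻¹) ^ 3 * ∑ w, cv f f w ^ 2 := by ring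
    _ ≤ _ := mul_le_mul_of_nonneg_left h3 (by positivity)

/-- Green function -/
def gr (c : V → V → ℝ) (k : V → ℝ) (b : ℝ) : V → ℝ := iv c (fun w => (1 - b * ft c k w)⁻¹)

lemma ft_abs (hc : FC c) (k : V → ℝ) (h0 : ∀ x, 0 ≤ k x) (w : V) : |ft c k w| ≤ ∑ x, k x := by
  unfold ft
  refine (Finset.abs_sum_le_sum_abs _ _).trans (Finset.sum_le_sum fun x _ => ?_)
  rw [abs_mul, abs_of_nonneg (h0 x)]
  nlinarith [hc.le w x, h0 x]

lemma iv_one (hc : FC c) (x : V) : iv c (fun _ => 1) x = if x = 0 then 1 else 0 := by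
  unfold iv; simp only [one_mul]; rw [hc.sum]; have := card_ne hc; split_ifs <;> simp

lemma ft_zero (hc : FC c) (k : V → ℝ) : ft c k 0 = ∑ x, k x := by
  unfold ft; exact Finset.sum_congr rfl fun x _ => by rw [hc.symm, hc.zero, mul_one]

lemma gr_eq (hc : FC c) (k : V → ℝ) (h0 : ∀ x, 0 ≤ k x) (h1 : ∑ x, k x = 1) (hk : ∀ x, k (-x) = k x) (b : ℝ) (hb0 : 0 ≤ b) (hb1 : b < 1) (x : V) :
    gr c k b x = (if x = 0 then 1 else 0) + b * cv k (gr c k b) x := by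
  unfold gr
  rw [cv_iv hc _ _ hk, ← iv_one hc]
  unfold iv
  rw [mul_left_comm, ← mul_add]
  congr 1
  rw [Finset.mul_sum, ← Finset.sum_add_distrib]
  refine Finset.sum_congr rfl fun w _ => ?_
  have h := abs_le.1 (ft_abs hc k h0 w)
  rw [h1] at h
  have : 0 < 1 - b * ft c k w := by nlinarith [h.1, h.2]
  have := this.ne'
  field_simp
  ring

lemma cv_sum (k g : V → ℝ) (x : V) : cv k g x = ∑ z, k (x - z) * g z := by
  unfold cv
  rw [← Equiv.sum_comp (Equiv.subLeft x)]
  exact Finset.sum_congr rfl fun z _ => by simp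

lemma gr_nonneg (hc : FC c) (k : V → ℝ) (h0 : ∀ x, 0 ≤ k x) (h1 : ∑ x, k x = 1) (hk : ∀ x, k (-x) = k x) (b : ℝ) (hb0 : 0 ≤ b) (hb1 : b < 1) (x : V) :
    0 ≤ gr c k b x := by
  have hs : ∀ x : V, ∑ a, k (x - a) ≤ 1 := by
    intro x
    rw [← h1]; exact (Equiv.sum_comp (Equiv.subLeft x) k).le
  have := max_principle (fun x y => k (x - y)) (fun x y => h0 _) hs b hb0 hb1 ∅ (fun x => - gr c k b x) ?_ x (by simp)
  · linarith
  · intro x _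
    rw [gr_eq hc k h0 h1 hk b hb0 hb1 x, cv_sum]
    simp only [KC, Finset.notMem_empty, not_false_eq_true, and_self, if_true, mul_neg, Finset.sum_neg_distrib]
    split_ifs <;> linarith

lemma gr_one (hc : FC c) (k : V → ℝ) (h0 : ∀ x, 0 ≤ k x) (h1 : ∑ x, k x = 1) (hk : ∀ x, k (-x) = k x) (b : ℝ) (hb0 : 0 ≤ b) (hb1 : b < 1) :
    1 ≤ gr c k b 0 := by
  rw [gr_eq hc k h0 h1 hk b hb0 hb1]
  have : 0 ≤ cv k (gr c k b) 0 := Finset.sum_nonneg fun z _ => mul_nonneg (h0 _) (gr_nonneg hc k h0 h1 hk b hb0 hb1 _)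
  simp only [if_true]; nlinarith

end fourier

section kac
variable {V : Type*} [AddCommGroup V] [Fintype V] [DecidableEq V]

/-- translation kernel -/
def tk (k : V → ℝ) (x y : V) : ℝ := k (x - y)

def Jk (β : ℝ) (k : V → ℝ) : V × V → ℝ := JK β (tk k)
def Sf (β : ℝ) (k : V → ℝ) (x : V) : ℝ := S2 (Jk β k) x 0
def Ef (β : ℝ) (k : V → ℝ) : ℝ := ev (Jk β k) (fun s => hl (tk k 0) s ^ 2)

/-- shift of a configuration -/
def sh (a : V) (s : V → Bool) : V → Bool := fun v => s (v + a)

lemma sum_sh (a : V) (F : (V → Bool) → ℝ) : ∑ s, F (sh a s) = ∑ s, F s :=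
  Equiv.sum_comp (Equiv.arrowCongr (Equiv.addRight (-a)) (Equiv.refl Bool)) F |> fun h => by
    rw [← h]
    refine Finset.sum_congr rfl fun s _ => ?_
    congr 1; funext v
    simp [sh, Equiv.arrowCongr]

lemma en_sh (β : ℝ) (k : V → ℝ) (a : V) (s : V → Bool) : en (Jk β k) (sh a s) = en (Jk β k) s := by
  unfold en
  rw [← Equiv.sum_comp (Equiv.prodCongr (Equiv.addRight a) (Equiv.addRight a)) (fun e => Jk β k e * (sg s e.1 * sg s e.2))]
  refine Finset.sum_congr rfl fun e _ => ?_
  simp [Jk, JK, tk, sg, sh]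

lemma ev_sh (β : ℝ) (k : V → ℝ) (a : V) (F : (V → Bool) → ℝ) : ev (Jk β k) (fun s => F (sh a s)) = ev (Jk β k) F := by
  unfold ev
  congr 1
  rw [← sum_sh a (fun s => wt (Jk β k) s * F s)]
  refine Finset.sum_congr rfl fun s _ => ?_
  unfold wt; rw [en_sh]

lemma S2_sh (β : ℝ) (k : V → ℝ) (x y : V) : S2 (Jk β k) x y = Sf β k (x - y) := by
  unfold Sf
  rw [S2_eq, S2_eq, ← ev_sh β k y (fun s => sg s (x - y) * sg s 0)]
  simp [sg, sh]

lemma Sf_even (β : ℝ) (k : V → ℝ) (x : V) : Sf β k (-x) = Sf β k x := by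
  have := S2_sh β k 0 x
  rw [S2_comm] at this
  rw [zero_sub] at this; rw [← this]; rfl

lemma E_sh (β : ℝ) (k : V → ℝ) (x : V) : ev (Jk β k) (fun s => hl (tk k x) s ^ 2) = Ef β k := by
  unfold Ef
  rw [← ev_sh β k x (fun s => hl (tk k 0) s ^ 2)]
  congr 1; funext s
  congr 1
  unfold hl tk
  rw [← Equiv.sum_comp (Equiv.addRight x)]
  refine Finset.sum_congr rfl fun v _ => ?_
  simp [sg, sh]

lemma Q_sh (β : ℝ) (k : V → ℝ) (x y : V) : ∑ a, tk k x a * S2 (Jk β k) a y = cv k (Sf β k) (x - y) := by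
  simp only [S2_sh]
  unfold cv tk
  rw [← Equiv.sum_comp (Equiv.subLeft x)]
  refine Finset.sum_congr rfl fun z _ => ?_
  simp only [Equiv.subLeft_apply]
  congr 2 <;> abel

lemma quad_cv (k g : V → ℝ) (hk : ∀ x, k (-x) = k x) (x : V) :
    ∑ a, ∑ d, tk k x a * tk k x d * g (a - d) = cv k (cv k g) 0 := by
  unfold cv tk
  rw [← Equiv.sum_comp (Equiv.subLeft x)]
  refine Finset.sum_congr rfl fun z _ => ?_
  rw [← Equiv.sum_comp (Equiv.addLeft x), Finset.mul_sum]
  refine Finset.sum_congr rfl fun w _ => ?_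
  simp only [Equiv.subLeft_apply, Equiv.coe_addLeft]
  have e1 : x - (x - z) = z := by abel
  have e2 : x - (x + w) = -w := by abel
  have e3 : x - z - (x + w) = 0 - z - w := by abel
  rw [e1, e2, e3, hk]; ring

/-- the kernel hypotheses -/
structure KH (k : V → ℝ) : Prop where
  nonneg : ∀ x, 0 ≤ k x
  sum : ∑ x, k x = 1
  even : ∀ x, k (-x) = k x
  zero : k 0 = 0

variable {c : V → V → ℝ}

lemma quad_ft (hc : FC c) (k g : V → ℝ) (hk : ∀ x, k (-x) = k x) (hg : ∀ x, g (-x) = g x) :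
    cv k (cv k g) 0 = (Fintype.card V : ℝ)⁻¹ * ∑ w, ft c k w ^ 2 * ft c g w := by
  have he : ∀ x, cv k (cv k g) (-x) = cv k (cv k g) x := cv_even hc k (cv k g) hk (cv_even hc k g hk hg)
  rw [← iv_ft hc (cv k (cv k g)) he 0]
  unfold iv
  congr 1
  refine Finset.sum_congr rfl fun w _ => ?_
  rw [ft_cv hc _ _ hk, ft_cv hc _ _ hk, hc.zero]; ring

lemma E_ft (hc : FC c) (β : ℝ) (k : V → ℝ) (hk : KH k) :
    Ef β k = (Fintype.card V : ℝ)⁻¹ * ∑ w, ft c k w ^ 2 * ft c (Sf β k) w := by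
  rw [← quad_ft hc k (Sf β k) hk.even (Sf_even β k), ← quad_cv k _ hk.even 0]
  unfold Ef
  rw [ev_h2]; simp only [S2_sh]

lemma tk_symm {k : V → ℝ} (hk : KH k) (x y : V) : tk k x y = tk k y x := by
  unfold tk; rw [← hk.even]; congr 1; abel
lemma tk_diag {k : V → ℝ} (hk : KH k) (x : V) : tk k x x = 0 := by
  unfold tk; rw [sub_self, hk.zero]
lemma tk_nonneg {k : V → ℝ} (hk : KH k) (x y : V) : 0 ≤ tk k x y := hk.nonneg _
lemma tk_sum {k : V → ℝ} (hk : KH k) (x : V) : ∑ a, tk k x a ≤ 1 := by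
  unfold tk; rw [← hk.sum]; exact (Equiv.sum_comp (Equiv.subLeft x) k).le

lemma Jk_nonneg {β : ℝ} (hβ : 0 ≤ β) {k : V → ℝ} (hk : KH k) (e : V × V) : 0 ≤ Jk β k e := JK_nonneg hβ (tk_nonneg hk) e

lemma Sf_nonneg {β : ℝ} (hβ : 0 ≤ β) {k : V → ℝ} (hk : KH k) (x : V) : 0 ≤ Sf β k x := S2_nonneg _ (Jk_nonneg hβ hk) _ _

lemma Ef_nonneg (β : ℝ) (k : V → ℝ) : 0 ≤ Ef β k := ev_nonneg _ fun s => sq_nonneg _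

lemma Sf_lower {β : ℝ} (hβ : 0 ≤ β) {k : V → ℝ} (hk : KH k) (x : V) :
    (1 - β ^ 2 * Ef β k) * (if x = 0 then 1 else 0) + β * (1 - β ^ 2 * Ef β k) * cv k (Sf β k) x ≤ Sf β k x := by
  have := lowerS β hβ (tk k) (tk_symm hk) (tk_diag hk) (tk_nonneg hk) x 0 (Ef β k) (E_sh β k x).le
  have hq := Q_sh β k x 0
  unfold Jk at hq
  rw [hq, sub_zero] at this
  exact this

lemma sum_cv (k g : V → ℝ) : ∑ x, cv k g x = (∑ x, k x) * ∑ x, g x := by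
  unfold cv
  rw [Finset.sum_comm, Finset.sum_mul]
  refine Finset.sum_congr rfl fun z _ => ?_
  rw [← Finset.mul_sum]; congr 1
  exact Equiv.sum_comp (Equiv.subRight z) g

lemma chi_lower {β : ℝ} (hβ : 0 ≤ β) {k : V → ℝ} (hk : KH k) :
    (1 - β ^ 2 * Ef β k) + β * (1 - β ^ 2 * Ef β k) * ∑ x, Sf β k x ≤ ∑ x, Sf β k x := by
  have h := Finset.sum_le_sum fun x (_ : x ∈ Finset.univ) => Sf_lower hβ hk x
  rw [Finset.sum_add_distrib, ← Finset.mul_sum, ← Finset.mul_sum, sum_cv, hk.sum, one_mul] at h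
  simpa using h

lemma ft_sub (f g : V → ℝ) (w : V) : ft c (fun x => f x - g x) w = ft c f w - ft c g w := by
  unfold ft; rw [← Finset.sum_sub_distrib]; exact Finset.sum_congr rfl fun x _ => by ring
lemma ft_mul (a : ℝ) (g : V → ℝ) (w : V) : ft c (fun x => a * g x) w = a * ft c g w := by
  unfold ft; rw [Finset.mul_sum]; exact Finset.sum_congr rfl fun x _ => by ring
lemma ft_delta (hc : FC c) (w : V) : ft c (fun x => if x = 0 then (1:ℝ) else 0) w = 1 := by
  unfold ft; simp [hc.zero]

/-- remainder -/
def rh (β : ℝ) (k : V → ℝ) (x : V) : ℝ :=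
  Sf β k x - (1 - β ^ 2 * Ef β k) * (if x = 0 then 1 else 0) - β * (1 - β ^ 2 * Ef β k) * cv k (Sf β k) x

lemma rh_nonneg {β : ℝ} (hβ : 0 ≤ β) {k : V → ℝ} (hk : KH k) (x : V) : 0 ≤ rh β k x := by
  have := Sf_lower hβ hk x
  unfold rh; linarith

lemma ft_rh (hc : FC c) {β : ℝ} {k : V → ℝ} (hk : KH k) (w : V) :
    ft c (rh β k) w = ft c (Sf β k) w * (1 - β * (1 - β ^ 2 * Ef β k) * ft c k w) - (1 - β ^ 2 * Ef β k) := by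
  unfold rh
  rw [ft_sub, ft_sub, ft_mul, ft_mul, ft_delta hc, ft_cv hc _ _ hk.even]; ring

/-- infrared bound -/
lemma ir_bound (hc : FC c) {β : ℝ} (hβ : 0 ≤ β) {k : V → ℝ} (hk : KH k) (w : V) :
    ft c (Sf β k) w * (1 - β * (1 - β ^ 2 * Ef β k) * ft c k w) ≤ (∑ x, Sf β k x) * (1 - β * (1 - β ^ 2 * Ef β k)) := by
  have h1 := ft_rh (β := β) hc hk w
  have h2 := ft_rh (β := β) hc hk 0
  rw [ft_zero hc k, hk.sum, ft_zero hc (Sf β k), mul_one, ft_zero hc] at h2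
  have h3 := (abs_le.1 (ft_abs hc (rh β k) (rh_nonneg hβ hk) w)).2
  linarith

/-- positivity of the transform -/
lemma ftS_nonneg (hc : FC c) (β : ℝ) (k : V → ℝ) (w : V) : 0 ≤ ft c (Sf β k) w := by
  obtain ⟨s, hs⟩ := hc.sub
  have h1 : (0:ℝ) ≤ ∑ x, ∑ y, S2 (Jk β k) x y * c w (x - y) := by
    have e : ∑ x, ∑ y, S2 (Jk β k) x y * c w (x - y) = ev (Jk β k) (fun t => hl (c w) t ^ 2 + hl (s w) t ^ 2) := by
      rw [ev_add, ev_h2, ev_h2, ← Finset.sum_add_distrib]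
      refine Finset.sum_congr rfl fun x _ => ?_
      rw [← Finset.sum_add_distrib]
      refine Finset.sum_congr rfl fun y _ => ?_
      rw [hs]; ring
    rw [e]; exact ev_nonneg _ fun t => by positivity
  have h2 : ∑ x, ∑ y, S2 (Jk β k) x y * c w (x - y) = Fintype.card V * ft c (Sf β k) w := by
    have : ∀ x, ∑ y, S2 (Jk β k) x y * c w (x - y) = ft c (Sf β k) w := by
      intro x
      simp only [S2_sh]
      exact Equiv.sum_comp (Equiv.subLeft x) (fun z => Sf β k z * c w z)
    simp only [this]; simp
  rw [h2] at h1
  have : (0:ℝ) < Fintype.card V := by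
    have := Fintype.card_pos (α := V); exact_mod_cast this
  exact nonneg_of_mul_nonneg_right h1 this

lemma one_sub_pos (hc : FC c) {k : V → ℝ} (hk : KH k) {b : ℝ} (hb0 : 0 ≤ b) (hb1 : b < 1) (w : V) : 0 < 1 - b * ft c k w := by
  have h := abs_le.1 (ft_abs hc k hk.nonneg w)
  rw [hk.sum] at h
  nlinarith [h.1, h.2]

/-- Lower bound for `E`. -/
lemma E_lower (hc : FC c) {β : ℝ} (hβ : 0 ≤ β) {k : V → ℝ} (hk : KH k) {b : ℝ} (hb0 : 0 ≤ b) (hb1 : b < 1)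
    (hb : b ≤ β * (1 - β ^ 2 * Ef β k)) :
    (1 - β ^ 2 * Ef β k) * ((Fintype.card V : ℝ)⁻¹ * ∑ w, ft c k w ^ 2 * (1 - b * ft c k w)⁻¹)
     + (β * (1 - β ^ 2 * Ef β k) - b) * ((Fintype.card V : ℝ)⁻¹ * ((∑ x, Sf β k x) * (1 - b)⁻¹) - Ef β k) ≤ Ef β k := by
  have hp := one_sub_pos hc hk hb0 hb1
  set α := 1 - β ^ 2 * Ef β k with hα
  set S := ft c (Sf β k) with hS
  set q := ft c k with hq
  set n := (Fintype.card V : ℝ)⁻¹ with hn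
  have hn0 : 0 ≤ n := by positivity
  -- decomposition
  have h1 : ∀ w, q w ^ 2 * S w = α * (q w ^ 2 * (1 - b * q w)⁻¹) + (β * α - b) * (q w ^ 3 * S w * (1 - b * q w)⁻¹)
      + q w ^ 2 * (ft c (gr c k b) w * ft c (rh β k) w) := by
    intro w
    have hg : ft c (gr c k b) w = (1 - b * q w)⁻¹ := by
      unfold gr; rw [ft_iv hc]; intro x; rw [ft_even hc]
    have hr : ft c (rh β k) w = S w * (1 - β * α * q w) - α := ft_rh hc hk w
    rw [hg, hr]
    have hi := mul_inv_cancel₀ (hp w).ne'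
    linear_combination (-(q w ^ 2 * S w)) * hi
  have h2 : 0 ≤ n * ∑ w, q w ^ 2 * (ft c (gr c k b) w * ft c (rh β k) w) := by
    have hge : ∀ x, gr c k b (-x) = gr c k b x := iv_even hc _
    have hre : ∀ x, rh β k (-x) = rh β k x := by
      intro x; unfold rh; rw [Sf_even, cv_even hc _ _ hk.even (Sf_even β k)]; simp
    have : n * ∑ w, q w ^ 2 * (ft c (gr c k b) w * ft c (rh β k) w) = cv k (cv k (cv (gr c k b) (rh β k))) 0 := by
      rw [quad_ft hc k _ hk.even (cv_even hc _ _ hge hre)]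
      congr 1; refine Finset.sum_congr rfl fun w _ => ?_
      rw [ft_cv hc _ _ hge]
    rw [this]
    have hg0 := gr_nonneg hc k hk.nonneg hk.sum hk.even b hb0 hb1
    exact Finset.sum_nonneg fun x _ => mul_nonneg (hk.nonneg _) (Finset.sum_nonneg fun y _ => mul_nonneg (hk.nonneg _)
      (Finset.sum_nonneg fun z _ => mul_nonneg (hg0 _) (rh_nonneg hβ hk _)))
  have hE : Ef β k = n * ∑ w, q w ^ 2 * S w := E_ft hc β k hk
  have h3 : (∑ x, Sf β k x) * (1 - b)⁻¹ - ∑ w, q w ^ 2 * S w ≤ ∑ w, q w ^ 3 * S w * (1 - b * q w)⁻¹ := by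
    have hS0 : ∀ w, 0 ≤ S w := ftS_nonneg hc β k
    have e0 : q 0 = 1 := by rw [hq, ft_zero hc, hk.sum]
    have e1 : S 0 = ∑ x, Sf β k x := by rw [hS, ft_zero hc]
    have h4 : ∀ w, (if w = 0 then S 0 * (1 - b)⁻¹ else 0) - q w ^ 2 * S w ≤ q w ^ 3 * S w * (1 - b * q w)⁻¹ := by
      intro w
      have hqs : 0 ≤ q w ^ 2 * S w := mul_nonneg (sq_nonneg _) (hS0 w)
      by_cases hw : w = 0
      · subst hw
        simp only [if_true, e0]
        simp only [e0] at hqs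
        simp only [one_pow, one_mul, mul_one] at *; linarith
      · simp only [hw, if_false]
        have hqa := abs_le.1 (ft_abs hc k hk.nonneg w)
        rw [hk.sum] at hqa
        have hqa1 : -1 ≤ q w := hqa.1
        have : q w ^ 3 * S w * (1 - b * q w)⁻¹ = (q w ^ 2 * S w) * (q w * (1 - b * q w)⁻¹) := by ring
        rw [this]
        have : -1 ≤ q w * (1 - b * q w)⁻¹ := by
          rw [← div_eq_mul_inv, le_div_iff₀ (hp w)]
          nlinarith
        nlinarith
    have h5 := Finset.sum_le_sum fun w (_ : w ∈ Finset.univ) => h4 w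
    rw [Finset.sum_sub_distrib] at h5
    simp only [Finset.sum_ite_eq', Finset.mem_univ, if_true] at h5
    rw [← e1]; exact h5
  have h6 : Ef β k = α * (n * ∑ w, q w ^ 2 * (1 - b * q w)⁻¹) + (β * α - b) * (n * ∑ w, q w ^ 3 * S w * (1 - b * q w)⁻¹)
      + n * ∑ w, q w ^ 2 * (ft c (gr c k b) w * ft c (rh β k) w) := by
    rw [hE, Finset.sum_congr rfl fun w _ => h1 w]
    simp only [Finset.sum_add_distrib, ← Finset.mul_sum]; ring
  have h7 := mul_le_mul_of_nonneg_left (mul_le_mul_of_nonneg_left h3 hn0) (sub_nonneg.2 hb)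
  have e7 : n * ((∑ x, Sf β k x) * (1 - b)⁻¹ - ∑ w, q w ^ 2 * S w) = n * ((∑ x, Sf β k x) * (1 - b)⁻¹) - Ef β k := by
    rw [hE]; ring
  rw [e7] at h7
  linarith

lemma chi_upper0 {β : ℝ} (hβ : 0 ≤ β) (hβ1 : β ≤ 11 / 10) {k : V → ℝ} (hk : KH k) :
    ∑ x, Sf β k x ≤ 1 + (β - β ^ 3 / 10 * Ef β k) * ∑ x, Sf β k x := by
  have h := Finset.sum_le_sum fun x (_ : x ∈ Finset.univ) => upper0S β hβ hβ1 (tk k) (tk_symm hk) (tk_diag hk) (tk_nonneg hk) (tk_sum hk) x 0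
  have e : ∀ x, ev (JK β (tk k)) (fun s => hl (tk k x) s ^ 2) = Ef β k := E_sh β k
  have e2 : ∀ x, ev (JK β (tk k)) (fun s => hl (tk k x) s * sg s 0) = cv k (Sf β k) x := by
    intro x; rw [ev_h1]; have := Q_sh β k x 0; rw [sub_zero] at this; exact this
  simp only [e, e2] at h
  rw [Finset.sum_add_distrib, ← Finset.mul_sum, sum_cv, hk.sum, one_mul] at h
  simp only [Finset.sum_ite_eq', Finset.mem_univ, if_true] at h
  exact h

lemma chi_upper (hc : FC c) {β : ℝ} (hβ : 0 ≤ β) {k : V → ℝ} (hk : KH k) (ha : 0 ≤ 1 - β ^ 2 * Ef β k)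
    {b : ℝ} (hb0 : 0 ≤ b) (hb1 : b < 1) (hb : b ≤ β * (1 - β ^ 2 * Ef β k)) :
    ∑ x, Sf β k x ≤ 1 + (β + 2 * β ^ 5 * Ef β k ^ 2 - β ^ 3 / 3 * (Ef β k
      + 2 * (1 - β ^ 2 * Ef β k) * ((Fintype.card V : ℝ)⁻¹ * ∑ w, ft c k w ^ 2 * (1 - b * ft c k w)⁻¹)
      - 2 * (1 - β ^ 2 * Ef β k) * ∑ u, cv k (gr c k b) u ^ 2 * cv k (Sf β k) u)) * ∑ x, Sf β k x := by
  have hge : ∀ x, gr c k b (-x) = gr c k b x := iv_even hc _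
  have h := Finset.sum_le_sum fun y (_ : y ∈ Finset.univ) => upperS β hβ (tk k) (tk_symm hk) (tk_diag hk) (tk_nonneg hk) 0 y
  have hG1 : ∀ x y, gr c k b (x - y) = (if x = y then 1 else 0) + b * ∑ z, tk k x z * gr c k b (z - y) := by
    intro x y
    rw [gr_eq hc k hk.nonneg hk.sum hk.even b hb0 hb1]
    simp only [sub_eq_zero]
    congr 2
    unfold cv tk
    rw [← Equiv.sum_comp (Equiv.subLeft x)]
    refine Finset.sum_congr rfl fun z _ => ?_
    simp only [Equiv.subLeft_apply]
    congr 2; abel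
  have h3 := Finset.sum_le_sum fun y (_ : y ∈ Finset.univ) => upper_sum β hβ (tk k) (tk_symm hk) (tk_diag hk) (tk_nonneg hk) (tk_sum hk) (Ef β k) (E_sh β k)
    ha b hb0 hb1 hb (fun x y => gr c k b (x - y)) hG1 (fun x y => gr_nonneg hc k hk.nonneg hk.sum hk.even b hb0 hb1 _)
    (fun x => by simp only [sub_self]; exact gr_one hc k hk.nonneg hk.sum hk.even b hb0 hb1) 0 y
  have e : ev (JK β (tk k)) (fun s => hl (tk k 0) s ^ 2) = Ef β k := E_sh β k 0
  have e2 : ∀ y, ∑ a, tk k 0 a * S2 (JK β (tk k)) a y = cv k (Sf β k) (0 - y) := fun y => Q_sh β k 0 y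
  have e2' : ∀ y, ev (JK β (tk k)) (fun s => hl (tk k 0) s * sg s y) = cv k (Sf β k) y := by
    intro y; rw [ev_h1, e2, zero_sub, cv_even hc _ _ hk.even (Sf_even β k)]
  have e3 : ∀ y, cv k (Sf β k) (0 - y) = cv k (Sf β k) y := fun y => by rw [zero_sub, cv_even hc _ _ hk.even (Sf_even β k)]
  have e4 : ∑ a, ∑ d, tk k 0 a * tk k 0 d * gr c k b (a - d) = (Fintype.card V : ℝ)⁻¹ * ∑ w, ft c k w ^ 2 * (1 - b * ft c k w)⁻¹ := by
    rw [quad_cv k _ hk.even, quad_ft hc k _ hk.even hge]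
    congr 1; refine Finset.sum_congr rfl fun w _ => ?_
    unfold gr; rw [ft_iv hc]; intro x; rw [ft_even hc]
  have e5 : ∀ u, ∑ a, tk k 0 a * gr c k b (a - u) = cv k (gr c k b) u := by
    intro u
    unfold cv tk
    refine Finset.sum_congr rfl fun z _ => ?_
    rw [zero_sub, hk.even, ← hge]; congr 2; abel
  have e6 : ∀ u, ∑ a, tk k 0 a * gr c k b (u - a) = cv k (gr c k b) u := by
    intro u
    unfold cv tk
    refine Finset.sum_congr rfl fun z _ => ?_
    rw [zero_sub, hk.even]
  have e7 : ∀ u y, S2 (JK β (tk k)) u y = Sf β k (u - y) := S2_sh β k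
  have e8 : ∀ y, S2 (JK β (tk k)) 0 y = Sf β k y := fun y => by rw [e7, zero_sub, Sf_even]
  have e9 : ∀ u, ∑ y, Sf β k (u - y) = ∑ y, Sf β k y := fun u => Equiv.sum_comp (Equiv.subLeft u) (Sf β k)
  simp only [e, e2', e8] at h
  simp only [e2, e3, e4, e5, e6] at h3
  set χ := ∑ x, Sf β k x with hχ
  set α := 1 - β ^ 2 * Ef β k with hα
  set EG := (Fintype.card V : ℝ)⁻¹ * ∑ w, ft c k w ^ 2 * (1 - b * ft c k w)⁻¹ with hEG
  set Tt := ∑ u, cv k (gr c k b) u ^ 2 * cv k (Sf β k) u with hT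
  have hcv : ∑ y, cv k (Sf β k) y = χ := by rw [sum_cv, hk.sum, one_mul]
  have e10 : ∑ y, ∑ u, cv k (gr c k b) u * cv k (gr c k b) u * cv k (Sf β k) u * S2 (JK β (tk k)) u y = Tt * χ := by
    simp only [e7]
    rw [Finset.sum_comm]
    simp only [← Finset.mul_sum, e9]
    rw [hT, Finset.sum_mul]
    exact Finset.sum_congr rfl fun u _ => by rw [hχ]; ring
  simp only [Finset.sum_add_distrib, Finset.sum_sub_distrib, ← Finset.mul_sum] at h h3
  rw [hcv] at h h3
  rw [e10] at h3
  simp only [Finset.sum_ite_eq, Finset.mem_univ, if_true] at h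
  have hb3 : 0 ≤ β ^ 3 / 3 := by positivity
  have h4 := mul_le_mul_of_nonneg_left h3 hb3
  nlinarith

lemma T1_sq (hc : FC c) (β : ℝ) {k : V → ℝ} (hk : KH k) :
    ∑ u, cv k (Sf β k) u ^ 2 = (Fintype.card V : ℝ)⁻¹ * ∑ w, ft c k w ^ 2 * ft c (Sf β k) w ^ 2 := by
  have := parseval hc (cv k (Sf β k)) (cv k (Sf β k)) (cv_even hc _ _ hk.even (Sf_even β k))
  simp only [ft_cv hc _ _ hk.even] at this
  simp only [sq]; rw [this]; congr 1; exact Finset.sum_congr rfl fun w _ => by ring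

end kac

lemma scal_R {p κ θ : ℝ} (hp : 0 < p) (hp2 : p ≤ 2) (hκ : 0 < κ) (hκ1 : κ ≤ 1) (hθ : 0 < θ) (hθ1 : θ ≤ 1) :
    p⁻¹ - κ ^ θ * p ^ (-(1 + θ)) ≤ (1 - (1 - κ) * (1 - p))⁻¹ := by
  have hd : 1 - (1 - κ) * (1 - p) = p + κ * (1 - p) := by ring
  rw [hd]
  have hdpos : 0 < p + κ * (1 - p) := by nlinarith
  have e : κ ^ θ * p ^ (-(1 + θ)) = p⁻¹ * (κ / p) ^ θ := by
    rw [neg_add, Real.rpow_add hp, Real.rpow_neg_one, Real.div_rpow hκ.le hp.le, Real.rpow_neg hp.le]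
    field_simp
  rw [e]
  have hr : 0 ≤ (κ / p) ^ θ := by positivity
  by_cases hq : 1 - p ≤ 0
  · have : p⁻¹ ≤ (p + κ * (1 - p))⁻¹ := inv_anti₀ hdpos (by nlinarith)
    have h2 : 0 ≤ p⁻¹ * (κ / p) ^ θ := by positivity
    linarith
  · push Not at hq
    have h1 : p⁻¹ - (p + κ * (1 - p))⁻¹ = p⁻¹ * (κ * (1 - p) / (p + κ * (1 - p))) := by
      field_simp; ring
    have h2 : κ * (1 - p) / (p + κ * (1 - p)) ≤ (κ / p) ^ θ := by
      rcases le_total p κ with h | h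
      · have a1 : 1 ≤ (κ / p) ^ θ := Real.one_le_rpow ((one_le_div hp).2 h) hθ.le
        have a2 : κ * (1 - p) / (p + κ * (1 - p)) ≤ 1 := by rw [div_le_one hdpos]; linarith
        linarith
      · have a1 : κ / p ≤ (κ / p) ^ θ := by
          have := Real.rpow_le_rpow_of_exponent_ge (x := κ / p) (by positivity) ((div_le_one hp).2 h) hθ1
          rwa [Real.rpow_one] at this
        have a2 : κ * (1 - p) / (p + κ * (1 - p)) ≤ κ / p := by
          rw [div_le_div_iff₀ hdpos hp]
          have : 0 ≤ κ * (1 - p) := by positivity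
          nlinarith [mul_nonneg hκ.le this, mul_nonneg hκ.le (mul_nonneg hp.le hp.le)]
        linarith
    have := mul_le_mul_of_nonneg_left h2 (inv_nonneg.2 hp.le)
    linarith

lemma scal_c {p θ : ℝ} (hp : 0 < p) (hp2 : p ≤ 2) (hθ : 0 < θ) (hθ1 : θ ≤ 1) : p⁻¹ ≤ 2 * p ^ (-(1 + θ)) := by
  have e : p ^ (-(1 + θ)) = p⁻¹ * (p ^ θ)⁻¹ := by
    rw [neg_add, Real.rpow_add hp, Real.rpow_neg_one, Real.rpow_neg hp.le]
  rw [e]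
  have h1 : p ^ θ ≤ 2 := by
    have a : p ^ θ ≤ 2 ^ θ := Real.rpow_le_rpow hp.le hp2 hθ.le
    have b : (2:ℝ) ^ θ ≤ 2 ^ (1:ℝ) := Real.rpow_le_rpow_of_exponent_le (by norm_num) hθ1
    rw [Real.rpow_one] at b; linarith
  have h2 : (1:ℝ) ≤ 2 * (p ^ θ)⁻¹ := by
    rw [← div_eq_mul_inv, one_le_div (by positivity)]; exact h1
  have := mul_le_mul_of_nonneg_left h2 (inv_nonneg.2 hp.le)
  linarith

lemma scal_phi {p κ q : ℝ} (hp : 0 < p) (hp2 : p ≤ 2) (hκ : 0 < κ) (hκ1 : κ ≤ 1 / 2) (hq : q = 1 - p) :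
    (q ^ 2 * (1 - (1 - κ) * q)⁻¹) ^ (4 / 3 : ℝ) ≤ 4 * κ ^ (-(1/6) : ℝ) * (q ^ 2 * p ^ (-(1 + 1/6) : ℝ)) := by
  have hd : 1 - (1 - κ) * q = (1 - κ) * p + κ := by rw [hq]; ring
  rw [hd]
  have hb : p ^ (7/8 : ℝ) * κ ^ (1/8 : ℝ) / 2 ≤ (1 - κ) * p + κ := by
    have h1 := Real.geom_mean_le_arith_mean2_weighted (w₁ := 7/8) (w₂ := 1/8) (by norm_num) (by norm_num) hp.le hκ.le (by norm_num)
    nlinarith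
  have hpos : 0 < p ^ (7/8 : ℝ) * κ ^ (1/8 : ℝ) / 2 := by positivity
  have hdp : 0 < (1 - κ) * p + κ := by nlinarith
  have h2 : q ^ 2 * ((1 - κ) * p + κ)⁻¹ ≤ q ^ 2 * (p ^ (7/8 : ℝ) * κ ^ (1/8 : ℝ) / 2)⁻¹ :=
    mul_le_mul_of_nonneg_left (inv_anti₀ hpos hb) (sq_nonneg _)
  refine (Real.rpow_le_rpow (by positivity) h2 (by norm_num)).trans ?_
  have hq2 : q ^ 2 ≤ 1 := by rw [hq]; nlinarith
  rw [Real.mul_rpow (sq_nonneg _) (by positivity)]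
  have h3 : (q ^ 2) ^ (4/3 : ℝ) ≤ q ^ 2 := by
    have := Real.rpow_le_rpow_of_exponent_ge' (x := q ^ 2) (sq_nonneg _) hq2 (y := 4/3) (z := 1) (by norm_num) (by norm_num)
    rwa [Real.rpow_one] at this
  have h4 : ((p ^ (7/8 : ℝ) * κ ^ (1/8 : ℝ) / 2)⁻¹) ^ (4/3 : ℝ) ≤ 4 * (p ^ (-(1 + 1/6) : ℝ) * κ ^ (-(1/6) : ℝ)) := by
    have e1 : (p ^ (7/8 : ℝ) * κ ^ (1/8 : ℝ) / 2)⁻¹ = 2 * (p ^ (-(7/8) : ℝ) * κ ^ (-(1/8) : ℝ)) := by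
      rw [Real.rpow_neg hp.le, Real.rpow_neg hκ.le]; field_simp
    rw [e1, Real.mul_rpow (by norm_num) (by positivity), Real.mul_rpow (by positivity) (by positivity), ← Real.rpow_mul hp.le, ← Real.rpow_mul hκ.le]
    have e2 : (-(7/8) * (4/3) : ℝ) = -(1 + 1/6) := by norm_num
    have e3 : (-(1/8) * (4/3) : ℝ) = -(1/6) := by norm_num
    rw [e2, e3]
    refine mul_le_mul_of_nonneg_right ?_ (by positivity)
    have : (2:ℝ) ^ (4/3 : ℝ) ≤ 2 ^ (2:ℝ) := Real.rpow_le_rpow_of_exponent_le (by norm_num) (by norm_num)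
    refine this.trans (by norm_num)
  calc _ ≤ q ^ 2 * (4 * (p ^ (-(1 + 1/6) : ℝ) * κ ^ (-(1/6) : ℝ))) := mul_le_mul h3 h4 (by positivity) (sq_nonneg _)
    _ = _ := by ring

section kac2
variable {V : Type*} [AddCommGroup V] [Fintype V] [DecidableEq V] {c : V → V → ℝ}

/-- analytic kernel hypotheses; `B` constant, `N` scale, everything summed over nonzero modes -/
structure KA (c : V → V → ℝ) (k : V → ℝ) (B N : ℝ) : Prop where
  one_le_B : 1 ≤ B
  one_le_N : 1 ≤ N
  card : (Fintype.card V : ℝ) = 4 * N ^ 2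
  ppos : ∀ w, w ≠ 0 → 0 < 1 - ft c k w
  sup : ∀ x, k x ≤ B / N
  s16 : ∑ w, (if w = 0 then 0 else ft c k w ^ 2 * (1 - ft c k w) ^ (-(1 + 1/16) : ℝ)) ≤ B * N ^ (1 + 1/16 : ℝ)
  s6 : ∑ w, (if w = 0 then 0 else ft c k w ^ 2 * (1 - ft c k w) ^ (-(1 + 1/6) : ℝ)) ≤ B * N ^ (1 + 1/6 : ℝ)
  s1 : ∑ w, (if w = 0 then 0 else ft c k w ^ 2 * (1 - ft c k w) ^ (-(1 + 1) : ℝ)) ≤ B * N ^ (1 + 1 : ℝ)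

/-- the counterterm -/
def ccf (c : V → V → ℝ) (k : V → ℝ) (N : ℝ) : ℝ := 1 / (4 * N) * ∑ w, (if w = 0 then 0 else ft c k w ^ 2 * (1 - ft c k w)⁻¹)

lemma p_le_two (hc : FC c) {k : V → ℝ} (hk : KH k) (w : V) : 1 - ft c k w ≤ 2 := by
  have := abs_le.1 (ft_abs hc k hk.nonneg w)
  rw [hk.sum] at this; linarith [this.1]

lemma ccf_nonneg {k : V → ℝ} {B N : ℝ} (ha : KA c k B N) : 0 ≤ ccf c k N := by
  have := ha.one_le_N
  refine mul_nonneg (by positivity) (Finset.sum_nonneg fun w _ => ?_)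
  split_ifs with h
  · exact le_rfl
  · exact mul_nonneg (sq_nonneg _) (inv_nonneg.2 (ha.ppos w h).le)

lemma ccf_upper (hc : FC c) {k : V → ℝ} (hk : KH k) {B N X : ℝ} (ha : KA c k B N) (hX : 0 ≤ X) (hN : N = X ^ 16) : ccf c k N ≤ B * X := by
  have hN1 := ha.one_le_N
  have h1 : ∑ w, (if w = 0 then 0 else ft c k w ^ 2 * (1 - ft c k w)⁻¹) ≤ 2 * (B * N ^ (1 + 1/16 : ℝ)) := by
    refine le_trans ?_ (mul_le_mul_of_nonneg_left ha.s16 (by norm_num))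
    rw [Finset.mul_sum]
    refine Finset.sum_le_sum fun w _ => ?_
    split_ifs with h
    · simp
    · have := scal_c (ha.ppos w h) (p_le_two hc hk w) (θ := 1/16) (by norm_num) (by norm_num)
      nlinarith [mul_le_mul_of_nonneg_left this (sq_nonneg (ft c k w))]
  have h2 : N ^ (1 + 1/16 : ℝ) = N * X := by
    rw [Real.rpow_add (by linarith), Real.rpow_one]; congr 1
    rw [hN, ← Real.rpow_natCast, ← Real.rpow_mul hX]; norm_num
  rw [h2] at h1
  unfold ccf
  calc _ ≤ 1 / (4 * N) * (2 * (B * (N * X))) := mul_le_mul_of_nonneg_left h1 (by positivity)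
    _ = B * X / 2 := by field_simp; norm_num
    _ ≤ B * X := by have := ha.one_le_B; nlinarith [mul_nonneg (by linarith : (0:ℝ) ≤ B) hX]

lemma eG_lower (hc : FC c) {k : V → ℝ} (hk : KH k) {B N X m : ℝ} (ha : KA c k B N) (hX : 0 < X) (hN : N = X ^ 16) (hm : 0 < m) (hmX : m ≤ X) :
    ccf c k N - B * m ≤ N * ((Fintype.card V : ℝ)⁻¹ * ∑ w, ft c k w ^ 2 * (1 - (1 - m ^ 16 / N) * ft c k w)⁻¹) := by
  have hN1 := ha.one_le_N
  have hB := ha.one_le_B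
  set κ := m ^ 16 / N with hκd
  have hκ : 0 < κ := by positivity
  have hκ1 : κ ≤ 1 := by rw [hκd, hN, div_le_one (by positivity)]; exact pow_le_pow_left₀ hm.le hmX 16
  have hκr : κ ^ (1/16 : ℝ) = m / X := by
    rw [hκd, hN, ← div_pow, ← Real.rpow_natCast, ← Real.rpow_mul (by positivity)]; norm_num
  have h2 : N ^ (1 + 1/16 : ℝ) = N * X := by
    rw [Real.rpow_add (by linarith), Real.rpow_one]; congr 1
    rw [hN, ← Real.rpow_natCast, ← Real.rpow_mul hX.le]; norm_num
  have h1 : ∑ w, (if w = 0 then 0 else ft c k w ^ 2 * (1 - ft c k w)⁻¹) - m / X * (B * (N * X)) ≤ ∑ w, ft c k w ^ 2 * (1 - (1 - κ) * ft c k w)⁻¹ := by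
    have := mul_le_mul_of_nonneg_left ha.s16 (by positivity : 0 ≤ m / X)
    rw [h2] at this
    refine le_trans (sub_le_sub_left this _) ?_
    rw [Finset.mul_sum, ← Finset.sum_sub_distrib]
    refine Finset.sum_le_sum fun w _ => ?_
    split_ifs with h
    · simp only [mul_zero, sub_zero]
      have e0 : ft c k w = 1 := by rw [h, ft_zero hc, hk.sum]
      rw [e0]; norm_num; exact hκ.le
    · have := scal_R (ha.ppos w h) (p_le_two hc hk w) hκ hκ1 (θ := 1/16) (by norm_num) (by norm_num)
      rw [hκr] at this
      have e : 1 - (1 - ft c k w) = ft c k w := by ring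
      rw [e] at this
      nlinarith [mul_le_mul_of_nonneg_left this (sq_nonneg (ft c k w))]
  rw [ha.card]
  unfold ccf
  have e1 : m / X * (B * (N * X)) = m * B * N := by field_simp
  rw [e1] at h1
  calc _ ≤ 1 / (4 * N) * (∑ w, (if w = 0 then 0 else ft c k w ^ 2 * (1 - ft c k w)⁻¹) - m * B * N) := by
        rw [mul_sub]
        have : 1 / (4 * N) * (m * B * N) = m * B / 4 := by field_simp
        rw [this]; nlinarith [mul_pos hm (by linarith : 0 < B)]
    _ ≤ 1 / (4 * N) * ∑ w, ft c k w ^ 2 * (1 - (1 - κ) * ft c k w)⁻¹ := mul_le_mul_of_nonneg_left h1 (by positivity)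
    _ = _ := by
        have : N * (4 * N ^ 2)⁻¹ = 1 / (4 * N) := by field_simp
        rw [← mul_assoc, this]

lemma T0_four (hc : FC c) {k : V → ℝ} (hk : KH k) {B N X m : ℝ} (ha : KA c k B N) (hX : 0 < X) (hN : N = X ^ 16) (hm : 1 ≤ m) (hmX : 2 * m ≤ X) :
    ∑ u, cv k (gr c k (1 - m ^ 16 / N)) u ^ 4 ≤ 8 * (B ^ 3 / N ^ 3 + 2 * B ^ 3 / (N ^ 2 * m ^ 8)) := by
  have hN1 := ha.one_le_N
  have hB := ha.one_le_B
  have hm0 : 0 < m := by linarith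
  set κ := m ^ 16 / N with hκd
  have hκ : 0 < κ := by positivity
  have hκ1 : κ ≤ 1 / 2 := by
    rw [hκd, hN, div_le_iff₀ (by positivity)]
    have := pow_le_pow_left₀ (by linarith) hmX 16
    rw [mul_pow] at this
    have : 0 ≤ m ^ 16 := by positivity
    linarith
  have hb0 : 0 ≤ 1 - κ := by linarith
  have hb1 : 1 - κ < 1 := by linarith
  set φ : V → ℝ := fun w => (ft c k w ^ 2 * (1 - (1 - κ) * ft c k w)⁻¹) ^ (1/3 : ℝ) with hφ
  have hf0 : ∀ w, 0 ≤ ft c k w ^ 2 * (1 - (1 - κ) * ft c k w)⁻¹ := fun w =>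
    mul_nonneg (sq_nonneg _) (inv_nonneg.2 (one_sub_pos hc hk hb0 hb1 w).le)
  have hφe : ∀ x, φ (-x) = φ x := by intro x; simp only [hφ, ft_even hc]
  have hφ3 : ∀ w, φ w ^ 3 = ft c k w * (ft c k w * (1 - (1 - κ) * ft c k w)⁻¹) := by
    intro w; simp only [hφ]
    rw [← Real.rpow_natCast, ← Real.rpow_mul (hf0 w)]; norm_num; ring
  have hφ4 : ∀ w, φ w ^ 4 = (ft c k w ^ 2 * (1 - (1 - κ) * ft c k w)⁻¹) ^ (4/3 : ℝ) := by
    intro w; simp only [hφ]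
    rw [← Real.rpow_natCast, ← Real.rpow_mul (hf0 w)]; norm_num
  have hT0 : ∀ u, cv k (gr c k (1 - κ)) u = k u + (1 - κ) * iv c (fun w => φ w ^ 3) u := by
    intro u
    have e1 : iv c (fun w => φ w ^ 3) u = cv k (cv k (gr c k (1 - κ))) u := by
      have e2 : cv k (gr c k (1 - κ)) = iv c (fun w => ft c k w * (1 - (1 - κ) * ft c k w)⁻¹) := by
        funext x; unfold gr; rw [cv_iv hc _ _ hk.even]
      rw [e2, cv_iv hc _ _ hk.even]
      congr 1; funext w; exact hφ3 w
    rw [e1]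
    have e3 : ∀ x, gr c k (1 - κ) x = (if x = 0 then 1 else 0) + (1 - κ) * cv k (gr c k (1 - κ)) x :=
      gr_eq hc k hk.nonneg hk.sum hk.even (1 - κ) hb0 hb1
    conv_lhs => unfold cv
    rw [Finset.sum_congr rfl fun z _ => by rw [e3 (u - z)]]
    simp only [mul_add, Finset.sum_add_distrib]
    congr 1
    · simp [sub_eq_zero]
    · show _ = (1 - κ) * ∑ z, k z * cv k (gr c k (1 - κ)) (u - z)
      rw [Finset.mul_sum]
      exact Finset.sum_congr rfl fun z _ => by ring
  have h4 : ∑ w, φ w ^ 4 ≤ 5 * B * (κ ^ (-(1/6) : ℝ) * N ^ (1 + 1/6 : ℝ)) := by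
    have a1 : ∀ w, φ w ^ 4 ≤ (if w = 0 then κ⁻¹ ^ (4/3 : ℝ) else 0) + 4 * κ ^ (-(1/6) : ℝ) *
        (if w = 0 then 0 else ft c k w ^ 2 * (1 - ft c k w) ^ (-(1 + 1/6) : ℝ)) := by
      intro w
      rw [hφ4]
      split_ifs with h
      · have e0 : ft c k w = 1 := by rw [h, ft_zero hc, hk.sum]
        rw [e0]; norm_num
      · rw [zero_add]
        exact scal_phi (ha.ppos w h) (p_le_two hc hk w) hκ hκ1 (by ring)
    refine (Finset.sum_le_sum fun w _ => a1 w).trans ?_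
    rw [Finset.sum_add_distrib, ← Finset.mul_sum]
    simp only [Finset.sum_ite_eq', Finset.mem_univ, if_true]
    have a2 : κ⁻¹ ^ (4/3 : ℝ) ≤ κ ^ (-(1/6) : ℝ) * N ^ (1 + 1/6 : ℝ) := by
      have : κ⁻¹ ^ (4/3 : ℝ) = κ⁻¹ ^ (1/6 : ℝ) * κ⁻¹ ^ (1 + 1/6 : ℝ) := by
        rw [← Real.rpow_add (by positivity)]; norm_num
      rw [this, Real.inv_rpow hκ.le, ← Real.rpow_neg hκ.le]
      refine mul_le_mul_of_nonneg_left (Real.rpow_le_rpow (by positivity) ?_ (by norm_num)) (by positivity)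
      rw [hκd, inv_div, div_le_iff₀ (by positivity)]
      have : 1 ≤ m ^ 16 := one_le_pow₀ hm
      nlinarith
    have a3 := mul_le_mul_of_nonneg_left ha.s6 (by positivity : 0 ≤ 4 * κ ^ (-(1/6) : ℝ))
    have a4 : 0 ≤ κ ^ (-(1/6) : ℝ) * N ^ (1 + 1/6 : ℝ) := by positivity
    nlinarith
  have h5 : (κ ^ (-(1/6) : ℝ) * N ^ (1 + 1/6 : ℝ)) ^ 3 = N ^ 4 / m ^ 8 := by
    rw [mul_pow, ← Real.rpow_natCast, ← Real.rpow_natCast, ← Real.rpow_mul hκ.le, ← Real.rpow_mul (by linarith)]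
    have e1 : κ ^ (-(1/6) * ((3:ℕ):ℝ) : ℝ) = (X / m) ^ 8 := by
      rw [hκd, hN, ← div_pow, ← Real.rpow_natCast (m / X), ← Real.rpow_mul (by positivity)]
      have : (((16:ℕ):ℝ) * (-(1/6) * ((3:ℕ):ℝ))) = -((8:ℕ):ℝ) := by norm_num
      rw [this, Real.rpow_neg (by positivity), Real.rpow_natCast, ← inv_pow, inv_div]
    have e2 : N ^ ((1 + 1/6) * ((3:ℕ):ℝ) : ℝ) = X ^ 56 := by
      rw [hN, ← Real.rpow_natCast, ← Real.rpow_mul hX.le]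
      have : (((16:ℕ):ℝ) * ((1 + 1/6) * ((3:ℕ):ℝ))) = ((56:ℕ):ℝ) := by norm_num
      rw [this, Real.rpow_natCast]
    rw [e1, e2, hN]; field_simp
  have h6 : ∑ x, iv c (fun w => φ w ^ 3) x ^ 4 ≤ 2 * B ^ 3 / (N ^ 2 * m ^ 8) := by
    refine (iv_four hc φ hφe).trans ?_
    have hs0 : 0 ≤ ∑ w, φ w ^ 4 := Finset.sum_nonneg fun w _ => by positivity
    have := pow_le_pow_left₀ hs0 h4 3
    rw [mul_pow, h5] at this
    rw [ha.card]
    calc _ ≤ ((4 * N ^ 2)⁻¹) ^ 3 * ((5 * B) ^ 3 * (N ^ 4 / m ^ 8)) := mul_le_mul_of_nonneg_left this (by positivity)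
      _ = (125 / 64) * B ^ 3 / (N ^ 2 * m ^ 8) := by field_simp; norm_num
      _ ≤ _ := by gcongr; norm_num
  have h7 : ∑ u, k u ^ 4 ≤ B ^ 3 / N ^ 3 := by
    have : ∀ u, k u ^ 4 ≤ (B / N) ^ 3 * k u := by
      intro u
      have := pow_le_pow_left₀ (hk.nonneg u) (ha.sup u) 3
      nlinarith [mul_le_mul_of_nonneg_right this (hk.nonneg u)]
    refine (Finset.sum_le_sum fun u _ => this u).trans ?_
    rw [← Finset.mul_sum, hk.sum, mul_one, div_pow]
  have h8 : ∀ u, cv k (gr c k (1 - κ)) u ^ 4 ≤ 8 * (k u ^ 4 + iv c (fun w => φ w ^ 3) u ^ 4) := by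
    intro u
    rw [hT0]
    set a := k u
    set b := iv c (fun w => φ w ^ 3) u
    have b1 : (a + (1 - κ) * b) ^ 4 ≤ 8 * (a ^ 4 + ((1 - κ) * b) ^ 4) := by
      generalize (1 - κ) * b = d
      have e1 : (a + d) ^ 2 ≤ 2 * (a ^ 2 + d ^ 2) := by nlinarith [sq_nonneg (a - d)]
      have e2 := pow_le_pow_left₀ (sq_nonneg (a + d)) e1 2
      nlinarith [sq_nonneg (a ^ 2 - d ^ 2)]
    have b2 : ((1 - κ) * b) ^ 4 ≤ b ^ 4 := by
      rw [mul_pow]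
      have : (1 - κ) ^ 4 ≤ 1 := pow_le_one₀ hb0 hb1.le
      have hb4 : 0 ≤ b ^ 4 := by positivity
      nlinarith
    linarith
  refine (Finset.sum_le_sum fun u _ => h8 u).trans ?_
  rw [← Finset.mul_sum, Finset.sum_add_distrib]
  linarith

end kac2

set_option maxHeartbeats 1600000 in
/-- a priori scalar bounds; `u = 26 D X`. -/
lemma sc_apriori {A B D X N cc E β χ u : ℝ} (hD : D = |A| + B) (hB : 1 ≤ B) (hX : 1 ≤ X) (hu : u = 26 * D * X) (hN : u ^ 9 ≤ N)
    (hcc0 : 0 ≤ cc) (hcc : cc ≤ B * X) (hE : 0 ≤ E) (hβ : β = 1 + (cc + A) / N) (hχ : 4 * N ≤ χ)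
    (hup : χ ≤ 1 + (β - β ^ 3 / 10 * E) * χ) (hβ1 : β ≤ 11/10) :
    |β - 1| ≤ 1/1000 ∧ |β - 1| * u ^ 2 ≤ 1/1000 ∧ N * E ≤ u / 2 ∧ |cc + A| ≤ u / 26 := by
  have hA := abs_nonneg A
  have hA1 := neg_abs_le A
  have hA2 := le_abs_self A
  have hD1 : 1 ≤ D := by linarith
  have hDX : D ≤ D * X := by nlinarith
  have hu26 : 26 ≤ u := by nlinarith
  have hca : |cc + A| ≤ u / 26 := by
    have : u / 26 = D * X := by rw [hu]; ring
    rw [this, abs_le, hD]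
    constructor <;> nlinarith
  have hu9 : u ^ 3 * 26 ^ 6 ≤ N := by
    refine le_trans ?_ hN
    have : (26:ℝ) ^ 6 ≤ u ^ 6 := pow_le_pow_left₀ (by norm_num) hu26 6
    have h3 : 0 ≤ u ^ 3 := by positivity
    calc u ^ 3 * 26 ^ 6 ≤ u ^ 3 * u ^ 6 := mul_le_mul_of_nonneg_left this h3
      _ = u ^ 9 := by ring
  have hN0 : 0 < N := by have : 0 < u ^ 3 := by positivity
                         nlinarith
  have hb1 : |β - 1| * N ≤ u / 26 := by
    rw [hβ, add_sub_cancel_left, abs_div, abs_of_pos hN0, div_mul_cancel₀ _ hN0.ne']; exact hca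
  have hb2 : |β - 1| * u ^ 2 ≤ 1/1000 := by
    have h0 := abs_nonneg (β - 1)
    have h1 : |β - 1| * (u ^ 3 * 26 ^ 6) ≤ u / 26 := (mul_le_mul_of_nonneg_left hu9 h0).trans hb1
    have h2 : |β - 1| * u ^ 2 * 26 ^ 7 * u ≤ 1 * u := by linarith
    have h3 := le_of_mul_le_mul_right h2 (by linarith)
    have h4 : 0 ≤ |β - 1| * u ^ 2 := by positivity
    nlinarith
  have hb3 : |β - 1| ≤ 1/1000 := by
    have h0 := abs_nonneg (β - 1)
    have : 1 ≤ u ^ 2 := by nlinarith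
    nlinarith
  refine ⟨hb3, hb2, ?_, hca⟩
  have hχ0 : 0 < χ := by linarith
  have hb4 := abs_le.1 hb3
  have hβ3 : 99/100 ≤ β ^ 3 := by
    have : (999/1000:ℝ) ^ 3 ≤ β ^ 3 := pow_le_pow_left₀ (by norm_num) (by linarith) 3
    norm_num at this ⊢; linarith
  have h1 : (β ^ 3 / 10 * E - (β - 1)) * χ ≤ 1 := by nlinarith
  have hbN : (β - 1) * N = cc + A := by rw [hβ]; field_simp; ring
  have h2 : β ^ 3 / 10 * (N * E) - (cc + A) ≤ 1/4 := by
    by_contra h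
    push Not at h
    have h3 : (β ^ 3 / 10 * E - (β - 1)) * N > 1/4 := by nlinarith
    have h4 : 0 < β ^ 3 / 10 * E - (β - 1) := by
      by_contra h5; push Not at h5; nlinarith
    nlinarith
  have h5 : cc + A ≤ u / 26 := (le_abs_self _).trans hca
  have h6 : 0 ≤ N * E := by positivity
  have h7 := mul_le_mul_of_nonneg_right hβ3 h6
  linarith

set_option maxHeartbeats 1600000 in
/-- derived scalar bounds -/
lemma sc_two {A B D X N cc E β χ u M α : ℝ} (hD : D = |A| + B) (hB : 1 ≤ B) (hX : 1 ≤ X) (hu : u = 26 * D * X) (hN : u ^ 9 ≤ N)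
    (hcc0 : 0 ≤ cc) (hcc : cc ≤ B * X) (hE : 0 ≤ E) (hβ : β = 1 + (cc + A) / N) (hχ : 4 * N ≤ χ)
    (hup : χ ≤ 1 + (β - β ^ 3 / 10 * E) * χ) (hβ1 : β ≤ 11/10)
    (hα : α = 1 - β ^ 2 * E) (hM : M = N * (1 - β * α)) (hlow : α + β * α * χ ≤ χ) :
    0 < N ∧ 1/2 ≤ α ∧ α ≤ 1 ∧ 1/2 ≤ β ∧ 0 < M ∧ 1 + M ≤ u ∧ M = β ^ 3 * (N * E) - cc - A ∧ (1 + M) ^ 8 * (N * E) ≤ N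
    ∧ |β ^ 3 - 1| * (N * E) ≤ 1 ∧ E * β ^ 2 * cc ≤ 1 ∧ β ^ 5 * (N * E) * E * 2 ≤ 1 ∧ (1 - β ^ 3 * α) * cc ≤ 1
    ∧ β ^ 3 ≤ 2 ∧ 0 ≤ β ^ 3 := by
  obtain ⟨hb, hbu, he, hca⟩ := sc_apriori hD hB hX hu hN hcc0 hcc hE hβ hχ hup hβ1
  have hA := abs_nonneg A
  have hD1 : 1 ≤ D := by linarith
  have hDX : D ≤ D * X := by nlinarith
  have hu26 : 26 ≤ u := by nlinarith
  have hccu : cc ≤ u / 26 := by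
    have : u / 26 = D * X := by rw [hu]; ring
    rw [this, hD]; nlinarith
  have hN8 : u * u ^ 8 ≤ N := by linarith [hN, (by ring : u * u ^ 8 = u ^ 9)]
  have hN3 : u ^ 3 * 26 ^ 6 ≤ N := by
    refine le_trans ?_ hN
    have : (26:ℝ) ^ 6 ≤ u ^ 6 := pow_le_pow_left₀ (by norm_num) hu26 6
    calc u ^ 3 * 26 ^ 6 ≤ u ^ 3 * u ^ 6 := mul_le_mul_of_nonneg_left this (by positivity)
      _ = u ^ 9 := by ring
  have hN0 : 0 < N := by have : 0 < u ^ 3 := by positivity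
                         nlinarith
  have hEu : E * u ^ 2 ≤ 1 / 1000 := by
    have h1 : E * (u ^ 3 * 26 ^ 6) ≤ u / 2 := by
      have := mul_le_mul_of_nonneg_left hN3 hE
      linarith
    have h2 : E * u ^ 2 * 26 ^ 6 * u ≤ (1/2) * u := by linarith
    have h3 := le_of_mul_le_mul_right h2 (by linarith)
    have : 0 ≤ E * u ^ 2 := by positivity
    nlinarith
  have hEs : E ≤ 1/1000 := by
    have : 1 ≤ u ^ 2 := by nlinarith
    nlinarith
  have hb4 := abs_le.1 hb
  have hβ2 : β ^ 2 ≤ 2 := by nlinarith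
  have hβ3 : β ^ 3 ≤ 2 := by
    have : β ^ 3 ≤ (11/10:ℝ) ^ 3 := pow_le_pow_left₀ (by linarith) hβ1 3
    norm_num at this ⊢; linarith
  have hβ5 : β ^ 5 ≤ 2 := by
    have : β ^ 5 ≤ (11/10:ℝ) ^ 5 := pow_le_pow_left₀ (by linarith) hβ1 5
    norm_num at this ⊢; linarith
  have hα2 : α ≤ 1 := by rw [hα]; have : 0 ≤ β ^ 2 * E := by positivity
                         linarith
  have hα1 : 1/2 ≤ α := by rw [hα]; nlinarith
  have hχ0 : 0 < χ := by linarith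
  have hbN : (β - 1) * N = cc + A := by rw [hβ]; field_simp; ring
  have hMe : M = β ^ 3 * (N * E) - cc - A := by
    rw [hM, hα]; linear_combination (-1) * hbN
  have hβ0 : 0 ≤ β := by linarith
  have hMpos : 0 < M := by
    rw [hM]; refine mul_pos hN0 ?_
    by_contra h; push Not at h
    nlinarith
  have he0 : 0 ≤ N * E := by positivity
  have hb3 : β ^ 3 ≤ 11/10 := by
    have h : β ≤ 1001/1000 := by linarith
    have : β ^ 3 ≤ (1001/1000:ℝ) ^ 3 := pow_le_pow_left₀ (by linarith) h 3
    norm_num at this ⊢; linarith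
  have hMu : 1 + M ≤ u := by
    have := (abs_le.1 hca).1
    have h2 : β ^ 3 * (N * E) ≤ 11/10 * (u / 2) := mul_le_mul hb3 he he0 (by norm_num)
    rw [hMe]; linarith
  have hb3a : |β ^ 3 - 1| ≤ 4 * |β - 1| := by
    have : β ^ 3 - 1 = (β - 1) * (β ^ 2 + β + 1) := by ring
    rw [this, abs_mul, mul_comm]
    refine mul_le_mul_of_nonneg_right ?_ (abs_nonneg _)
    rw [abs_of_nonneg (by positivity)]; nlinarith
  have hbb : 4 * |β - 1| * u ≤ 1/1000 := by
    have h0 := abs_nonneg (β - 1)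
    have : 0 ≤ |β - 1| * u := by positivity
    nlinarith
  refine ⟨hN0, hα1, hα2, by linarith, hMpos, hMu, hMe, ?_, ?_, ?_, ?_, ?_, hβ3, by positivity⟩
  · have : (1 + M) ^ 8 ≤ u ^ 8 := pow_le_pow_left₀ (by linarith) hMu 8
    calc (1 + M) ^ 8 * (N * E) ≤ u ^ 8 * (u / 2) := mul_le_mul this he he0 (by positivity)
      _ ≤ N := by have : 0 ≤ u ^ 8 * u := by positivity
                  nlinarith
  · calc _ ≤ 4 * |β - 1| * (u / 2) := mul_le_mul hb3a he he0 (by positivity)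
      _ ≤ 1 := by linarith
  · have h1 : E * cc ≤ E * u ^ 2 := mul_le_mul_of_nonneg_left (by nlinarith) hE
    have h2 : 0 ≤ E * cc := by positivity
    nlinarith
  · have h1 : E * (N * E) ≤ E * u ^ 2 := mul_le_mul_of_nonneg_left (by nlinarith) hE
    have h2 : 0 ≤ E * (N * E) := by positivity
    have h3 : 0 ≤ β ^ 5 := by positivity
    nlinarith
  · have h1 : (1 - β ^ 3 * α) = (1 - β ^ 3) + β ^ 5 * E := by rw [hα]; ring
    rw [h1]
    have h2 : (1 - β ^ 3) * cc ≤ |β ^ 3 - 1| * cc := mul_le_mul_of_nonneg_right (by rw [abs_sub_comm]; exact le_abs_self _) hcc0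
    have h3 : |β ^ 3 - 1| * cc ≤ 4 * |β - 1| * u := mul_le_mul hb3a (by linarith) hcc0 (by positivity)
    have h4 : E * cc ≤ E * u ^ 2 := mul_le_mul_of_nonneg_left (by nlinarith) hE
    have h5 : 0 ≤ E * cc := by positivity
    nlinarith

lemma sc_y {A B D N cc E β M α m y eG : ℝ} (hD : D = |A| + B) (hB : 1 ≤ B) (hN0 : 0 < N) (hE : 0 ≤ E) (hα1 : α ≤ 1) (hα0 : 1/2 ≤ α) (hα : α = 1 - β ^ 2 * E)
    (hM0 : 0 < M) (hM : M = β ^ 3 * (N * E) - cc - A) (hm : 1 ≤ m) (hm2 : m ^ 2 = 1 + M) (hy : 0 ≤ y)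
    (h8 : (1 + M) ^ 8 * (N * E) ≤ N) (h3 : |β ^ 3 - 1| * (N * E) ≤ 1) (hEc : E * β ^ 2 * cc ≤ 1)
    (hG : cc - B * m ≤ eG)
    (hlow : α * eG + (m ^ 16 - M) * (y / m ^ 16 - E) ≤ N * E) : y ≤ 2 * (D + 3) * (1 + M) := by
  have hK : m ^ 16 = (1 + M) ^ 8 := by rw [← hm2]; ring
  have hK2 : 2 * M ≤ m ^ 16 := by
    rw [hK]
    have : (1 + M) ^ 2 ≤ (1 + M) ^ 8 := pow_le_pow_right₀ (by linarith) (by norm_num)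
    nlinarith
  have hKp : 0 < m ^ 16 := by positivity
  have h1 : y / 2 ≤ (m ^ 16 - M) * (y / m ^ 16) := by
    rw [mul_div_assoc', le_div_iff₀ hKp]; nlinarith
  have h2 : (m ^ 16 - M) * E ≤ 1 := by
    have : m ^ 16 * E ≤ 1 := by
      rw [hK]; by_contra h; push Not at h; nlinarith
    nlinarith
  have h4 : α * (cc - B * m) ≤ α * eG := mul_le_mul_of_nonneg_left hG (by linarith)
  have h5 : (1 - β ^ 3) * (N * E) ≤ 1 := by
    refine le_trans (mul_le_mul_of_nonneg_right ?_ (by positivity)) h3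
    rw [abs_sub_comm]; exact le_abs_self _
  have h6 : m ≤ 1 + M := by nlinarith
  have h7 : α * (B * m) ≤ B * (1 + M) := by
    have : 0 ≤ B * m := by positivity
    nlinarith
  have h9 : α * cc = cc - E * β ^ 2 * cc := by rw [hα]; ring
  have hA := le_abs_self A
  have hA0 := abs_nonneg A
  have h10 : y / 2 ≤ M + |A| + 3 + B * (1 + M) := by nlinarith
  rw [hD]; nlinarith

lemma sc_fin {A B N cc E β M α m t eG t0 : ℝ} (hB : 1 ≤ B) (hα1 : α ≤ 1) (hα0 : 1/2 ≤ α)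
    (hM : M = β ^ 3 * (N * E) - cc - A) (hm : 1 ≤ m) (hm2 : m ^ 2 = 1 + M)
    (hcα : (1 - β ^ 3 * α) * cc ≤ 1) (hE5 : β ^ 5 * (N * E) * E * 2 ≤ 1) (hb0 : 0 ≤ β ^ 3) (hb2 : β ^ 3 ≤ 2)
    (hG : cc - B * m ≤ eG) (ht : t ≤ t0) (ht0 : 0 ≤ t0)
    (hup : β ^ 3 / 3 * (N * E + 2 * α * eG - 2 * α * t) ≤ 1/4 + (cc + A) + 2 * β ^ 5 * (N * E) * E) :
    m ≤ 10 + 3 * |A| + 6 * B + 12 * t0 := by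
  have h1 : β ^ 3 * α * (cc - B * m - t0) ≤ β ^ 3 * α * (eG - t) := mul_le_mul_of_nonneg_left (by linarith) (by positivity)
  have h2 : β ^ 3 * α * (B * m + t0) ≤ 2 * (B * m + t0) := by
    refine mul_le_mul_of_nonneg_right ?_ (by positivity)
    nlinarith
  have hA := le_abs_self A
  have hA0 := abs_nonneg A
  have h3 : M ≤ 9 + 3 * |A| + 6 * B * m + 6 * t0 := by nlinarith
  by_contra h; push Not at h
  nlinarith

section main
variable {V : Type*} [AddCommGroup V] [Fintype V] [DecidableEq V] {c : V → V → ℝ}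

lemma T1_bound (hc : FC c) {β : ℝ} (hβ : 0 ≤ β) {k : V → ℝ} (hk : KH k) {B N M y : ℝ} (ha : KA c k B N)
    (hM : M = N * (1 - β * (1 - β ^ 2 * Ef β k))) (hM0 : 0 < M) (hMN : M ≤ N / 2) (hy : ∑ x, Sf β k x = 4 * N * y) (hy0 : 0 ≤ y) :
    ∑ u, cv k (Sf β k) u ^ 2 ≤ 4 * y ^ 2 * (1 + 4 * B * M ^ 2) := by
  have hN1 := ha.one_le_N
  have hN0 : 0 < N := by linarith
  rw [T1_sq hc β hk, ha.card]
  set be := β * (1 - β ^ 2 * Ef β k) with hbe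
  have hbe1 : be = 1 - M / N := by rw [hM]; field_simp; ring
  have hMN' : M / N ≤ 1/2 := by rw [div_le_iff₀ hN0]; linarith
  have hMNp : 0 < M / N := by positivity
  have h1 : ∀ w, ft c k w ^ 2 * ft c (Sf β k) w ^ 2 ≤ (if w = 0 then (4 * N * y) ^ 2 else 0) +
      (4 * (4 * N * y) ^ 2 * (M / N) ^ 2) * (if w = 0 then 0 else ft c k w ^ 2 * (1 - ft c k w) ^ (-(1 + 1) : ℝ)) := by
    intro w
    split_ifs with h
    · rw [h, ft_zero hc, ft_zero hc, hk.sum, hy]; simp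
    · have hp := ha.ppos w h
      have hir := ir_bound hc hβ hk w
      rw [← hbe, hy, hbe1] at hir
      have hS := ftS_nonneg hc β k w
      set q := ft c k w
      set S := ft c (Sf β k) w
      have hd : (1 - q) / 2 ≤ 1 - (1 - M / N) * q := by nlinarith
      have h2 : S * ((1 - q) / 2) ≤ 4 * N * y * (M / N) := by
        have := mul_le_mul_of_nonneg_left hd hS
        nlinarith
      have h3 : S ≤ 2 * (4 * N * y * (M / N)) * (1 - q)⁻¹ := by
        rw [← div_eq_mul_inv, le_div_iff₀ hp]; linarith
      have h4 : S ^ 2 ≤ (2 * (4 * N * y * (M / N)) * (1 - q)⁻¹) ^ 2 := pow_le_pow_left₀ hS h3 2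
      have h5 : (1 - q) ^ (-(1 + 1) : ℝ) = ((1 - q)⁻¹) ^ 2 := by
        rw [Real.rpow_neg hp.le, inv_pow]; congr 1
        rw [← Real.rpow_natCast]; norm_num
      rw [h5, zero_add]
      calc q ^ 2 * S ^ 2 ≤ q ^ 2 * (2 * (4 * N * y * (M / N)) * (1 - q)⁻¹) ^ 2 := mul_le_mul_of_nonneg_left h4 (sq_nonneg _)
        _ = _ := by ring
  have h2 := Finset.sum_le_sum fun w (_ : w ∈ Finset.univ) => h1 w
  rw [Finset.sum_add_distrib, ← Finset.mul_sum] at h2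
  simp only [Finset.sum_ite_eq', Finset.mem_univ, if_true] at h2
  have h3 := mul_le_mul_of_nonneg_left ha.s1 (by positivity : 0 ≤ 4 * (4 * N * y) ^ 2 * (M / N) ^ 2)
  have e : N ^ (1 + 1 : ℝ) = N ^ 2 := by rw [← Real.rpow_natCast]; norm_num
  rw [e] at h3
  have h4 := mul_le_mul_of_nonneg_left (h2.trans (add_le_add_right h3 _)) (by positivity : 0 ≤ (4 * N ^ 2)⁻¹)
  refine h4.trans (le_of_eq ?_)
  field_simp

lemma sc_q {W N χ : ℝ} (hN : 0 < N) (hχ : 4 * N ≤ χ) (h : W * χ ≤ 1) : W * N ≤ 1/4 := by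
  rcases le_total W 0 with h0 | h0
  · have : W * N ≤ 0 := mul_nonpos_of_nonpos_of_nonneg h0 hN.le
    linarith
  · have := mul_le_mul_of_nonneg_left hχ h0
    linarith

lemma sc_y1 {y N χ : ℝ} (hN : 0 < N) (hχ : 4 * N ≤ χ) (h : χ = 4 * N * y) : 1 ≤ y := by
  by_contra h'; push Not at h'; nlinarith

lemma sc_MK {M : ℝ} (hM : 0 < M) : M ≤ (1 + M) ^ 8 / 2 := by
  have : (1 + M) ^ 2 ≤ (1 + M) ^ 8 := pow_le_pow_right₀ (by linarith) (by norm_num)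
  nlinarith

lemma sc_t {B D N M m y T : ℝ} (hB : 1 ≤ B) (hD0 : 0 ≤ D) (hN0 : 0 < N) (hM0 : 0 < M) (hm : 1 ≤ m) (hm2 : m ^ 2 = 1 + M) (hKN' : m ^ 16 ≤ N / 2)
    (hy0 : 0 ≤ y) (hyb : y ≤ 2 * (D + 3) * (1 + M))
    (hs : T ^ 2 ≤ (8 * (B ^ 3 / N ^ 3 + 2 * B ^ 3 / (N ^ 2 * m ^ 8))) * (4 * y ^ 2 * (1 + 4 * B * M ^ 2))) : N * T ≤ 80 * B ^ 2 * (D + 3) := by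
  have hm8 : m ^ 8 = (1 + M) ^ 4 := by rw [← hm2]; ring
  have hm8N : m ^ 8 ≤ N := by
    have : m ^ 8 ≤ m ^ 16 := pow_le_pow_right₀ hm (by norm_num)
    linarith
  have e1 : B ^ 3 / N ^ 3 ≤ B ^ 3 / (N ^ 2 * m ^ 8) := by
    apply div_le_div_of_nonneg_left (by positivity) (by positivity)
    calc N ^ 2 * m ^ 8 ≤ N ^ 2 * N := mul_le_mul_of_nonneg_left hm8N (by positivity)
      _ = N ^ 3 := by ring
  have e2 : 1 + 4 * B * M ^ 2 ≤ 4 * B * (1 + M) ^ 2 := by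
    have : 0 ≤ B * M := by positivity
    linarith [(by ring : 4 * B * (1 + M) ^ 2 = 4 * B + 8 * (B * M) + 4 * B * M ^ 2)]
  have e3 : y ^ 2 ≤ (2 * (D + 3) * (1 + M)) ^ 2 := pow_le_pow_left₀ (by linarith) hyb 2
  have e4 : T ^ 2 ≤ (8 * (3 * (B ^ 3 / (N ^ 2 * m ^ 8)))) * (4 * (2 * (D + 3) * (1 + M)) ^ 2 * (4 * B * (1 + M) ^ 2)) := by
    refine hs.trans ?_
    refine mul_le_mul ?_ ?_ (by positivity) (by positivity)
    · have : 2 * B ^ 3 / (N ^ 2 * m ^ 8) = 2 * (B ^ 3 / (N ^ 2 * m ^ 8)) := by ring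
      linarith
    · exact mul_le_mul (by linarith) e2 (by positivity) (by positivity)
  have e5 : (N * T) ^ 2 ≤ (80 * B ^ 2 * (D + 3)) ^ 2 := by
    rw [mul_pow]
    calc N ^ 2 * T ^ 2 ≤ N ^ 2 * _ := mul_le_mul_of_nonneg_left e4 (by positivity)
      _ = 1536 * (B ^ 2 * (D + 3)) ^ 2 := by rw [hm8]; have : 1 + M ≠ 0 := by linarith
                                             field_simp; ring
      _ ≤ _ := by nlinarith [sq_nonneg (B ^ 2 * (D + 3))]
  exact (abs_le_of_sq_le_sq' e5 (by positivity)).2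

set_option maxHeartbeats 1000000 in
theorem chi_main {A B D : ℝ} (hD : D = |A| + B) (hB : 1 ≤ B) (hc : FC c) {k : V → ℝ} (hk : KH k) {N X : ℝ} (ha : KA c k B N)
    (hN : N = X ^ 16) (hX1 : 104 * D ≤ X) (hX2 : (26 * D * X) ^ 9 ≤ N) {β : ℝ} (hβ : β = 1 + (ccf c k N + A) / N)
    : ∑ x, Sf β k x ≤ 4 * N * (1 + 2 * (D + 3) * (10 + 3 * |A| + 6 * B + 12 * (80 * B ^ 2 * (D + 3))) ^ 2) := by
  have hA0 := abs_nonneg A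
  have hD1 : 1 ≤ D := by linarith
  have hX : 1 ≤ X := by linarith
  have hN1 := ha.one_le_N
  have hN0 : 0 < N := by linarith
  set χ := ∑ x, Sf β k x with hχd
  set P := 10 + 3 * |A| + 6 * B + 12 * (80 * B ^ 2 * (D + 3)) with hP
  by_cases hχ : χ < 4 * N
  · have : 0 ≤ 2 * (D + 3) * P ^ 2 := by positivity
    nlinarith
  push Not at hχ
  have hcc0 := ccf_nonneg ha
  have hccu := ccf_upper hc hk ha (by linarith) hN
  set cc := ccf c k N with hcc
  -- beta bounds
  have hca : |cc + A| ≤ D * X := by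
    have h1 := neg_abs_le A
    have h2 := le_abs_self A
    rw [abs_le, hD]; constructor <;> nlinarith
  have hDX : D ≤ D * X := by nlinarith
  have hbb : |β - 1| ≤ 1/10 := by
    rw [hβ, add_sub_cancel_left, abs_div, abs_of_pos hN0, div_le_iff₀ hN0]
    have h1 : (26 * D * X) ^ 1 ≤ (26 * D * X) ^ 9 := pow_le_pow_right₀ (by linarith) (by norm_num)
    rw [pow_one] at h1
    linarith
  have hbb' := abs_le.1 hbb
  have hβ0 : 0 ≤ β := by linarith
  have hβ1 : β ≤ 11/10 := by linarith
  have hE := Ef_nonneg β k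
  have hup := chi_upper0 hβ0 hβ1 hk
  have hlow := chi_lower hβ0 hk
  rw [← hχd] at hup hlow
  set E := Ef β k with hEd
  obtain ⟨α, hα⟩ : ∃ α, α = 1 - β ^ 2 * E := ⟨_, rfl⟩
  obtain ⟨M, hM⟩ : ∃ M, M = N * (1 - β * α) := ⟨_, rfl⟩
  rw [← hα] at hlow
  obtain ⟨-, hα0, hα1, hβh, hM0, hMu, hMe, h8, h3, hEc, hE5, hcα, hb2, hb0⟩ :=
    sc_two hD hB hX rfl hX2 hcc0 hccu hE hβ hχ hup hβ1 hα hM hlow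
  obtain ⟨m, hmd⟩ : ∃ m, m = √(1 + M) := ⟨_, rfl⟩
  have hm2 : m ^ 2 = 1 + M := by rw [hmd, Real.sq_sqrt (by linarith)]
  have hm : 1 ≤ m := by rw [hmd]; exact Real.one_le_sqrt.2 (by linarith)
  have hmX : 2 * m ≤ X := by
    have : m ≤ X / 2 := by
      rw [hmd]; refine Real.sqrt_le_iff.2 ⟨by linarith, ?_⟩
      nlinarith
    linarith
  have hKN : m ^ 16 / N ≤ 1 / 2 := by
    rw [div_le_iff₀ hN0, hN]
    have h1 : m ^ 16 ≤ (X / 2) ^ 16 := pow_le_pow_left₀ (by linarith) (by linarith) 16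
    have h2 : 0 ≤ X ^ 16 := by positivity
    rw [div_pow] at h1
    norm_num at h1 ⊢
    linarith
  have hK0 : 0 < m ^ 16 / N := by positivity
  have hK16 : m ^ 16 = (1 + M) ^ 8 := by rw [← hm2]; ring
  have hMK : M ≤ m ^ 16 / 2 := by
    rw [hK16]
    exact sc_MK hM0
  have hKN' : m ^ 16 ≤ N / 2 := by rw [div_le_iff₀ hN0] at hKN; linarith
  have hβα : β * α = 1 - M / N := by rw [hM]; field_simp; ring
  have hbb2 : 1 - m ^ 16 / N ≤ β * α := by
    rw [hβα]; have : M / N ≤ m ^ 16 / N := div_le_div_of_nonneg_right (by linarith) hN0.le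
    linarith
  have hG := eG_lower hc hk ha (by linarith) hN (by linarith : 0 < m) (by linarith)
  rw [← hcc] at hG
  set G := (Fintype.card V : ℝ)⁻¹ * ∑ w, ft c k w ^ 2 * (1 - (1 - m ^ 16 / N) * ft c k w)⁻¹ with hGd
  obtain ⟨y, hy⟩ : ∃ y, χ = 4 * N * y := ⟨χ / (4 * N), by field_simp⟩
  have hy1 : 1 ≤ y := by
    exact sc_y1 hN0 hχ hy
  -- y bound
  have hyb : y ≤ 2 * (D + 3) * (1 + M) := by
    have h := E_lower hc hβ0 hk (b := 1 - m ^ 16 / N) (by linarith) (by linarith) (by rw [← hEd, ← hα]; exact hbb2)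
    rw [← hEd, ← hα, ← hGd, ← hχd, ha.card, hy] at h
    refine sc_y (eG := N * G) hD hB hN0 hE hα1 hα0 hα hM0 hMe hm hm2 (by linarith) h8 h3 hEc hG ?_
    have h' := mul_le_mul_of_nonneg_left h hN0.le
    refine le_trans (le_of_eq ?_) h'
    rw [hβα]
    field_simp
    ring
  -- T bound
  set T := ∑ u, cv k (gr c k (1 - m ^ 16 / N)) u ^ 2 * cv k (Sf β k) u with hT
  have hT1 := T1_bound hc hβ0 hk ha (by rw [← hEd, ← hα]; exact hM) hM0 (by linarith) hy (by linarith)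
  have hT0 := T0_four hc hk ha (by linarith) hN hm hmX
  have hD0 : 0 ≤ D := by linarith
  have ht : N * T ≤ 80 * B ^ 2 * (D + 3) := by
    have cs := Finset.sum_mul_sq_le_sq_mul_sq Finset.univ (fun u => cv k (gr c k (1 - m ^ 16 / N)) u ^ 2) (fun u => cv k (Sf β k) u)
    rw [← hT] at cs
    simp only [← pow_mul] at cs
    norm_num at cs
    have hs : T ^ 2 ≤ (8 * (B ^ 3 / N ^ 3 + 2 * B ^ 3 / (N ^ 2 * m ^ 8))) * (4 * y ^ 2 * (1 + 4 * B * M ^ 2)) :=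
      cs.trans (mul_le_mul hT0 hT1 (Finset.sum_nonneg fun u _ => sq_nonneg _) (by positivity))
    exact sc_t hB hD0 hN0 hM0 hm hm2 hKN' (by linarith) hyb hs
  have hfin := chi_upper hc hβ0 hk (by rw [← hEd, ← hα]; linarith) (b := 1 - m ^ 16 / N) (by linarith) (by linarith)
    (by rw [← hEd, ← hα]; exact hbb2)
  rw [← hEd, ← hα, ← hGd, ← hχd, ← hT] at hfin
  have hm_b : m ≤ P := by
    refine sc_fin (t := N * T) hB hα1 hα0 hMe hm hm2 hcα hE5 hb0 hb2 hG ht (by positivity) ?_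
    have hχ0 : 0 < χ := by linarith
    set W := β + 2 * β ^ 5 * E ^ 2 - β ^ 3 / 3 * (E + 2 * α * G - 2 * α * T) with hW
    have h1 : (1 - W) * χ ≤ 1 := by linarith
    have h2 : (1 - W) * N ≤ 1/4 := sc_q hN0 hχ h1
    have hbN : (β - 1) * N = cc + A := by rw [hβ]; field_simp; ring
    rw [hW] at h2
    linarith
  have hM2 : 1 + M ≤ P ^ 2 := by rw [← hm2]; exact pow_le_pow_left₀ (by linarith) hm_b 2
  rw [hy]
  refine mul_le_mul_of_nonneg_left ?_ (by positivity)
  have := mul_le_mul_of_nonneg_left hM2 (by positivity : 0 ≤ 2 * (D + 3))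
  linarith
end main

section conc
variable (N : ℕ) [NeZero N]

/-- pairing -/
def pr (w z : Lat N) : ZMod (2*N) := w.1 * z.1 + w.2 * z.2

def psi (a : ZMod (2*N)) : ℂ := ZMod.stdAddChar a

def chc (w z : Lat N) : ℝ := (psi N (pr N w z)).re

lemma psi_add (a b : ZMod (2*N)) : psi N (a + b) = psi N a * psi N b := AddChar.map_add_eq_mul _ _ _

lemma psi_norm (a : ZMod (2*N)) : ‖psi N a‖ = 1 := by
  unfold psi; rw [ZMod.stdAddChar_apply]; exact Circle.norm_coe _

lemma psi_neg (a : ZMod (2*N)) : psi N (-a) = (starRingEnd ℂ) (psi N a) := by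
  unfold psi; exact AddChar.map_neg_eq_conj _ _

lemma psi_zero : psi N 0 = 1 := AddChar.map_zero_eq_one _

lemma pr_add (w x y : Lat N) : pr N w (x + y) = pr N w x + pr N w y := by simp [pr]; ring
lemma pr_neg (w x : Lat N) : pr N w (-x) = - pr N w x := by simp [pr]; ring
lemma pr_comm (w x : Lat N) : pr N w x = pr N x w := by simp [pr]; ring

lemma psi_sum (a : ZMod (2*N)) : ∑ x, psi N (x * a) = if a = 0 then ((2 * N : ℕ) : ℂ) else 0 := by
  have := AddChar.sum_mulShift (R := ZMod (2*N)) (R' := ℂ) (ψ := ZMod.stdAddChar) a (ZMod.isPrimitive_stdAddChar (2*N))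
  unfold psi
  rw [this, ZMod.card]; split_ifs <;> simp

theorem chc_FC : FC (chc N) where
  symm w z := by unfold chc; rw [pr_comm]
  zero w := by simp [chc, pr, psi_zero]
  prod w x y := by
    unfold chc
    rw [sub_eq_add_neg, pr_add, pr_add, pr_neg, psi_add, psi_add, psi_neg]
    simp; ring
  sum z := by
    unfold chc
    rw [← Complex.re_sum]
    have : ∑ w : Lat N, psi N (pr N w z) = (∑ x, psi N (x * z.1)) * (∑ x, psi N (x * z.2)) := by
      rw [Finset.sum_mul_sum, Fintype.sum_prod_type]
      simp only [pr, psi_add]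
    rw [this, psi_sum, psi_sum]
    rcases z with ⟨a, b⟩
    by_cases ha : a = 0 <;> by_cases hb : b = 0 <;> simp [ha, hb, Prod.ext_iff, ZMod.card]
  le w x := by
    unfold chc
    exact (Complex.abs_re_le_norm _).trans (psi_norm N _).le
  sub := ⟨fun w z => (psi N (pr N w z)).im, fun w x y => by
    unfold chc
    rw [sub_eq_add_neg, pr_add, pr_neg, psi_add, psi_neg]
    simp⟩

lemma latRep_cast (v : ZMod (2*N)) : ((latRep N v : ℤ) : ZMod (2*N)) = v := by
  unfold latRep
  split_ifs
  · simp
  · have : ((2 * N : ℕ) : ZMod (2*N)) = 0 := ZMod.natCast_self _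
    push_cast at this ⊢
    rw [this]; simp

lemma latRep_bd (v : ZMod (2*N)) : -(N:ℤ) < latRep N v ∧ latRep N v ≤ N := by
  have := ZMod.val_lt v
  have hN := NeZero.pos N
  unfold latRep; split_ifs <;> constructor <;> omega

lemma latRep_eq (j : ℤ) (h1 : -(N:ℤ) < j) (h2 : j ≤ N) : latRep N (j : ZMod (2*N)) = j := by
  have h3 := latRep_bd N (j : ZMod (2*N))
  have h4 := (ZMod.intCast_eq_intCast_iff_dvd_sub _ _ _).1 (latRep_cast N (j : ZMod (2*N)))
  obtain ⟨d, hd⟩ := h4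
  push_cast at hd
  have hN := NeZero.pos N
  have : d = 0 := by
    by_contra hne
    rcases lt_or_gt_of_ne hne with h | h
    · have : d ≤ -1 := by omega
      nlinarith
    · have : 1 ≤ d := by omega
      nlinarith
  rw [this] at hd; linarith

lemma latRep_zero : latRep N 0 = 0 := by
  have := latRep_eq N 0 (by have := NeZero.pos N; omega) (by positivity)
  simpa using this

lemma latRep_eq_zero {v : ZMod (2*N)} (h : latRep N v = 0) : v = 0 := by
  rw [← latRep_cast N v, h]; simp

lemma latRep_neg_sq (v : ZMod (2*N)) : (latRep N (-v))^2 = (latRep N v)^2 := by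
  have h1 := latRep_bd N v
  rcases h1.2.lt_or_eq with h | h
  · have := latRep_eq N (-latRep N v) (by linarith) (by linarith)
    rw [Int.cast_neg, latRep_cast] at this
    rw [this]; ring
  · have hv : -v = v := by
      have e := latRep_cast N v
      rw [h] at e
      rw [← e, neg_eq_iff_add_eq_zero]
      have : ((2 * N : ℕ) : ZMod (2*N)) = 0 := ZMod.natCast_self _
      push_cast at this ⊢
      linear_combination this
    rw [hv]

lemma psi_int (j : ℤ) : psi N (j : ZMod (2*N)) = Complex.exp (((Real.pi * (j / N) : ℝ) : ℂ) * Complex.I) := by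
  unfold psi
  rw [ZMod.stdAddChar_coe]
  congr 1
  have : (N : ℂ) ≠ 0 := Nat.cast_ne_zero.2 (NeZero.ne N)
  push_cast
  field_simp

lemma chc_cos (w z : Lat N) : chc N w z = Real.cos (Real.pi * ((latRep N w.1 : ℝ) * (latRep N z.1 : ℝ) / N + (latRep N w.2 : ℝ) * (latRep N z.2 : ℝ) / N)) := by
  unfold chc
  have : pr N w z = ((latRep N w.1 * latRep N z.1 + latRep N w.2 * latRep N z.2 : ℤ) : ZMod (2*N)) := by
    push_cast; simp only [latRep_cast]; rfl
  rw [this, psi_int, Complex.exp_ofReal_mul_I_re]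
  push_cast; congr 1; ring

lemma ft_kHat (k : Lat N → ℝ) (w : Lat N) : ft (chc N) k w = kHat N k (latRep2 N w) := by
  unfold ft kHat
  exact Finset.sum_congr rfl fun z _ => by rw [chc_cos]; rfl

lemma gam_sq : gam N ^ 2 = (N:ℝ)⁻¹ := by
  unfold gam; rw [Real.sq_sqrt (by positivity)]

lemma cGamma_ccf (k : Lat N → ℝ) : cGamma N k (gam N) = ccf (chc N) k N := by
  have hN : (N : ℝ) ≠ 0 := Nat.cast_ne_zero.2 (NeZero.ne N)
  unfold cGamma ccf
  rw [Finset.mul_sum, Finset.mul_sum]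
  refine Finset.sum_congr rfl fun w _ => ?_
  split_ifs
  · simp
  · rw [ft_kHat, gam_sq, inv_inv]
    simp only [div_eq_mul_inv, mul_inv]
    ring

end conc

section conc2
variable (N : ℕ) [NeZero N]

lemma psi_sub_one (v : ZMod (2*N)) : 2 * |(latRep N v : ℝ)| / N ≤ ‖psi N v - 1‖ := by
  have hN : (0:ℝ) < N := Nat.cast_pos.2 (NeZero.pos N)
  have hb := latRep_bd N v
  conv_rhs => rw [← latRep_cast N v]
  rw [psi_int, mul_comm _ Complex.I, Complex.norm_exp_I_mul_ofReal_sub_one, norm_mul, Real.norm_eq_abs, Real.norm_eq_abs]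
  have ha : |(latRep N v : ℝ)| ≤ N := by
    rw [abs_le]; constructor
    · have : -(N:ℤ) ≤ latRep N v := hb.1.le
      exact_mod_cast this
    · exact_mod_cast hb.2
  have e : |Real.pi * ((latRep N v : ℝ) / N) / 2| = Real.pi / 2 * (|(latRep N v : ℝ)| / N) := by
    rw [abs_div, abs_mul, abs_div, abs_of_pos Real.pi_pos, abs_of_pos hN]; norm_num; ring
  have := Real.mul_abs_le_abs_sin (x := Real.pi * ((latRep N v : ℝ) / N) / 2) (by
    rw [e]
    have : |(latRep N v : ℝ)| / N ≤ 1 := (div_le_one hN).2 ha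
    nlinarith [Real.pi_pos])
  rw [e] at this
  have e2 : 2 / Real.pi * (Real.pi / 2 * (|(latRep N v : ℝ)| / N)) = |(latRep N v : ℝ)| / N := by
    field_simp
  rw [e2] at this
  rw [abs_of_pos (by norm_num : (0:ℝ) < 2)]
  calc 2 * |(latRep N v : ℝ)| / N = 2 * (|(latRep N v : ℝ)| / N) := by ring
    _ ≤ _ := by linarith

lemma ft_diff (k : Lat N → ℝ) (w : Lat N) :
    |ft (chc N) k w| * (2 * |(latRep N w.1 : ℝ)| / N) ≤ ∑ z, |k (z + (1, 0)) - k z| := by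
  set K : ℂ := ∑ z, (k z : ℂ) * psi N (pr N w z) with hK
  have h1 : |ft (chc N) k w| ≤ ‖K‖ := by
    have : ft (chc N) k w = K.re := by
      rw [hK, Complex.re_sum]; unfold ft chc
      exact Finset.sum_congr rfl fun z _ => by simp
    rw [this]; exact Complex.abs_re_le_norm _
  have h2 : K = psi N w.1 * ∑ z, (k (z + (1, 0)) : ℂ) * psi N (pr N w z) := by
    rw [hK, ← Equiv.sum_comp (Equiv.addRight ((1, 0) : Lat N)), Finset.mul_sum]
    refine Finset.sum_congr rfl fun z _ => ?_
    simp only [Equiv.coe_addRight]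
    rw [pr_add, psi_add]
    have : pr N w (1, 0) = w.1 := by simp [pr]
    rw [this]; ring
  have h3 : K * (psi N w.1 - 1) = psi N w.1 * (∑ z, (k z : ℂ) * psi N (pr N w z) - ∑ z, (k (z + (1, 0)) : ℂ) * psi N (pr N w z)) := by
    rw [mul_sub, mul_sub, ← h2, ← hK]; ring
  have h4 : ‖K‖ * ‖psi N w.1 - 1‖ ≤ ∑ z, |k (z + (1, 0)) - k z| := by
    rw [← norm_mul, h3, norm_mul, psi_norm, one_mul, ← Finset.sum_sub_distrib]
    refine (norm_sum_le _ _).trans (Finset.sum_le_sum fun z _ => ?_)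
    rw [← sub_mul, norm_mul, psi_norm, mul_one, ← Complex.ofReal_sub, Complex.norm_real, Real.norm_eq_abs, abs_sub_comm]
  refine le_trans ?_ h4
  exact mul_le_mul h1 (psi_sub_one N w.1) (by positivity) (norm_nonneg _)

lemma one_sub_pow_le (ζ : ℂ) (h : ‖ζ‖ = 1) (j : ℕ) : ‖1 - ζ ^ j‖ ≤ j * ‖1 - ζ‖ := by
  induction j with
  | zero => simp
  | succ j ih =>
    have : 1 - ζ ^ (j + 1) = (1 - ζ ^ j) + ζ ^ j * (1 - ζ) := by ring
    rw [this]
    refine (norm_add_le _ _).trans ?_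
    rw [norm_mul, norm_pow, h, one_pow, one_mul]; push_cast; linarith

lemma one_sub_re (ζ : ℂ) (h : ‖ζ‖ = 1) : 1 - ζ.re = ‖1 - ζ‖ ^ 2 / 2 := by
  have h1 : ζ.re ^ 2 + ζ.im ^ 2 = 1 := by
    have := Complex.sq_norm ζ
    rw [h, Complex.normSq_apply] at this; linarith
  rw [Complex.sq_norm, Complex.normSq_apply]
  simp; linarith

lemma psi_nsmul (j : ℕ) (a : ZMod (2*N)) : psi N (j * a) = psi N a ^ j := by
  unfold psi; rw [← AddChar.map_nsmul_eq_pow]; simp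

lemma one_sub_chc (w z : Lat N) (j : ℕ) : 1 - chc N ((j:ZMod (2*N)) * w.1, (j:ZMod (2*N)) * w.2) z ≤ (j:ℝ)^2 * (1 - chc N w z) := by
  unfold chc
  have e : pr N ((j:ZMod (2*N)) * w.1, (j:ZMod (2*N)) * w.2) z = (j:ZMod (2*N)) * pr N w z := by simp [pr]; ring
  rw [e, psi_nsmul, one_sub_re _ (psi_norm N _), one_sub_re _ (by rw [norm_pow, psi_norm, one_pow])]
  have := pow_le_pow_left₀ (norm_nonneg _) (one_sub_pow_le (psi N (pr N w z)) (psi_norm N _) j) 2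
  rw [mul_pow] at this; linarith

lemma p_eq {k : Lat N → ℝ} (hk : KH k) (w : Lat N) : 1 - ft (chc N) k w = ∑ z, k z * (1 - chc N w z) := by
  unfold ft; simp only [mul_sub, mul_one, Finset.sum_sub_distrib]; rw [hk.sum]

lemma p_mul {k : Lat N → ℝ} (hk : KH k) (w : Lat N) (j : ℕ) :
    1 - ft (chc N) k ((j:ZMod (2*N)) * w.1, (j:ZMod (2*N)) * w.2) ≤ (j:ℝ)^2 * (1 - ft (chc N) k w) := by
  rw [p_eq N hk, p_eq N hk, Finset.mul_sum]
  refine Finset.sum_le_sum fun z _ => ?_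
  have := mul_le_mul_of_nonneg_left (one_sub_chc N w z j) (hk.nonneg z)
  linarith

lemma p_low1 {k : Lat N → ℝ} (hk : KH k) {C : ℝ} (hC : 1 ≤ C) (hd : ∑ z, |k (z + (1, 0)) - k z| ≤ C / √(N:ℝ))
    {w : Lat N} (hw : C * √(N:ℝ) ≤ |(latRep N w.1 : ℝ)|) : 1/2 ≤ 1 - ft (chc N) k w := by
  have hN : (0:ℝ) < N := Nat.cast_pos.2 (NeZero.pos N)
  have hs : 0 < √(N:ℝ) := Real.sqrt_pos.2 hN
  have hss : √(N:ℝ) * √(N:ℝ) = N := Real.mul_self_sqrt hN.le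
  have h := (ft_diff N k w).trans hd
  have h1 : |ft (chc N) k w| * (2 * (C * √(N:ℝ)) / N) ≤ C / √(N:ℝ) := by
    refine le_trans (mul_le_mul_of_nonneg_left ?_ (abs_nonneg _)) h
    gcongr
  have e : 2 * (C * √(N:ℝ)) / N = 2 * (C / √(N:ℝ)) := by
    rw [div_eq_iff hN.ne']
    field_simp
    linear_combination Real.sq_sqrt hN.le
  rw [e] at h1
  have h2 : 0 < C / √(N:ℝ) := by positivity
  have h3 : |ft (chc N) k w| ≤ 1/2 := by
    by_contra h4; push Not at h4; nlinarith
  linarith [le_abs_self (ft (chc N) k w)]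

lemma p_low {k : Lat N → ℝ} (hk : KH k) {C : ℝ} (hC : 1 ≤ C) (hd : ∑ z, |k (z + (1, 0)) - k z| ≤ C / √(N:ℝ))
    (hCN : 2 * (C * √(N:ℝ)) < N) {w : Lat N} (hw : latRep N w.1 ≠ 0) :
    1/2 ≤ 1 - ft (chc N) k w ∨ (latRep N w.1 : ℝ)^2 / (8 * C ^ 2 * N) ≤ 1 - ft (chc N) k w := by
  have hN : (0:ℝ) < N := Nat.cast_pos.2 (NeZero.pos N)
  have hs : 0 < √(N:ℝ) := Real.sqrt_pos.2 hN
  set Lb := C * √(N:ℝ) with hLb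
  have hLb0 : 0 < Lb := by positivity
  set m := |(latRep N w.1 : ℝ)| with hm
  have hm1 : 1 ≤ m := by
    rw [hm]; have := Int.one_le_abs hw
    exact_mod_cast this
  rcases le_or_gt Lb m with h | h
  · left; exact p_low1 N hk hC hd h
  · right
    set j := ⌈Lb / m⌉₊ with hj
    have hj1 : Lb / m ≤ j := Nat.le_ceil _
    have hj2 : (j:ℝ) < Lb / m + 1 := Nat.ceil_lt_add_one (by positivity)
    have hj3 : Lb ≤ j * m := by rwa [div_le_iff₀ (by linarith)] at hj1
    have hj4 : (j:ℝ) * m ≤ 2 * Lb := by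
      have : Lb / m * m = Lb := div_mul_cancel₀ _ (by linarith)
      nlinarith
    have hrep : latRep N ((j:ZMod (2*N)) * w.1) = j * latRep N w.1 := by
      have e : ((j * latRep N w.1 : ℤ) : ZMod (2*N)) = (j:ZMod (2*N)) * w.1 := by push_cast; rw [latRep_cast]
      rw [← e]
      have hab : |((j * latRep N w.1 : ℤ) : ℝ)| < N := by
        push_cast; rw [abs_mul, ← hm, Nat.abs_cast]; linarith
      have hab2 : |(j * latRep N w.1 : ℤ)| < N := by exact_mod_cast hab
      exact latRep_eq N _ (abs_lt.1 hab2).1 (abs_lt.1 hab2).2.le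
    have h1 := p_low1 N hk hC hd (w := ((j:ZMod (2*N)) * w.1, (j:ZMod (2*N)) * w.2)) (by
      show Lb ≤ |(latRep N ((j:ZMod (2*N)) * w.1) : ℝ)|
      rw [hrep]; push_cast; rw [abs_mul, ← hm, Nat.abs_cast]; exact hj3)
    have h2 := h1.trans (p_mul N hk w j)
    have hp0 : 0 ≤ 1 - ft (chc N) k w := by
      by_contra hn; push Not at hn; nlinarith [sq_nonneg (j:ℝ)]
    rw [div_le_iff₀ (by positivity), ← sq_abs, ← hm]
    have e2 : Lb ^ 2 = C ^ 2 * N := by rw [hLb, mul_pow, Real.sq_sqrt hN.le]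
    have h3 : ((j:ℝ) * m) ^ 2 ≤ (2 * Lb) ^ 2 := pow_le_pow_left₀ (by positivity) hj4 2
    have h4 : ((j:ℝ) * m) ^ 2 * (1 - ft (chc N) k w) ≤ (2 * Lb) ^ 2 * (1 - ft (chc N) k w) := mul_le_mul_of_nonneg_right h3 hp0
    have h5 := mul_le_mul_of_nonneg_right h2 (sq_nonneg m)
    nlinarith

/-- swap of coordinates -/
lemma ft_swap {k : Lat N → ℝ} (hsw : ∀ z, k (z.2, z.1) = k z) (w : Lat N) : ft (chc N) k (w.2, w.1) = ft (chc N) k w := by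
  unfold ft
  rw [← Equiv.sum_comp (Equiv.prodComm (ZMod (2*N)) (ZMod (2*N)))]
  refine Finset.sum_congr rfl fun z _ => ?_
  have : chc N (w.2, w.1) (Equiv.prodComm (ZMod (2*N)) (ZMod (2*N)) z) = chc N w z := by
    unfold chc pr; simp [add_comm]
  rw [this]; congr 1; exact hsw z

def mxr (i : ℤ) : ℝ := max 1 |(i:ℝ)|

lemma one_le_mxr (i : ℤ) : 1 ≤ mxr i := le_max_left _ _

lemma p_low2 {k : Lat N → ℝ} (hk : KH k) (hsw : ∀ z, k (z.2, z.1) = k z) {C : ℝ} (hC : 1 ≤ C) (hd : ∑ z, |k (z + (1, 0)) - k z| ≤ C / √(N:ℝ))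
    (hCN : 2 * (C * √(N:ℝ)) < N) {w : Lat N} (hw : w ≠ 0) :
    1/2 ≤ 1 - ft (chc N) k w ∨ mxr (latRep N w.1) * mxr (latRep N w.2) / (8 * C ^ 2 * N) ≤ 1 - ft (chc N) k w := by
  have hN : (0:ℝ) < N := Nat.cast_pos.2 (NeZero.pos N)
  have key : ∀ a b : ℤ, a ≠ 0 → |b| ≤ |a| → mxr a * mxr b ≤ (a:ℝ)^2 := by
    intro a b ha hab
    have h1 : (1:ℝ) ≤ |(a:ℝ)| := by exact_mod_cast Int.one_le_abs ha
    have h2 : |(b:ℝ)| ≤ |(a:ℝ)| := by exact_mod_cast hab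
    have e1 : mxr a = |(a:ℝ)| := max_eq_right h1
    have e2 : mxr b ≤ |(a:ℝ)| := max_le h1 h2
    rw [e1, ← sq_abs, sq]
    exact mul_le_mul_of_nonneg_left e2 (abs_nonneg _)
  rcases le_total |latRep N w.2| |latRep N w.1| with h | h
  · have h0 : latRep N w.1 ≠ 0 := by
      intro h0; rw [h0, abs_zero] at h
      have h2 := abs_eq_zero.1 (le_antisymm h (abs_nonneg _))
      exact hw (Prod.ext (latRep_eq_zero N h0) (latRep_eq_zero N h2))
    rcases p_low N hk hC hd hCN h0 with h1 | h1
    · left; exact h1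
    · right; refine le_trans (div_le_div_of_nonneg_right (key _ _ h0 h) (by positivity)) h1
  · have h0 : latRep N w.2 ≠ 0 := by
      intro h0; rw [h0, abs_zero] at h
      have h2 := abs_eq_zero.1 (le_antisymm h (abs_nonneg _))
      exact hw (Prod.ext (latRep_eq_zero N h2) (latRep_eq_zero N h0))
    rw [← ft_swap N hsw]
    rcases p_low N hk hC hd hCN (w := (w.2, w.1)) h0 with h1 | h1
    · left; exact h1
    · right; rw [mul_comm (mxr _)]; refine le_trans (div_le_div_of_nonneg_right (key _ _ h0 h) (by positivity)) h1

lemma mxr_sum {s : ℝ} (hs : 1 < s) : ∑ v : ZMod (2*N), mxr (latRep N v) ^ (-s) ≤ 1 + ∑' i : ℤ, |(i:ℝ)| ^ (-s) := by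
  have hsum := Real.summable_abs_int_rpow hs
  have h1 : ∀ v : ZMod (2*N), mxr (latRep N v) ^ (-s) = (if v = 0 then 1 else 0) + |(latRep N v:ℝ)| ^ (-s) := by
    intro v
    split_ifs with h
    · rw [h, latRep_zero]; simp [mxr]; rw [Real.zero_rpow (by linarith)]
    · have h0 : latRep N v ≠ 0 := fun h0 => h (latRep_eq_zero N h0)
      have : (1:ℝ) ≤ |(latRep N v:ℝ)| := by exact_mod_cast Int.one_le_abs h0
      rw [mxr, max_eq_right this, zero_add]
  simp only [h1, Finset.sum_add_distrib]
  simp only [Finset.sum_ite_eq', Finset.mem_univ, if_true]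
  have hinj : Function.Injective (latRep N) := fun a b h => by rw [← latRep_cast N a, h, latRep_cast]
  have h2 := Summable.sum_le_tsum (Finset.univ.map ⟨latRep N, hinj⟩) (fun i _ => by positivity) hsum
  rw [Finset.sum_map] at h2
  simpa using h2

/-- constant for the mode sums -/
def Sc (θ : ℝ) : ℝ := (1 + ∑' i : ℤ, |(i:ℝ)| ^ (-(1 + θ))) ^ 2

lemma mode_sum {k : Lat N → ℝ} (hk : KH k) (hsw : ∀ z, k (z.2, z.1) = k z) {C B₀ : ℝ} (hC : 1 ≤ C) (hd : ∑ z, |k (z + (1, 0)) - k z| ≤ C / √(N:ℝ))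
    (hCN : 2 * (C * √(N:ℝ)) < N) (hB : ∀ z, k z ≤ B₀ / N) {θ : ℝ} (hθ : 0 < θ) (hθ1 : θ ≤ 1) :
    ∑ w, (if w = 0 then 0 else ft (chc N) k w ^ 2 * (1 - ft (chc N) k w) ^ (-(1 + θ) : ℝ)) ≤ (16 * B₀ + (8 * C ^ 2) ^ 2 * Sc θ) * (N:ℝ) ^ (1 + θ : ℝ) := by
  have hN : (0:ℝ) < N := Nat.cast_pos.2 (NeZero.pos N)
  have hN1 : (1:ℝ) ≤ N := by exact_mod_cast NeZero.pos N
  have hB0 : 0 ≤ B₀ := by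
    have := (hk.nonneg 0).trans (hB 0)
    by_contra h; push Not at h
    have := div_neg_of_neg_of_pos h hN
    linarith
  have hc := chc_FC N
  have h1 : ∀ w : Lat N, (if w = 0 then 0 else ft (chc N) k w ^ 2 * (1 - ft (chc N) k w) ^ (-(1 + θ) : ℝ)) ≤
      4 * ft (chc N) k w ^ 2 + (8 * C ^ 2 * N) ^ (1 + θ : ℝ) * (mxr (latRep N w.1) ^ (-(1 + θ)) * mxr (latRep N w.2) ^ (-(1 + θ))) := by
    intro w
    have m1 := one_le_mxr (latRep N w.1)
    have m2 := one_le_mxr (latRep N w.2)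
    have hr : 0 ≤ (8 * C ^ 2 * N) ^ (1 + θ : ℝ) * (mxr (latRep N w.1) ^ (-(1 + θ)) * mxr (latRep N w.2) ^ (-(1 + θ))) := by positivity
    split_ifs with h
    · positivity
    · rcases p_low2 N hk hsw hC hd hCN h with h2 | h2
      · have : (1 - ft (chc N) k w) ^ (-(1 + θ) : ℝ) ≤ 4 := by
          refine (Real.rpow_le_rpow_of_nonpos (by norm_num) h2 (by linarith)).trans ?_
          rw [Real.rpow_neg (by norm_num), ← Real.inv_rpow (by norm_num)]
          have : ((1/2:ℝ)⁻¹) ^ (1 + θ) ≤ 2 ^ (2:ℝ) := by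
            norm_num
            have := Real.rpow_le_rpow_of_exponent_le (x := 2) (by norm_num) (by linarith : 1 + θ ≤ 2)
            norm_num at this; linarith
          norm_num at this ⊢; linarith
        have := mul_le_mul_of_nonneg_left this (sq_nonneg (ft (chc N) k w))
        linarith
      · have hq : ft (chc N) k w ^ 2 ≤ 1 := by
          have := ft_abs hc k hk.nonneg w
          rw [hk.sum] at this
          rw [← sq_abs]; nlinarith [abs_nonneg (ft (chc N) k w)]
        have h3 : (1 - ft (chc N) k w) ^ (-(1 + θ) : ℝ) ≤ (8 * C ^ 2 * N) ^ (1 + θ : ℝ) * (mxr (latRep N w.1) ^ (-(1 + θ)) * mxr (latRep N w.2) ^ (-(1 + θ))) := by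
          refine (Real.rpow_le_rpow_of_nonpos (by positivity) h2 (by linarith)).trans (le_of_eq ?_)
          rw [Real.div_rpow (by positivity) (by positivity), Real.mul_rpow (by linarith) (by linarith), Real.rpow_neg (x := 8 * C ^ 2 * N) (by positivity), div_inv_eq_mul]
          ring
        have h4 : 0 ≤ (1 - ft (chc N) k w) ^ (-(1 + θ) : ℝ) := Real.rpow_nonneg (le_trans (by positivity) h2) _
        have h5 := mul_le_mul_of_nonneg_right hq h4
        have h6 : 0 ≤ 4 * ft (chc N) k w ^ 2 := by positivity
        linarith
  refine (Finset.sum_le_sum fun w _ => h1 w).trans ?_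
  rw [Finset.sum_add_distrib, ← Finset.mul_sum, ← Finset.mul_sum]
  have hcard : (Fintype.card (Lat N) : ℝ) = 4 * N ^ 2 := by
    simp [ZMod.card]; ring
  have h2 : ∑ w, ft (chc N) k w ^ 2 ≤ 4 * B₀ * N := by
    have hp := parseval hc k k hk.even
    have h3 : ∑ x, k x * k x ≤ B₀ / N := by
      calc ∑ x, k x * k x ≤ ∑ x, B₀ / N * k x := Finset.sum_le_sum fun x _ => mul_le_mul_of_nonneg_right (hB x) (hk.nonneg x)
        _ = B₀ / N := by rw [← Finset.mul_sum, hk.sum, mul_one]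
    rw [hp, hcard, inv_mul_le_iff₀ (by positivity)] at h3
    simp only [sq]
    refine h3.trans (le_of_eq ?_)
    field_simp
  have h3 : ∑ w : Lat N, mxr (latRep N w.1) ^ (-(1 + θ)) * mxr (latRep N w.2) ^ (-(1 + θ)) ≤ Sc θ := by
    rw [Fintype.sum_prod_type]
    have := Finset.sum_mul_sum (Finset.univ : Finset (ZMod (2*N))) (Finset.univ : Finset (ZMod (2*N))) (fun v => mxr (latRep N v) ^ (-(1 + θ))) (fun v => mxr (latRep N v) ^ (-(1 + θ)))
    rw [← this, ← sq]
    refine pow_le_pow_left₀ (Finset.sum_nonneg fun v _ => ?_) (mxr_sum N (by linarith)) 2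
    have := one_le_mxr (latRep N v)
    positivity
  have hS : 0 ≤ Sc θ := sq_nonneg _
  have h4 : (8 * C ^ 2 * N) ^ (1 + θ : ℝ) ≤ (8 * C ^ 2) ^ 2 * (N:ℝ) ^ (1 + θ : ℝ) := by
    rw [Real.mul_rpow (by positivity) hN.le]
    refine mul_le_mul_of_nonneg_right ?_ (by positivity)
    have : (8 * C ^ 2) ^ (1 + θ : ℝ) ≤ (8 * C ^ 2) ^ (2:ℝ) := Real.rpow_le_rpow_of_exponent_le (by nlinarith) (by linarith)
    exact_mod_cast this
  have h5 : (N:ℝ) ≤ (N:ℝ) ^ (1 + θ : ℝ) := by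
    have := Real.rpow_le_rpow_of_exponent_le hN1 (by linarith : 1 ≤ 1 + θ)
    rwa [Real.rpow_one] at this
  have h6 := mul_le_mul h4 h3 (Finset.sum_nonneg fun w _ => by
    have m1 := one_le_mxr (latRep N w.1)
    have m2 := one_le_mxr (latRep N w.2)
    positivity) (by positivity)
  have h7 := mul_le_mul_of_nonneg_left h5 hB0
  linarith

/-- everything together -/
lemma KA_of {k : Lat N → ℝ} (hk : KH k) (hsw : ∀ z, k (z.2, z.1) = k z) {C B₀ : ℝ} (hC : 1 ≤ C) (hd : ∑ z, |k (z + (1, 0)) - k z| ≤ C / √(N:ℝ))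
    (hCN : 2 * (C * √(N:ℝ)) < N) (hB : ∀ z, k z ≤ B₀ / N) :
    KA (chc N) k (1 + 16 * B₀ + (8 * C ^ 2) ^ 2 * (Sc (1/16) + Sc (1/6) + Sc 1)) N := by
  have hN : (0:ℝ) < N := Nat.cast_pos.2 (NeZero.pos N)
  have hN1 : (1:ℝ) ≤ N := by exact_mod_cast NeZero.pos N
  have hB0 : 0 ≤ B₀ := by
    have := (hk.nonneg 0).trans (hB 0)
    by_contra h; push Not at h
    have := div_neg_of_neg_of_pos h hN
    linarith
  have hs1 : 0 ≤ Sc (1/16) := sq_nonneg _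
  have hs2 : 0 ≤ Sc (1/6) := sq_nonneg _
  have hs3 : 0 ≤ Sc 1 := sq_nonneg _
  have hC2 : 0 ≤ (8 * C ^ 2) ^ 2 := by positivity
  have p1 := mul_nonneg hC2 hs1
  have p2 := mul_nonneg hC2 hs2
  have p3 := mul_nonneg hC2 hs3
  refine ⟨by linarith, hN1, by simp [ZMod.card]; ring, ?_, ?_, ?_, ?_, ?_⟩
  · intro w hw
    rcases p_low2 N hk hsw hC hd hCN hw with h | h
    · linarith
    · refine lt_of_lt_of_le ?_ h
      have m1 := one_le_mxr (latRep N w.1)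
      have m2 := one_le_mxr (latRep N w.2)
      positivity
  · intro x; refine (hB x).trans (div_le_div_of_nonneg_right (by linarith) hN.le)
  · refine (mode_sum N hk hsw hC hd hCN hB (θ := 1/16) (by norm_num) (by norm_num)).trans (mul_le_mul_of_nonneg_right (by linarith) (by positivity))
  · refine (mode_sum N hk hsw hC hd hCN hB (θ := 1/6) (by norm_num) (by norm_num)).trans (mul_le_mul_of_nonneg_right (by linarith) (by positivity))
  · refine (mode_sum N hk hsw hC hd hCN hB (θ := 1) (by norm_num) (by norm_num)).trans (mul_le_mul_of_nonneg_right (by linarith) (by positivity))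

end conc2

section kern
variable (𝔎 : KacProfile)

lemma abs_le_enorm2_fst (x : ℝ × ℝ) : |x.1| ≤ enorm2 x := by
  unfold enorm2; apply Real.abs_le_sqrt; nlinarith [sq_nonneg x.2]
lemma abs_le_enorm2_snd (x : ℝ × ℝ) : |x.2| ≤ enorm2 x := by
  unfold enorm2; apply Real.abs_le_sqrt; nlinarith [sq_nonneg x.1]

lemma prof_lip : ∃ L : ℝ, 0 ≤ L ∧ ∀ x y, |𝔎.f x - 𝔎.f y| ≤ L * dist x y := by
  have hc : HasCompactSupport 𝔎.f := by
    refine HasCompactSupport.of_support_subset_isCompact (isCompact_closedBall (0:ℝ×ℝ) 3) ?_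
    intro x hx
    rw [Function.mem_support] at hx
    have h : enorm2 x ≤ 3 := by
      by_contra h; push Not at h; exact hx (𝔎.supp x h)
    rw [mem_closedBall_zero_iff, Prod.norm_def]
    exact max_le ((abs_le_enorm2_fst x).trans h) ((abs_le_enorm2_snd x).trans h)
  obtain ⟨C, hC⟩ := 𝔎.smooth.lipschitzWith_of_hasCompactSupport hc (by norm_num)
  refine ⟨C, C.2, fun x y => ?_⟩
  have := hC.dist_le_mul x y
  rwa [Real.dist_eq] at this

lemma prof_low : ∃ (x0 : ℝ × ℝ) (m ρ : ℝ), 0 < m ∧ 0 < ρ ∧ ∀ y, dist y x0 ≤ ρ → m ≤ 𝔎.f y := by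
  obtain ⟨x0, hx⟩ := 𝔎.nontriv
  have hp : 0 < 𝔎.f x0 := lt_of_le_of_ne (𝔎.mem x0).1 (Ne.symm hx)
  have hc := 𝔎.smooth.continuous.continuousAt (x := x0)
  rw [Metric.continuousAt_iff] at hc
  obtain ⟨d, hd, h⟩ := hc (𝔎.f x0 / 2) (by linarith)
  refine ⟨x0, 𝔎.f x0 / 2, d/2, by linarith, by linarith, fun y hy => ?_⟩
  have := h (show dist y x0 < d by linarith)
  rw [Real.dist_eq, abs_lt] at this
  linarith [this.1]

variable (N : ℕ) [NeZero N]

lemma gam_eq : gam N = (√(N:ℝ))⁻¹ := by unfold gam; rw [Real.sqrt_inv]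

def gP (z : Lat N) : ℝ := 𝔎.f (gam N * (latRep N z.1 : ℝ), gam N * (latRep N z.2 : ℝ))

lemma kG_eq (c : ℝ) (z : Lat N) : kGamma 𝔎 N c (gam N) z = if z = 0 then 0 else c / N * gP 𝔎 N z := by
  unfold kGamma gP; rw [gam_sq]; rfl

lemma gP_mem (z : Lat N) : gP 𝔎 N z ∈ Set.Icc (0:ℝ) 1 := 𝔎.mem _

lemma gP_neg (z : Lat N) : gP 𝔎 N (-z) = gP 𝔎 N z := by
  unfold gP
  apply 𝔎.radial
  unfold enorm2
  have h1 : ((latRep N (-z.1) : ℤ) : ℝ)^2 = (latRep N z.1 : ℝ)^2 := by exact_mod_cast latRep_neg_sq N z.1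
  have h2 : ((latRep N (-z.2) : ℤ) : ℝ)^2 = (latRep N z.2 : ℝ)^2 := by exact_mod_cast latRep_neg_sq N z.2
  simp only [Prod.fst_neg, Prod.snd_neg, mul_pow, h1, h2]

lemma gP_swap (z : Lat N) : gP 𝔎 N (z.2, z.1) = gP 𝔎 N z := by
  unfold gP
  apply 𝔎.radial
  unfold enorm2
  simp only
  rw [add_comm]

lemma kG_KH {c : ℝ} (hc : 0 < c) (hs : ∑ z, kGamma 𝔎 N c (gam N) z = 1) : KH (kGamma 𝔎 N c (gam N)) where
  nonneg x := by
    rw [kG_eq]; split_ifs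
    · exact le_rfl
    · exact mul_nonneg (by positivity) (gP_mem 𝔎 N x).1
  sum := hs
  even x := by rw [kG_eq, kG_eq, gP_neg]; simp only [neg_eq_zero]
  zero := by rw [kG_eq]; simp

lemma kG_swap (c : ℝ) (z : Lat N) : kGamma 𝔎 N c (gam N) (z.2, z.1) = kGamma 𝔎 N c (gam N) z := by
  rw [kG_eq, kG_eq, gP_swap]
  have : ((z.2, z.1) : Lat N) = 0 ↔ z = 0 := by
    rw [Prod.ext_iff, Prod.ext_iff]; exact and_comm
  simp only [this]

lemma count_Ioc (a l : ℝ) (hl : 2 ≤ l) : l / 2 ≤ ((Finset.Ioc ⌊a⌋ ⌊a + l⌋).card : ℝ) := by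
  rw [Int.card_Ioc]
  have h1 := Int.lt_floor_add_one (a + l)
  have h2 := Int.floor_le a
  have h3 : ((⌊a + l⌋ - ⌊a⌋ : ℤ) : ℝ) ≤ (((⌊a + l⌋ - ⌊a⌋).toNat : ℕ) : ℝ) := by
    exact_mod_cast Int.self_le_toNat _
  push_cast at h3
  linarith

/-- the normalisation is bounded -/
lemma c_bd {x0 : ℝ × ℝ} {m ρ : ℝ} (hm : 0 < m) (hρ : 0 < ρ) (hlow : ∀ y, dist y x0 ≤ ρ → m ≤ 𝔎.f y)
    (h1 : 2 ≤ ρ * √(N:ℝ)) (h2 : 8 ≤ ρ^2 * N) (h3 : |x0.1| + ρ ≤ √(N:ℝ)) (h4 : |x0.2| + ρ ≤ √(N:ℝ))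
    {c : ℝ} (hc : 0 < c) (hs : ∑ z, kGamma 𝔎 N c (gam N) z = 1) : c ≤ 8 / (m * ρ^2) := by
  have hN : (0:ℝ) < N := Nat.cast_pos.2 (NeZero.pos N)
  have hsN : 0 < √(N:ℝ) := Real.sqrt_pos.2 hN
  have hss : √(N:ℝ) * √(N:ℝ) = N := Real.mul_self_sqrt hN.le
  set I : ℝ → Finset ℤ := fun a => Finset.Ioc ⌊√(N:ℝ) * a⌋ ⌊√(N:ℝ) * a + ρ * √(N:ℝ)⌋ with hI
  have hcard : ∀ a, ρ * √(N:ℝ) / 2 ≤ ((I a).card : ℝ) := fun a => count_Ioc _ _ h1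
  have hmem : ∀ a i, i ∈ I a → √(N:ℝ) * a < i ∧ (i:ℝ) ≤ √(N:ℝ) * a + ρ * √(N:ℝ) := by
    intro a i hi
    rw [hI, Finset.mem_Ioc] at hi
    exact ⟨Int.floor_lt.1 hi.1, Int.le_floor.1 hi.2⟩
  have hrep : ∀ a, |a| + ρ ≤ √(N:ℝ) → ∀ i ∈ I a, latRep N (i : ZMod (2*N)) = i := by
    intro a ha i hi
    obtain ⟨u, v⟩ := hmem a i hi
    have := abs_le.1 (show |a| ≤ √(N:ℝ) - ρ by linarith)
    apply latRep_eq
    · have : -(N:ℝ) < i := by nlinarith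
      exact_mod_cast this
    · have : (i:ℝ) ≤ N := by nlinarith
      exact_mod_cast this
  have hd : ∀ a, ∀ i ∈ I a, |gam N * (i:ℝ) - a| ≤ ρ := by
    intro a i hi
    obtain ⟨u, v⟩ := hmem a i hi
    have e : gam N * (i:ℝ) - a = (i - √(N:ℝ) * a) / √(N:ℝ) := by rw [gam_eq]; field_simp
    rw [e, abs_of_pos (div_pos (by linarith) hsN), div_le_iff₀ hsN]
    linarith
  set φ : ℤ × ℤ → Lat N := fun p => ((p.1 : ZMod (2*N)), (p.2 : ZMod (2*N))) with hφ
  set P := I x0.1 ×ˢ I x0.2 with hP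
  have hinj : Set.InjOn φ (P : Set (ℤ × ℤ)) := by
    intro p hp q hq hpq
    rw [Finset.mem_coe, hP, Finset.mem_product] at hp hq
    have e1 : ((p.1 : ℤ) : ZMod (2*N)) = q.1 := congrArg Prod.fst hpq
    have e2 : ((p.2 : ℤ) : ZMod (2*N)) = q.2 := congrArg Prod.snd hpq
    apply Prod.ext
    · rw [← hrep x0.1 h3 p.1 hp.1, e1, hrep x0.1 h3 q.1 hq.1]
    · rw [← hrep x0.2 h4 p.2 hp.2, e2, hrep x0.2 h4 q.2 hq.2]
  set T := (P.image φ).erase 0 with hT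
  have hTc : ρ^2 * N / 8 ≤ (T.card : ℝ) := by
    have a1 : (P.image φ).card - 1 ≤ T.card := Finset.pred_card_le_card_erase
    rw [Finset.card_image_of_injOn hinj, hP, Finset.card_product] at a1
    have a2 : (I x0.1).card * (I x0.2).card ≤ T.card + 1 := by omega
    have a3 : ((I x0.1).card : ℝ) * (I x0.2).card ≤ T.card + 1 := by exact_mod_cast a2
    have a4 : (ρ * √(N:ℝ) / 2) * (ρ * √(N:ℝ) / 2) ≤ ((I x0.1).card : ℝ) * (I x0.2).card :=
      mul_le_mul (hcard _) (hcard _) (by positivity) (by positivity)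
    have a5 : (ρ * √(N:ℝ) / 2) * (ρ * √(N:ℝ) / 2) = ρ^2 * N / 4 := by linear_combination ρ^2 / 4 * hss
    linarith
  have hTk : ∀ z ∈ T, c / N * m ≤ kGamma 𝔎 N c (gam N) z := by
    intro z hz
    rw [hT, Finset.mem_erase, Finset.mem_image] at hz
    obtain ⟨hz0, p, hp, rfl⟩ := hz
    rw [hP, Finset.mem_product] at hp
    rw [kG_eq, if_neg hz0]
    refine mul_le_mul_of_nonneg_left ?_ (by positivity)
    unfold gP
    apply hlow
    rw [Prod.dist_eq]
    simp only [hφ]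
    rw [hrep _ h3 _ hp.1, hrep _ h4 _ hp.2, Real.dist_eq, Real.dist_eq]
    exact max_le (hd _ _ hp.1) (hd _ _ hp.2)
  have hsum : (T.card : ℝ) * (c / N * m) ≤ 1 := by
    rw [← hs]
    calc (T.card : ℝ) * (c / N * m) = ∑ z ∈ T, c / N * m := by rw [Finset.sum_const, nsmul_eq_mul]
      _ ≤ ∑ z ∈ T, kGamma 𝔎 N c (gam N) z := Finset.sum_le_sum hTk
      _ ≤ _ := Finset.sum_le_sum_of_subset_of_nonneg (Finset.subset_univ _) fun z _ _ => (kG_KH 𝔎 N hc hs).nonneg z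
  have h5 : ρ^2 * N / 8 * (c / N * m) ≤ 1 := le_trans (mul_le_mul_of_nonneg_right hTc (by positivity)) hsum
  have h6 : ρ^2 * N / 8 * (c / N * m) = c * (m * ρ^2) / 8 := by field_simp
  rw [le_div_iff₀ (by positivity)]
  linarith

lemma gP_zero {z : Lat N} (h : 3 * √(N:ℝ) < |(latRep N z.1 : ℝ)| ∨ 3 * √(N:ℝ) < |(latRep N z.2 : ℝ)|) : gP 𝔎 N z = 0 := by
  have hN : (0:ℝ) < N := Nat.cast_pos.2 (NeZero.pos N)
  have hsN : 0 < √(N:ℝ) := Real.sqrt_pos.2 hN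
  apply 𝔎.supp
  have key : ∀ r : ℝ, 3 * √(N:ℝ) < |r| → 3 < |gam N * r| := by
    intro r hr
    rw [gam_eq, abs_mul, abs_of_pos (inv_pos.2 hsN), inv_mul_eq_div, lt_div_iff₀ hsN]; exact hr
  rcases h with h | h
  · exact (key _ h).trans_le (abs_le_enorm2_fst (gam N * (latRep N z.1 : ℝ), gam N * (latRep N z.2 : ℝ)))
  · exact (key _ h).trans_le (abs_le_enorm2_snd (gam N * (latRep N z.1 : ℝ), gam N * (latRep N z.2 : ℝ)))

lemma latRep_succ_lt {v : ZMod (2*N)} (h : latRep N v < N) : latRep N (v + 1) = latRep N v + 1 := by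
  have hb := latRep_bd N v
  have := latRep_eq N (latRep N v + 1) (by omega) (by omega)
  rw [← this]; push_cast; rw [latRep_cast]

lemma latRep_succ_eq {v : ZMod (2*N)} (h : latRep N v = N) : latRep N (v + 1) = 1 - N := by
  have hp := NeZero.pos N
  have := latRep_eq N (1 - N) (by omega) (by omega)
  rw [← this]; congr 1
  rw [← latRep_cast N v, h]
  have h2 : ((2 * N : ℕ) : ZMod (2*N)) = 0 := ZMod.natCast_self _
  push_cast at h2 ⊢
  linear_combination h2

lemma gP_diff {L : ℝ} (hL0 : 0 ≤ L) (hL : ∀ x y, |𝔎.f x - 𝔎.f y| ≤ L * dist x y) (hN4 : 4 * √(N:ℝ) < N) (z : Lat N) :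
    |gP 𝔎 N (z + (1,0)) - gP 𝔎 N z| ≤
      L / √(N:ℝ) * ((if |(latRep N z.1 : ℝ)| ≤ 4 * √(N:ℝ) then 1 else 0) * (if |(latRep N z.2 : ℝ)| ≤ 4 * √(N:ℝ) then 1 else 0)) := by
  have hN : (0:ℝ) < N := Nat.cast_pos.2 (NeZero.pos N)
  have hsN : 0 < √(N:ℝ) := Real.sqrt_pos.2 hN
  have hN1 : (1:ℝ) ≤ N := by exact_mod_cast NeZero.pos N
  have hs1 : 1 ≤ √(N:ℝ) := Real.one_le_sqrt.2 hN1
  have hb := latRep_bd N z.1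
  by_cases h1 : |(latRep N z.1 : ℝ)| ≤ 4 * √(N:ℝ)
  · by_cases h2 : |(latRep N z.2 : ℝ)| ≤ 4 * √(N:ℝ)
    · rw [if_pos h1, if_pos h2]
      have hlt : latRep N z.1 < N := by
        have : (latRep N z.1 : ℝ) < N := (le_abs_self _).trans_lt (h1.trans_lt hN4)
        exact_mod_cast this
      unfold gP
      refine (hL _ _).trans ?_
      simp only [Prod.fst_add, Prod.snd_add, add_zero]
      rw [latRep_succ_lt N hlt, Prod.dist_eq]
      simp only [dist_self]
      rw [Real.dist_eq]
      have : gam N * ((latRep N z.1 + 1 : ℤ) : ℝ) - gam N * (latRep N z.1 : ℝ) = gam N := by push_cast; ring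
      rw [this, gam_eq, abs_of_pos (inv_pos.2 hsN), max_eq_left (inv_pos.2 hsN).le]
      rw [mul_one, mul_one, div_eq_mul_inv]
    · rw [if_neg h2, mul_zero, mul_zero]
      push Not at h2
      rw [gP_zero 𝔎 N (z := z) (Or.inr (by linarith)), gP_zero 𝔎 N (z := z + (1,0)) (Or.inr (by simp only [Prod.snd_add, add_zero]; linarith))]
      simp
  · rw [if_neg h1, zero_mul, mul_zero]
    push Not at h1
    rw [gP_zero 𝔎 N (z := z) (Or.inl (by linarith)), gP_zero 𝔎 N (z := z + (1,0)) (Or.inl ?_)]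
    · simp
    · simp only [Prod.fst_add]
      rcases hb.2.lt_or_eq with h | h
      · rw [latRep_succ_lt N h]
        push_cast
        have := abs_sub_abs_le_abs_sub (latRep N z.1 : ℝ) (-1)
        rw [sub_neg_eq_add] at this
        norm_num at this
        linarith
      · rw [latRep_succ_eq N h]
        push_cast
        rw [abs_sub_comm]
        have := le_abs_self ((N:ℝ) - 1)
        linarith

lemma count_rep : ∑ v : ZMod (2*N), (if |(latRep N v : ℝ)| ≤ 4 * √(N:ℝ) then (1:ℝ) else 0) ≤ 9 * √(N:ℝ) := by
  have hN : (0:ℝ) < N := Nat.cast_pos.2 (NeZero.pos N)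
  have hN1 : (1:ℝ) ≤ N := by exact_mod_cast NeZero.pos N
  have hs1 : 1 ≤ √(N:ℝ) := Real.one_le_sqrt.2 hN1
  rw [Finset.sum_boole]
  have h : (Finset.univ.filter fun v : ZMod (2*N) => |(latRep N v : ℝ)| ≤ 4 * √(N:ℝ)).card ≤ (Finset.Icc (-⌊4 * √(N:ℝ)⌋) ⌊4 * √(N:ℝ)⌋).card := by
    refine Finset.card_le_card_of_injOn (latRep N) ?_ ?_
    · intro v hv
      rw [Finset.mem_coe, Finset.mem_filter] at hv
      rw [Finset.mem_coe, Finset.mem_Icc]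
      have := abs_le.1 hv.2
      constructor
      · have : -latRep N v ≤ ⌊4 * √(N:ℝ)⌋ := Int.le_floor.2 (by push_cast; linarith)
        linarith
      · exact Int.le_floor.2 this.2
    · intro v _ w _ h
      rw [← latRep_cast N v, ← latRep_cast N w, h]
  rw [Int.card_Icc] at h
  have h0 : 0 ≤ ⌊4 * √(N:ℝ)⌋ := Int.floor_nonneg.2 (by linarith)
  have h1 : ((Finset.univ.filter fun v : ZMod (2*N) => |(latRep N v : ℝ)| ≤ 4 * √(N:ℝ)).card : ℤ) ≤ 2 * ⌊4 * √(N:ℝ)⌋ + 1 := by omega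
  have h2 : ((Finset.univ.filter fun v : ZMod (2*N) => |(latRep N v : ℝ)| ≤ 4 * √(N:ℝ)).card : ℝ) ≤ 2 * ⌊4 * √(N:ℝ)⌋ + 1 := by exact_mod_cast h1
  have := Int.floor_le (4 * √(N:ℝ))
  linarith

lemma kG_diff {L : ℝ} (hL0 : 0 ≤ L) (hL : ∀ x y, |𝔎.f x - 𝔎.f y| ≤ L * dist x y) (hN4 : 4 * √(N:ℝ) < N)
    {c Bc : ℝ} (hc : 0 < c) (hcB : c ≤ Bc) :
    ∑ z, |kGamma 𝔎 N c (gam N) (z + (1,0)) - kGamma 𝔎 N c (gam N) z| ≤ Bc * (81 * L + 2) / √(N:ℝ) := by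
  have hN : (0:ℝ) < N := Nat.cast_pos.2 (NeZero.pos N)
  have hsN : 0 < √(N:ℝ) := Real.sqrt_pos.2 hN
  have hss : √(N:ℝ) * √(N:ℝ) = N := Real.mul_self_sqrt hN.le
  have hN1 : (1:ℝ) ≤ N := by exact_mod_cast NeZero.pos N
  have hs1 : 1 ≤ √(N:ℝ) := Real.one_le_sqrt.2 hN1
  have e : ∀ z, kGamma 𝔎 N c (gam N) z = c / N * (gP 𝔎 N z - if z = 0 then gP 𝔎 N 0 else 0) := by
    intro z; rw [kG_eq]; split_ifs with h
    · rw [h]; ring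
    · ring
  have b0 := gP_mem 𝔎 N 0
  have pt : ∀ z, |kGamma 𝔎 N c (gam N) (z + (1,0)) - kGamma 𝔎 N c (gam N) z| ≤
      c / N * (|gP 𝔎 N (z + (1,0)) - gP 𝔎 N z| + (if z + (1,0) = 0 then 1 else 0) + (if z = 0 then 1 else 0)) := by
    intro z
    rw [e, e, ← mul_sub, abs_mul, abs_of_nonneg (by positivity : 0 ≤ c / (N:ℝ))]
    refine mul_le_mul_of_nonneg_left ?_ (by positivity)
    have t : ∀ p : Prop, [Decidable p] → |(if p then gP 𝔎 N 0 else 0)| ≤ if p then (1:ℝ) else 0 := by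
      intro p _; split_ifs
      · rw [abs_of_nonneg b0.1]; exact b0.2
      · simp
    have t1 := t (z + (1,0) = 0)
    have t2 := t (z = 0)
    generalize (if z + (1,0) = 0 then gP 𝔎 N 0 else 0) = u at *
    generalize (if z = 0 then gP 𝔎 N 0 else 0) = v at *
    have : gP 𝔎 N (z + (1,0)) - u - (gP 𝔎 N z - v) = (gP 𝔎 N (z + (1,0)) - gP 𝔎 N z) - u + v := by ring
    rw [this]
    refine (abs_add_le _ _).trans (add_le_add ((abs_sub _ _).trans (add_le_add le_rfl t1)) t2)
  refine (Finset.sum_le_sum fun z _ => pt z).trans ?_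
  rw [← Finset.mul_sum, Finset.sum_add_distrib, Finset.sum_add_distrib]
  have s1 : ∑ z : Lat N, (if z = 0 then (1:ℝ) else 0) = 1 := by simp
  have s2 : ∑ z : Lat N, (if z + (1,0) = 0 then (1:ℝ) else 0) = 1 := by
    exact (Equiv.sum_comp (Equiv.addRight ((1,0) : Lat N)) (fun z => if z = 0 then (1:ℝ) else 0)).trans s1
  have s3 : ∑ z : Lat N, |gP 𝔎 N (z + (1,0)) - gP 𝔎 N z| ≤ 81 * L * √(N:ℝ) := by
    refine (Finset.sum_le_sum fun z _ => gP_diff 𝔎 N hL0 hL hN4 z).trans ?_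
    rw [← Finset.mul_sum, Fintype.sum_prod_type]
    dsimp only
    have q2 := Finset.sum_mul_sum Finset.univ Finset.univ
      (fun v : ZMod (2*N) => if |(latRep N v : ℝ)| ≤ 4 * √(N:ℝ) then (1:ℝ) else 0)
      (fun v : ZMod (2*N) => if |(latRep N v : ℝ)| ≤ 4 * √(N:ℝ) then (1:ℝ) else 0)
    refine (congrArg (fun t => L / √(N:ℝ) * t) q2.symm).le.trans ?_
    have q := count_rep N
    have q0 : 0 ≤ ∑ v : ZMod (2*N), (if |(latRep N v : ℝ)| ≤ 4 * √(N:ℝ) then (1:ℝ) else 0) :=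
      Finset.sum_nonneg fun v _ => by split_ifs <;> norm_num
    calc _ ≤ L / √(N:ℝ) * ((9 * √(N:ℝ)) * (9 * √(N:ℝ))) :=
          mul_le_mul_of_nonneg_left (mul_le_mul q q q0 (by positivity)) (by positivity)
      _ = _ := by field_simp; ring
  rw [s1, s2]
  have f1 : c / N * (∑ z : Lat N, |gP 𝔎 N (z + (1,0)) - gP 𝔎 N z| + 1 + 1) ≤ Bc / N * ((81 * L + 2) * √(N:ℝ)) := by
    have hq : 0 ≤ ∑ z : Lat N, |gP 𝔎 N (z + (1,0)) - gP 𝔎 N z| := Finset.sum_nonneg fun _ _ => abs_nonneg _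
    refine mul_le_mul (by gcongr) (by linarith) (by linarith) (by have := hc.trans_le hcB; positivity)
  refine f1.trans (le_of_eq ?_)
  rw [div_mul_eq_mul_div, div_eq_div_iff hN.ne' hsN.ne']; linear_combination Bc * (81 * L + 2) * hss

lemma kG_sup {c Bc : ℝ} (hc : 0 < c) (hcB : c ≤ Bc) (z : Lat N) : kGamma 𝔎 N c (gam N) z ≤ Bc / N := by
  have hN : (0:ℝ) < N := Nat.cast_pos.2 (NeZero.pos N)
  have hB := hc.trans_le hcB
  rw [kG_eq]; split_ifs
  · positivity
  · have := gP_mem 𝔎 N z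
    calc c / N * gP 𝔎 N z ≤ c / N * 1 := mul_le_mul_of_nonneg_left this.2 (by positivity)
      _ ≤ _ := by rw [mul_one]; gcongr

end kern

/-- all kernel hypotheses hold eventually, with a constant depending only on the profile -/
theorem kern_KA (𝔎 : KacProfile) : ∃ (B : ℝ) (N₀ : ℕ), 1 ≤ B ∧ ∀ (N : ℕ) [NeZero N], N₀ ≤ N → ∀ c : ℝ, 0 < c →
    ∑ z, kGamma 𝔎 N c (gam N) z = 1 → KA (chc N) (kGamma 𝔎 N c (gam N)) B N := by
  obtain ⟨L, hL0, hL⟩ := prof_lip 𝔎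
  obtain ⟨x0, m, ρ, hm, hρ, hlow⟩ := prof_low 𝔎
  set Bc := 8 / (m * ρ^2) with hBc
  have hBc0 : 0 < Bc := by positivity
  set C := 1 + Bc * (81 * L + 2) with hC
  have hC1 : 1 ≤ C := by have : 0 ≤ Bc * (81 * L + 2) := by positivity
                         linarith
  set M := 1 + 4 + 2 / ρ + 8 / ρ^2 + |x0.1| + |x0.2| + ρ + 2 * C with hM
  have p1 : 0 < 2 / ρ := by positivity
  have p2 : 0 < 8 / ρ^2 := by positivity
  have p3 := abs_nonneg x0.1
  have p4 := abs_nonneg x0.2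
  refine ⟨1 + 16 * Bc + (8 * C ^ 2) ^ 2 * (Sc (1/16) + Sc (1/6) + Sc 1), ⌈M^2⌉₊, ?_, ?_⟩
  · have hs1 : 0 ≤ Sc (1/16) := sq_nonneg _
    have hs2 : 0 ≤ Sc (1/6) := sq_nonneg _
    have hs3 : 0 ≤ Sc 1 := sq_nonneg _
    have : 0 ≤ (8 * C ^ 2) ^ 2 * (Sc (1/16) + Sc (1/6) + Sc 1) := by positivity
    linarith
  intro N _ hN c hc hs
  have hN0 : (0:ℝ) < N := Nat.cast_pos.2 (NeZero.pos N)
  have hss : √(N:ℝ) * √(N:ℝ) = N := Real.mul_self_sqrt hN0.le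
  have hMs : M ≤ √(N:ℝ) := Real.le_sqrt_of_sq_le (Nat.ceil_le.1 hN)
  have hs1 : 1 ≤ √(N:ℝ) := by linarith
  have hsN : √(N:ℝ) ≤ N := by nlinarith
  have hcB : c ≤ Bc := by
    refine c_bd 𝔎 N hm hρ hlow ?_ ?_ (by linarith) (by linarith) hc hs
    · have : 2 / ρ ≤ √(N:ℝ) := by linarith
      rw [div_le_iff₀ hρ] at this; linarith
    · have : 8 / ρ^2 ≤ N := by linarith
      rw [div_le_iff₀ (by positivity)] at this; linarith
  refine KA_of N (kG_KH 𝔎 N hc hs) (kG_swap 𝔎 N c) hC1 ?_ ?_ (kG_sup 𝔎 N hc hcB)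
  · refine (kG_diff 𝔎 N hL0 hL (by nlinarith) hc hcB).trans ?_
    gcongr
    linarith
  · nlinarith

section redn
variable (N : ℕ) [NeZero N]

lemma gibbsE_ev (k : Lat N → ℝ) (β : ℝ) (F : (Lat N → ℝ) → ℝ) :
    gibbsE N k β 0 F = ev (Jk β k) (fun s => F (fun x => spin (s x))) := by
  have h : ∀ s : Lat N → Bool, Real.exp (hamil N k β 0 (fun x => spin (s x))) = wt (Jk β k) s := by
    intro s
    unfold wt en hamil Jk JK tk sg
    congr 1
    have hsp : ∀ g : Lat N × Lat N → ℝ, ∑ e, g e = ∑ x, ∑ y, g (x, y) := fun g => Fintype.sum_prod_type g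
    rw [zero_mul, add_zero, Finset.mul_sum, hsp]
    refine Finset.sum_congr rfl fun x _ => ?_
    rw [Finset.mul_sum]
    refine Finset.sum_congr rfl fun y _ => ?_
    ring
  unfold gibbsE ev Zp
  simp only [h]

lemma ev_tsum {V : Type*} [Fintype V] [DecidableEq V] {ι : Type*} (J : V × V → ℝ) (f : ι → (V → Bool) → ℝ)
    (hf : ∀ s, Summable fun i => f i s) :
    ev J (fun s => ∑' i, f i s) = ∑' i, ev J (f i) := by
  unfold ev
  rw [tsum_div_const]
  congr 1
  rw [Summable.tsum_finsetSum (fun s _ => (hf s).mul_left _)]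
  exact Finset.sum_congr rfl fun s _ => (tsum_mul_left).symm

/-- lattice cell of a point -/
def cell (x : ℝ × ℝ) : Lat N := (((⌊(N : ℝ) * x.1⌋ : ℤ) : ZMod (2*N)), ((⌊(N : ℝ) * x.2⌋ : ℤ) : ZMod (2*N)))

def cset (z : Lat N) : Set (ℝ × ℝ) := {x | cell N x = z}

lemma cset_meas (z : Lat N) : MeasurableSet (cset N z) := by
  have h1 : Measurable fun x : ℝ × ℝ => ⌊(N:ℝ) * x.1⌋ := Int.measurable_floor.comp (measurable_fst.const_mul _)
  have h2 : Measurable fun x : ℝ × ℝ => ⌊(N:ℝ) * x.2⌋ := Int.measurable_floor.comp (measurable_snd.const_mul _)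
  have e : cset N z = (fun x : ℝ × ℝ => ⌊(N:ℝ) * x.1⌋) ⁻¹' {i | (i : ZMod (2*N)) = z.1} ∩ (fun x : ℝ × ℝ => ⌊(N:ℝ) * x.2⌋) ⁻¹' {i | (i : ZMod (2*N)) = z.2} := by
    ext x; simp only [cset, cell, Set.mem_setOf_eq, Prod.ext_iff, Set.mem_inter_iff, Set.mem_preimage]
  rw [e]
  exact (h1 (MeasurableSet.of_discrete)).inter (h2 (MeasurableSet.of_discrete))

def Sv (v : ZMod (2*N)) : Set ℝ :=
  Set.Icc ((latRep N v : ℝ) / N) (((latRep N v : ℝ) + 1) / N) ∪ Set.Icc (-1) (-1 + 1 / N)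

lemma Sv_vol (v : ZMod (2*N)) : volume (Sv N v) ≤ ENNReal.ofReal (2 / N) := by
  have hN : (0:ℝ) < N := Nat.cast_pos.2 (NeZero.pos N)
  refine (measure_union_le _ _).trans ?_
  rw [Real.volume_Icc, Real.volume_Icc, ← ENNReal.ofReal_add]
  · apply ENNReal.ofReal_le_ofReal; apply le_of_eq; field_simp; ring
  · rw [← sub_div]; apply div_nonneg _ hN.le; linarith
  · have : 0 < 1 / (N:ℝ) := by positivity
    linarith

lemma mem_Sv {t : ℝ} (ht : t ∈ Set.Icc (-1:ℝ) 1) : t ∈ Sv N ((⌊(N:ℝ) * t⌋ : ℤ) : ZMod (2*N)) := by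
  have hN : (0:ℝ) < N := Nat.cast_pos.2 (NeZero.pos N)
  have h1 := Int.floor_le ((N:ℝ) * t)
  have h2 := (Int.lt_floor_add_one ((N:ℝ) * t)).le
  have hlo : -(N:ℤ) ≤ ⌊(N:ℝ) * t⌋ := Int.le_floor.2 (by push_cast; nlinarith [ht.1])
  have hhi : ⌊(N:ℝ) * t⌋ ≤ N := by
    have : (⌊(N:ℝ) * t⌋ : ℝ) ≤ N := by nlinarith [ht.2]
    exact_mod_cast this
  rcases hlo.lt_or_eq with h | h
  · left
    rw [latRep_eq N _ h hhi, Set.mem_Icc, div_le_iff₀ hN, le_div_iff₀ hN]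
    constructor <;> linarith
  · right
    rw [← h] at h2
    push_cast at h2
    refine ⟨ht.1, ?_⟩
    have : N * t ≤ N * (-1 + 1 / (N:ℝ)) := by
      rw [mul_add, mul_one_div_cancel hN.ne']; linarith
    exact le_of_mul_le_mul_left this hN

lemma cell_vol (z : Lat N) : volume (cset N z ∩ box) ≤ ENNReal.ofReal (4 / N^2) := by
  have hN : (0:ℝ) < N := Nat.cast_pos.2 (NeZero.pos N)
  have hsub : cset N z ∩ box ⊆ Sv N z.1 ×ˢ Sv N z.2 := by
    rintro x ⟨hx, hb⟩
    have hx' : cell N x = z := hx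
    rw [← hx']
    exact ⟨mem_Sv N hb.1, mem_Sv N hb.2⟩
  refine (measure_mono hsub).trans ?_
  rw [Measure.volume_eq_prod, Measure.prod_prod]
  refine (mul_le_mul' (Sv_vol N z.1) (Sv_vol N z.2)).trans ?_
  rw [← ENNReal.ofReal_mul (by positivity)]
  apply ENNReal.ofReal_le_ofReal; apply le_of_eq; field_simp; norm_num

/-- Fourier coefficient of a cell -/
def az (ω : ℤ × ℤ) (z : Lat N) : ℂ := ∫ x in cset N z ∩ box, (starRingEnd ℂ) (eW ω x)

lemma eW_norm (ω : ℤ × ℤ) (x : ℝ × ℝ) : ‖(starRingEnd ℂ) (eW ω x)‖ = 1 := by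
  rw [RCLike.norm_conj]; unfold eW
  have : (Real.pi : ℂ) * Complex.I * ((ω.1 : ℂ) * (x.1 : ℂ) + (ω.2 : ℂ) * (x.2 : ℂ)) = ((Real.pi * (ω.1 * x.1 + ω.2 * x.2) : ℝ) : ℂ) * Complex.I := by
    push_cast; ring
  rw [this, Complex.norm_exp_ofReal_mul_I]

lemma az_norm (ω : ℤ × ℤ) (z : Lat N) : ‖az N ω z‖ ≤ 4 / N^2 := by
  have hv := cell_vol N z
  have hfin : volume (cset N z ∩ box) < ⊤ := hv.trans_lt ENNReal.ofReal_lt_top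
  have := norm_setIntegral_le_of_norm_le_const (μ := volume) (s := cset N z ∩ box) (C := 1) hfin
    (f := fun x => (starRingEnd ℂ) (eW ω x)) (fun x _ => (eW_norm ω x).le)
  refine this.trans ?_
  rw [one_mul]
  exact ENNReal.toReal_le_of_le_ofReal (by positivity) hv

lemma cFT_eq (σ : Lat N → ℝ) (g : ℝ) (ω : ℤ × ℤ) :
    cFT (fun x => ((g * stepField N σ x : ℝ) : ℂ)) ω = (g : ℂ) * ∑ z, (σ z : ℂ) * az N ω z := by
  unfold cFT
  have hcont : Continuous fun x => (starRingEnd ℂ) (eW ω x) := by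
    unfold eW; fun_prop
  have hinteg : IntegrableOn (fun x => (starRingEnd ℂ) (eW ω x)) box := by
    refine hcont.continuousOn.integrableOn_compact ?_
    exact isCompact_Icc.prod isCompact_Icc
  have e : ∀ x, ((g * stepField N σ x : ℝ) : ℂ) * (starRingEnd ℂ) (eW ω x) =
      ∑ z, (g : ℂ) * (σ z : ℂ) * (cset N z).indicator (fun x => (starRingEnd ℂ) (eW ω x)) x := by
    intro x
    rw [Finset.sum_eq_single (cell N x)]
    · rw [Set.indicator_of_mem (show x ∈ cset N (cell N x) from rfl)]
      push_cast; rfl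
    · intro z _ hz
      have hx : x ∉ cset N z := fun h => hz (show cell N x = z from h).symm
      rw [Set.indicator_of_notMem hx, mul_zero]
    · intro h; exact absurd (Finset.mem_univ _) h
  simp only [e]
  rw [integral_finset_sum]
  · rw [Finset.mul_sum]
    refine Finset.sum_congr rfl fun z _ => ?_
    rw [integral_const_mul, integral_indicator (cset_meas N z), Measure.restrict_restrict (cset_meas N z), mul_assoc]
    rfl
  · intro z _
    exact (hinteg.indicator (cset_meas N z)).const_mul _

lemma norm_cFT (s : Lat N → Bool) (ω : ℤ × ℤ) :
    ‖cFT (fun x => (((gam N)⁻¹ * stepField N (fun x => spin (s x)) x : ℝ) : ℂ)) ω‖^2 =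
      N * (hl (fun z => (az N ω z).re) s ^ 2 + hl (fun z => (az N ω z).im) s ^ 2) := by
  rw [cFT_eq, norm_mul, mul_pow, Complex.norm_real, Real.norm_eq_abs, sq_abs, inv_pow, gam_sq, inv_inv]
  congr 1
  rw [Complex.sq_norm, Complex.normSq_apply, Complex.re_sum, Complex.im_sum]
  unfold hl sg
  simp only [Complex.re_ofReal_mul, Complex.im_ofReal_mul, mul_comm (spin _)]
  ring

lemma hl_sq_le (f : Lat N → ℝ) {M : ℝ} (hM : ∀ z, |f z| ≤ M) (s : Lat N → Bool) :
    hl f s ^ 2 ≤ ((Fintype.card (Lat N) : ℝ) * M) ^ 2 := by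
  rw [← sq_abs (hl f s)]
  have : |hl f s| ≤ (Fintype.card (Lat N) : ℝ) * M := by
    unfold hl
    refine (Finset.abs_sum_le_sum_abs _ _).trans ?_
    rw [← nsmul_eq_mul, ← Finset.card_univ]
    refine Finset.sum_le_card_nsmul _ _ _ fun z _ => ?_
    rw [abs_mul]
    rcases sg_cases s z with h | h <;> rw [h] <;> simpa using hM z
  exact pow_le_pow_left₀ (abs_nonneg _) this 2

lemma ev_hl_le {β : ℝ} (hβ : 0 ≤ β) {k : Lat N → ℝ} (hk : KH k) (f : Lat N → ℝ) {M : ℝ} (hM : ∀ z, |f z| ≤ M) :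
    ev (Jk β k) (fun s => hl f s ^ 2) ≤ M^2 * (4 * N^2 * ∑ x, Sf β k x) := by
  rw [ev_h2]
  have h1 : ∀ a b, f a * f b * S2 (Jk β k) a b ≤ M^2 * Sf β k (a - b) := by
    intro a b
    rw [S2_sh]
    refine mul_le_mul_of_nonneg_right ?_ (Sf_nonneg hβ hk _)
    calc f a * f b ≤ |f a * f b| := le_abs_self _
      _ = |f a| * |f b| := abs_mul _ _
      _ ≤ M * M := mul_le_mul (hM a) (hM b) (abs_nonneg _) ((abs_nonneg _).trans (hM a))
      _ = M^2 := by ring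
  refine (Finset.sum_le_sum fun a _ => Finset.sum_le_sum fun b _ => h1 a b).trans (le_of_eq ?_)
  have h2 : ∀ a : Lat N, ∑ b, M^2 * Sf β k (a - b) = M^2 * ∑ x, Sf β k x := by
    intro a
    rw [← Finset.mul_sum]
    congr 1
    exact Equiv.sum_comp (Equiv.subLeft a) (Sf β k)
  simp only [h2]
  rw [Finset.sum_const, Finset.card_univ, nsmul_eq_mul]
  have : (Fintype.card (Lat N) : ℝ) = 4 * N^2 := by simp [ZMod.card]; ring
  rw [this]; ring

lemma summable_w1 : Summable fun n : ℤ => (1 + (n:ℝ)^2)⁻¹ := by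
  have h1 : Summable fun n : ℤ => 1 / (n:ℝ)^2 := Real.summable_one_div_int_pow.2 (by norm_num)
  have h2 : Summable fun n : ℤ => if n = 0 then (1:ℝ) else 0 := (hasSum_ite_eq (0:ℤ) (1:ℝ)).summable
  refine Summable.of_nonneg_of_le (fun n => by positivity) (fun n => ?_) (h2.add h1)
  split_ifs with h
  · subst h; norm_num
  · have : (0:ℝ) < (n:ℝ)^2 := by positivity
    rw [zero_add, ← one_div]
    exact one_div_le_one_div_of_le this (by linarith)

def wk (k : ℕ) (ω : ℤ × ℤ) : ℝ := ((1 + (ω.1 : ℝ)^2 + (ω.2 : ℝ)^2) ^ k)⁻¹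

lemma wk_nonneg (k : ℕ) (ω : ℤ × ℤ) : 0 ≤ wk k ω := by unfold wk; positivity

lemma summable_wk {k : ℕ} (hk : 2 ≤ k) : Summable (wk k) := by
  have h := summable_w1.mul_of_nonneg summable_w1 (fun n => by positivity) (fun n => by positivity)
  refine Summable.of_nonneg_of_le (wk_nonneg k) (fun ω => ?_) h
  unfold wk
  rw [← mul_inv]
  refine inv_anti₀ (by positivity) ?_
  have a := sq_nonneg (ω.1:ℝ)
  have b := sq_nonneg (ω.2:ℝ)
  calc (1 + (ω.1:ℝ)^2) * (1 + (ω.2:ℝ)^2) ≤ (1 + (ω.1 : ℝ)^2 + (ω.2 : ℝ)^2) ^ 2 := by nlinarith [mul_nonneg a b]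
    _ ≤ _ := pow_le_pow_right₀ (by linarith) hk

/-- moment bound from the susceptibility bound -/
lemma moment_le {β : ℝ} (hβ : 0 ≤ β) {k : Lat N → ℝ} (hk : KH k) {C : ℝ} (hC : ∑ x, Sf β k x ≤ C * N) {j : ℕ} (hj : 2 ≤ j) :
    gibbsE N k β 0 (fun σ => ∑' ω : ℤ × ℤ, ((1 + (ω.1 : ℝ)^2 + (ω.2 : ℝ)^2) ^ j)⁻¹ *
            ‖cFT (fun x => (((gam N)⁻¹ * stepField N σ x : ℝ) : ℂ)) ω‖^2) ≤ (128 * C) * ∑' ω, wk j ω := by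
  have hN : (0:ℝ) < N := Nat.cast_pos.2 (NeZero.pos N)
  rw [gibbsE_ev]
  simp only [norm_cFT]
  have hre : ∀ ω z, |(az N ω z).re| ≤ 4 / (N:ℝ)^2 := fun ω z => (Complex.abs_re_le_norm _).trans (az_norm N ω z)
  have him : ∀ ω z, |(az N ω z).im| ≤ 4 / (N:ℝ)^2 := fun ω z => (Complex.abs_im_le_norm _).trans (az_norm N ω z)
  have hw := summable_wk hj
  rw [ev_tsum]
  · rw [← tsum_mul_left]
    have hb : ∀ ω : ℤ × ℤ, ev (Jk β k) (fun s => ((1 + (ω.1 : ℝ)^2 + (ω.2 : ℝ)^2) ^ j)⁻¹ *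
        (N * (hl (fun z => (az N ω z).re) s ^ 2 + hl (fun z => (az N ω z).im) s ^ 2))) ≤ 128 * C * wk j ω := by
      intro ω
      rw [ev_mul_left, ev_mul_left, ev_add]
      have h1 := ev_hl_le N hβ hk _ (hre ω)
      have h2 := ev_hl_le N hβ hk _ (him ω)
      have h3 : (4 / (N:ℝ)^2)^2 * (4 * N^2 * ∑ x, Sf β k x) ≤ (4 / (N:ℝ)^2)^2 * (4 * N^2 * (C * N)) := by gcongr
      have h4 : (4 / (N:ℝ)^2)^2 * (4 * N^2 * (C * N)) = 64 * C / N := by field_simp; ring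
      have h5 : N * (ev (Jk β k) (fun s => hl (fun z => (az N ω z).re) s ^ 2) + ev (Jk β k) (fun s => hl (fun z => (az N ω z).im) s ^ 2)) ≤ 128 * C := by
        calc _ ≤ N * (64 * C / N + 64 * C / N) := by
              refine mul_le_mul_of_nonneg_left ?_ hN.le; linarith
          _ = 128 * C := by field_simp; ring
      rw [mul_comm (128 * C)]
      exact mul_le_mul_of_nonneg_left h5 (wk_nonneg j ω)
    refine Summable.tsum_le_tsum hb ?_ (hw.mul_left _)
    refine Summable.of_nonneg_of_le (fun ω => ?_) hb (hw.mul_left _)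
    exact ev_nonneg _ fun s => by positivity
  · intro s
    refine Summable.of_nonneg_of_le (fun ω => by positivity) (fun ω => ?_)
      (hw.mul_right (N * (((Fintype.card (Lat N) : ℝ) * (4 / (N:ℝ)^2)) ^ 2 + ((Fintype.card (Lat N) : ℝ) * (4 / (N:ℝ)^2)) ^ 2)))
    refine mul_le_mul_of_nonneg_left ?_ (wk_nonneg j ω)
    exact mul_le_mul_of_nonneg_left (add_le_add (hl_sq_le N _ (hre ω) s) (hl_sq_le N _ (him ω) s)) hN.le

end redn


/-- uniform bound on the second moment of the `H^{-k}(𝕋²)` norm of the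
rescaled spin field `γ^{-1} σ_{⌊ε^{-1}x⌋}` under the Gibbs measure, for `k` large enough. -/
theorem statement1 (𝔎 : KacProfile) (A : ℝ) :
    ∃ k₀ : ℕ, ∀ k : ℕ, k₀ ≤ k →
      ∃ C : ℝ, ∃ N₀ : ℕ, ∀ (N : ℕ) [NeZero N], N₀ ≤ N → ∀ c : ℝ, 0 < c →
        (∑ z : Lat N, kGamma 𝔎 N c (gam N) z) = 1 →
        gibbsE N (kGamma 𝔎 N c (gam N)) (betaCrit 𝔎 N c A) 0
          (fun σ => ∑' ω : ℤ × ℤ, ((1 + (ω.1 : ℝ)^2 + (ω.2 : ℝ)^2) ^ k)⁻¹ *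
            ‖cFT (fun x => (((gam N)⁻¹ * stepField N σ x : ℝ) : ℂ)) ω‖^2) ≤ C := by
  obtain ⟨B, N₀, hB, hKA⟩ := kern_KA 𝔎
  obtain ⟨D, hD⟩ : ∃ D, D = |A| + B := ⟨_, rfl⟩
  have hA0 := abs_nonneg A
  have hD1 : 1 ≤ D := by linarith
  obtain ⟨M, hM⟩ : ∃ M, M = 1 + 104 * D + (26 * D)^9 := ⟨_, rfl⟩
  have hp : 0 ≤ (26 * D)^9 := by positivity
  obtain ⟨C₁, hC₁⟩ : ∃ C₁, C₁ = 4 * (1+2*(D+3)*(10+3*|A|+6*B+12*(80*B^2*(D+3)))^2) := ⟨_, rfl⟩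
  refine ⟨2, fun k hk => ⟨128 * C₁ * ∑' ω, wk k ω, max N₀ ⌈M^16⌉₊, ?_⟩⟩
  intro N _ hN c hc hs
  have hN0 : (0:ℝ) < N := Nat.cast_pos.2 (NeZero.pos N)
  have ka := hKA N ((le_max_left _ _).trans hN) c hc hs
  have kh := kG_KH 𝔎 N hc hs
  have hNM : M^16 ≤ (N:ℝ) := Nat.ceil_le.1 ((le_max_right _ _).trans hN)
  obtain ⟨X, hX⟩ : ∃ X : ℝ, X = (N:ℝ) ^ (1/16 : ℝ) := ⟨_, rfl⟩
  have hXN : (N:ℝ) = X^16 := by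
    rw [hX, ← Real.rpow_natCast, ← Real.rpow_mul hN0.le]; norm_num
  have hX0 : 0 < X := by rw [hX]; exact Real.rpow_pos_of_pos hN0 _
  have hMX : M ≤ X := by
    rw [hXN] at hNM
    exact le_of_pow_le_pow_left₀ (by norm_num) hX0.le hNM
  have hX1 : 1 ≤ X := by rw [hM] at hMX; linarith
  have hXXN : X ≤ N := by
    rw [hXN]; exact le_self_pow₀ hX1 (by norm_num)
  have hβ : betaCrit 𝔎 N c A = 1 + (ccf (chc N) (kGamma 𝔎 N c (gam N)) N + A) / N := by
    unfold betaCrit; rw [gam_sq, cGamma_ccf]; ring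
  have hccf : 0 ≤ ccf (chc N) (kGamma 𝔎 N c (gam N)) N := by
    unfold ccf
    refine mul_nonneg (by positivity) (Finset.sum_nonneg fun w _ => ?_)
    split_ifs with h
    · exact le_rfl
    · exact mul_nonneg (sq_nonneg _) (inv_nonneg.2 (ka.ppos w h).le)
  have hβ0 : 0 ≤ betaCrit 𝔎 N c A := by
    rw [hβ]
    have : -1 ≤ (ccf (chc N) (kGamma 𝔎 N c (gam N)) N + A) / N := by
      rw [le_div_iff₀ hN0]
      have := neg_abs_le A
      linarith
    linarith
  have hchi := chi_main hD hB (chc_FC N) kh ka hXN (by linarith) (by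
    rw [mul_pow, hXN]
    calc (26 * D)^9 * X^9 ≤ X * X^9 := by gcongr; linarith
      _ = X^10 := by ring
      _ ≤ X^16 := pow_le_pow_right₀ hX1 (by norm_num)) hβ
  refine moment_le N hβ0 kh (C := C₁) (hchi.trans (le_of_eq ?_)) hk
  rw [hC₁]; ring

end IsingKac
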